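/- arXiv:1903.11635 — 3 statements merged into one kernel-verified Lean document; each statement's English description precedes it below -/
import Mathlib

section
/- There is a universal constant C > 0 such that for every n ≥ 1 and every linear threshold function f : {−1,1}^n → {−1,1} (i.e., f(x) = sign(w₀ + Σ_{i=1}^n w_i x_i) for some reals w₀, w₁, …, w_n), the Fourier entropy satisfies H(f) ≤ C·√n. -/
open Finset Real MeasureTheory ProbabilityTheory
open scoped Classical

/-- sign: maps z to 1 if z > 0 and to −1 if z ≤ 0. -/
noncomputable def sgn (z : ℝ) : ℝ := if 0 < z then 1 else -1

/-- interpret a Bool as ±1. -/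
def pm (b : Bool) : ℝ := if b then 1 else -1

/-- probability of an event under the uniform distribution on {−1,1}^n. -/
noncomputable def unifPr (n : ℕ) (E : (Fin n → Bool) → Prop) : ℝ :=
  ((Finset.univ : Finset (Fin n → Bool)).filter E).card / 2 ^ n

/-- expectation under the uniform distribution on {−1,1}^n. -/
noncomputable def unifExp (n : ℕ) (g : (Fin n → Bool) → ℝ) : ℝ :=
  (∑ x : Fin n → Bool, g x) / 2 ^ n

/-- flip the i-th coordinate. -/
def flipAt {n : ℕ} (i : Fin n) (x : Fin n → Bool) : Fin n → Bool :=
  Function.update x i (!(x i))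

/-- influence of coordinate i. -/
noncomputable def infl {n : ℕ} (f : (Fin n → Bool) → ℝ) (i : Fin n) : ℝ :=
  unifPr n (fun x => f x ≠ f (flipAt i x))

/-- total influence. -/
noncomputable def totalInfl {n : ℕ} (f : (Fin n → Bool) → ℝ) : ℝ :=
  ∑ i, infl f i

/-- Fourier coefficient f̂(S). -/
noncomputable def fCoeff {n : ℕ} (f : (Fin n → Bool) → ℝ) (S : Finset (Fin n)) : ℝ :=
  unifExp n (fun x => f x * ∏ i ∈ S, pm (x i))

/-- Fourier entropy with log base 2 (0 · log(1/0) is 0 by convention, which holds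
definitionally since `Real.log 0 = 0` in Mathlib). -/
noncomputable def fourierEntropy {n : ℕ} (f : (Fin n → Bool) → ℝ) : ℝ :=
  ∑ S : Finset (Fin n), (fCoeff f S) ^ 2 * Real.logb 2 (1 / (fCoeff f S) ^ 2)

/-- The linear threshold function with weights w₀, w₁, …, w_n. -/
noncomputable def ltf (n : ℕ) (w : Fin (n + 1) → ℝ) : (Fin n → Bool) → ℝ :=
  fun x => sgn (w 0 + ∑ i : Fin n, w i.succ * pm (x i))


/-- flip the coordinates in `T`. -/
def flipS {n : ℕ} (T : Finset (Fin n)) (x : Fin n → Bool) : Fin n → Bool :=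
  fun i => if i ∈ T then !(x i) else x i

lemma flipS_invol {n : ℕ} (T : Finset (Fin n)) : Function.Involutive (flipS T) := by
  intro x
  funext i
  by_cases h : i ∈ T <;> simp [flipS, h]

lemma sum_flipS {n : ℕ} (T : Finset (Fin n)) (g : (Fin n → Bool) → ℝ) :
    ∑ x, g (flipS T x) = ∑ x, g x :=
  Equiv.sum_comp (flipS_invol T).toPerm g

lemma pm_not (b : Bool) : pm (!b) = - pm b := by cases b <;> simp [pm]

lemma pm_flipS {n : ℕ} (T : Finset (Fin n)) (x : Fin n → Bool) (i : Fin n) :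
    pm (flipS T x i) = (if i ∈ T then -1 else 1) * pm (x i) := by
  by_cases h : i ∈ T <;> simp [flipS, h, pm_not]

/-- the sign picked up by the character `S` when flipping `T`. -/
noncomputable def aS {n : ℕ} (S T : Finset (Fin n)) : ℝ := ∏ i ∈ S, (if i ∈ T then -1 else 1)

lemma aS_sq {n : ℕ} (S T : Finset (Fin n)) : aS S T ^ 2 = 1 := by
  unfold aS
  rw [← Finset.prod_pow]
  apply Finset.prod_eq_one
  intro i _
  split_ifs <;> norm_num

lemma fCoeff_flip {n : ℕ} (f : (Fin n → Bool) → ℝ) (S T : Finset (Fin n)) :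
    fCoeff (fun x => f (flipS T x)) S = aS S T * fCoeff f S := by
  unfold fCoeff unifExp
  rw [← mul_div_assoc, ← sum_flipS T, Finset.mul_sum]
  congr 1
  apply Finset.sum_congr rfl
  intro x _
  simp only [flipS_invol T x, pm_flipS, Finset.prod_mul_distrib]
  unfold aS
  ring

lemma fCoeff_sub {n : ℕ} (f g : (Fin n → Bool) → ℝ) (S : Finset (Fin n)) :
    fCoeff (fun x => f x - g x) S = fCoeff f S - fCoeff g S := by
  unfold fCoeff unifExp
  rw [← sub_div, ← Finset.sum_sub_distrib]
  congr 1
  apply Finset.sum_congr rfl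
  intro x _
  ring

lemma char_orth {n : ℕ} (x y : Fin n → Bool) :
    ∑ S : Finset (Fin n), (∏ i ∈ S, pm (x i)) * (∏ i ∈ S, pm (y i)) =
      if x = y then 2 ^ n else 0 := by
  have h := Finset.prod_one_add (f := fun i => pm (x i) * pm (y i)) (Finset.univ : Finset (Fin n))
  rw [Finset.powerset_univ] at h
  simp only [← Finset.prod_mul_distrib]
  rw [← h]
  split_ifs with hxy
  · subst hxy
    have : ∀ i, 1 + pm (x i) * pm (x i) = 2 := by
      intro i
      cases x i <;> norm_num [pm]
    simp [this]
  · obtain ⟨i, hi⟩ := Function.ne_iff.mp hxy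
    apply Finset.prod_eq_zero (Finset.mem_univ i)
    revert hi
    cases x i <;> cases y i <;> simp [pm]

lemma parseval {n : ℕ} (f : (Fin n → Bool) → ℝ) :
    ∑ S : Finset (Fin n), fCoeff f S ^ 2 = (∑ x, f x ^ 2) / 2 ^ n := by
  have h1 : ∀ S : Finset (Fin n), fCoeff f S ^ 2 =
      (∑ x, ∑ y, f x * f y * ((∏ i ∈ S, pm (x i)) * (∏ i ∈ S, pm (y i)))) / (2 ^ n * 2 ^ n) := by
    intro S
    unfold fCoeff unifExp
    rw [div_pow, sq, Finset.sum_mul_sum, sq]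
    congr 1
    apply Finset.sum_congr rfl
    intro x _
    apply Finset.sum_congr rfl
    intro y _
    ring
  simp only [h1]
  rw [← Finset.sum_div, Finset.sum_comm]
  have h2 : ∀ x : Fin n → Bool, ∑ S : Finset (Fin n), ∑ y, f x * f y *
      ((∏ i ∈ S, pm (x i)) * (∏ i ∈ S, pm (y i))) = f x ^ 2 * 2 ^ n := by
    intro x
    rw [Finset.sum_comm]
    simp only [← Finset.mul_sum, char_orth]
    simp
    ring
  simp only [h2]
  rw [← Finset.sum_mul]
  field_simp

lemma sum_aS {n : ℕ} (f : (Fin n → Bool) → ℝ) (T : Finset (Fin n)) :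
    ∑ S : Finset (Fin n), fCoeff f S ^ 2 * (1 - aS S T) =
      (∑ x, (f x - f (flipS T x)) ^ 2) / 2 / 2 ^ n := by
  have h := parseval (fun x => f x - f (flipS T x))
  rw [div_right_comm, ← h, Finset.sum_div]
  apply Finset.sum_congr rfl
  intro S _
  rw [fCoeff_sub, fCoeff_flip]
  linear_combination (-fCoeff f S ^ 2 / 2) * aS_sq S T

lemma ltf_sq (n : ℕ) (w : Fin (n + 1) → ℝ) (x) : ltf n w x ^ 2 = 1 := by
  unfold ltf sgn
  split_ifs <;> norm_num

/-- linear form restricted to `T`. -/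
noncomputable def linT {n : ℕ} (w : Fin (n + 1) → ℝ) (T : Finset (Fin n)) (x : Fin n → Bool) : ℝ :=
  ∑ i ∈ T, w i.succ * pm (x i)

/-- odd sign of the linear form. -/
noncomputable def sT {n : ℕ} (w : Fin (n + 1) → ℝ) (T : Finset (Fin n)) (x : Fin n → Bool) : ℝ :=
  Real.sign (linT w T x)

lemma linT_flip_self {n : ℕ} (w : Fin (n + 1) → ℝ) (T : Finset (Fin n)) (x : Fin n → Bool) :
    linT w T (flipS T x) = - linT w T x := by
  unfold linT
  rw [← Finset.sum_neg_distrib]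
  apply Finset.sum_congr rfl
  intro i hi
  rw [pm_flipS, if_pos hi]; ring

lemma linT_flip_disj {n : ℕ} (w : Fin (n + 1) → ℝ) (T U : Finset (Fin n)) (h : Disjoint T U)
    (x : Fin n → Bool) :
    linT w U (flipS T x) = linT w U x := by
  unfold linT
  apply Finset.sum_congr rfl
  intro i hi
  rw [pm_flipS, if_neg (Finset.disjoint_right.mp h hi)]; ring

lemma ltf_flip_diff {n : ℕ} (w : Fin (n + 1) → ℝ) (T : Finset (Fin n)) (x : Fin n → Bool) :
    (ltf n w x - ltf n w (flipS T x)) ^ 2 =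
      2 * ((ltf n w x - ltf n w (flipS T x)) * sT w T x) := by
  have hd : ∀ y : Fin n → Bool, ∑ i : Fin n, w i.succ * pm (y i) = linT w T y + linT w Tᶜ y := by
    intro y
    unfold linT
    exact (Finset.sum_add_sum_compl T _).symm
  have hc : linT w Tᶜ (flipS T x) = linT w Tᶜ x :=
    linT_flip_disj w T _ disjoint_compl_right x
  unfold ltf sT
  rw [hd x, hd (flipS T x), hc, linT_flip_self]
  unfold sgn
  rcases lt_trichotomy (linT w T x) 0 with h | h | h
  · rw [Real.sign_of_neg h]
    split_ifs
    · norm_num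
    · exfalso; linarith
    · norm_num
    · norm_num
  · rw [h]; simp
  · rw [Real.sign_of_pos h]
    split_ifs
    · norm_num
    · norm_num
    · exfalso; linarith
    · norm_num

lemma sum_flip_diff {n : ℕ} (w : Fin (n + 1) → ℝ) (T : Finset (Fin n)) :
    ∑ x, (ltf n w x - ltf n w (flipS T x)) ^ 2 = 4 * ∑ x, ltf n w x * sT w T x := by
  have h1 : ∑ x, ltf n w (flipS T x) * sT w T x = - ∑ x, ltf n w x * sT w T x := by
    rw [← sum_flipS T, ← Finset.sum_neg_distrib]
    apply Finset.sum_congr rfl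
    intro x _
    rw [flipS_invol T x]
    unfold sT
    rw [linT_flip_self, Real.sign_neg]
    ring
  simp only [ltf_flip_diff]
  rw [← Finset.mul_sum]
  simp only [sub_mul]
  rw [Finset.sum_sub_distrib, h1]
  ring

lemma sT_sq_le {n : ℕ} (w : Fin (n + 1) → ℝ) (T : Finset (Fin n)) (x) : sT w T x * sT w T x ≤ 1 := by
  unfold sT
  rcases Real.sign_apply_eq (linT w T x) with h | h | h <;> rw [h] <;> norm_num

lemma sT_orth {n : ℕ} (w : Fin (n + 1) → ℝ) (T U : Finset (Fin n)) (h : Disjoint T U) :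
    ∑ x, sT w T x * sT w U x = 0 := by
  have h1 : ∑ x, sT w T x * sT w U x = - ∑ x, sT w T x * sT w U x := by
    conv_lhs => rw [← sum_flipS T]
    rw [← Finset.sum_neg_distrib]
    apply Finset.sum_congr rfl
    intro x _
    unfold sT
    rw [linT_flip_self, linT_flip_disj w T U h, Real.sign_neg]
    ring
  linarith

lemma block_bound {n m : ℕ} (w : Fin (n + 1) → ℝ) (T : Fin m → Finset (Fin n))
    (hT : ∀ j l, j ≠ l → Disjoint (T j) (T l)) :
    ∑ j, ∑ x, ltf n w x * sT w (T j) x ≤ 2 ^ n * Real.sqrt m := by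
  rw [Finset.sum_comm]
  simp only [← Finset.mul_sum]
  have hcs := Finset.sum_mul_sq_le_sq_mul_sq (Finset.univ) (ltf n w) (fun x => ∑ j, sT w (T j) x)
  have h1 : ∑ x, ltf n w x ^ 2 = 2 ^ n := by simp [ltf_sq]
  have h2 : ∑ x, (∑ j, sT w (T j) x) ^ 2 ≤ 2 ^ n * m := by
    simp only [sq, Finset.sum_mul_sum]
    rw [Finset.sum_comm]
    calc _ ≤ ∑ j : Fin m, (2:ℝ) ^ n := by
          apply Finset.sum_le_sum
          intro j _
          rw [Finset.sum_comm, Finset.sum_eq_single j]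
          · calc _ ≤ ∑ x : Fin n → Bool, (1:ℝ) := Finset.sum_le_sum fun x _ => sT_sq_le w (T j) x
              _ = _ := by simp
          · intro l _ hl
            exact sT_orth w _ _ (hT j l hl.symm)
          · simp
      _ = _ := by simp; ring
  rw [h1] at hcs
  apply abs_le_of_sq_le_sq' _ (by positivity) |>.2
  rw [mul_pow, Real.sq_sqrt (by positivity)]
  calc _ ≤ _ := hcs
    _ ≤ (2:ℝ) ^ n * (2 ^ n * m) := by gcongr
    _ = _ := by ring

lemma fourier_block {n m : ℕ} (w : Fin (n + 1) → ℝ) (ρ : Fin n → Fin m) :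
    ∑ S : Finset (Fin n), fCoeff (ltf n w) S ^ 2 *
      ∑ j, (1 - aS S (Finset.univ.filter fun i => ρ i = j)) ≤ 2 * Real.sqrt m := by
  simp only [Finset.mul_sum]
  rw [Finset.sum_comm]
  simp only [sum_aS, sum_flip_diff]
  have := block_bound w (fun j => Finset.univ.filter fun i => ρ i = j) (by
    intro j l hjl
    rw [Finset.disjoint_left]
    intro i h1 h2
    simp at h1 h2
    exact hjl (h1.symm.trans h2))
  rw [← Finset.sum_div, ← Finset.sum_div, ← Finset.mul_sum, div_le_iff₀ (by positivity)]
  linarith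

lemma avg_aS {n m : ℕ} (S : Finset (Fin n)) (j : Fin m) :
    ∑ ρ : Fin n → Fin m, aS S (Finset.univ.filter fun i => ρ i = j) =
      (m : ℝ) ^ n * (1 - 2 / m) ^ S.card := by
  have hm : (m : ℝ) ≠ 0 := by
    have := j.pos
    positivity
  have h1 : ∀ ρ : Fin n → Fin m, aS S (Finset.univ.filter fun i => ρ i = j) =
      ∏ i, (if i ∈ S then (if ρ i = j then (-1:ℝ) else 1) else 1) := by
    intro ρ
    unfold aS
    simp [Finset.prod_ite_mem]
  simp only [h1]
  have h2 := Finset.prod_univ_sum (fun _ : Fin n => (Finset.univ : Finset (Fin m)))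
    (fun i l => (if i ∈ S then (if l = j then (-1:ℝ) else 1) else 1))
  rw [Fintype.piFinset_univ] at h2
  rw [← h2]
  have h3 : ∀ i : Fin n, ∑ l : Fin m, (if i ∈ S then (if l = j then (-1:ℝ) else 1) else 1) =
      m * (if i ∈ S then (1 - 2 / (m:ℝ)) else 1) := by
    intro i
    split_ifs
    · have : ∀ l : Fin m, (if l = j then (-1:ℝ) else 1) = 1 - if l = j then 2 else 0 := by
        intro l; split_ifs <;> norm_num
      simp only [this]
      rw [Finset.sum_sub_distrib]
      simp
      field_simp
    · simp
  simp only [h3]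
  rw [Finset.prod_mul_distrib, Finset.prod_ite_mem]
  simp

lemma noise_bound {n m : ℕ} (hm : 2 ≤ m) (w : Fin (n + 1) → ℝ) :
    ∑ S : Finset (Fin n), fCoeff (ltf n w) S ^ 2 * (m * (1 - (1 - 2 / (m:ℝ)) ^ S.card))
      ≤ 2 * Real.sqrt m := by
  have hm0 : (0:ℝ) < m := by positivity
  have h := Finset.sum_le_sum fun (ρ : Fin n → Fin m) (_ : ρ ∈ Finset.univ) => fourier_block w ρ
  rw [Finset.sum_comm] at h
  simp only [← Finset.mul_sum] at h
  have h1 : ∀ S : Finset (Fin n), ∑ ρ : Fin n → Fin m,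
      ∑ j, (1 - aS S (Finset.univ.filter fun i => ρ i = j)) =
      (m:ℝ) ^ n * (m * (1 - (1 - 2 / (m:ℝ)) ^ S.card)) := by
    intro S
    rw [Finset.sum_comm]
    simp only [Finset.sum_sub_distrib, avg_aS]
    simp
    ring
  simp only [h1] at h
  simp only [Finset.sum_const, Finset.card_univ, Fintype.card_pi, Fintype.card_fin,
    Finset.prod_const, nsmul_eq_mul] at h
  have h2 : ∀ S : Finset (Fin n), fCoeff (ltf n w) S ^ 2 *
      ((m:ℝ) ^ n * (m * (1 - (1 - 2 / (m:ℝ)) ^ S.card))) = (m:ℝ)^n * (fCoeff (ltf n w) S ^ 2 *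
      (m * (1 - (1 - 2 / (m:ℝ)) ^ S.card))) := by intro S; ring
  simp only [h2] at h
  rw [← Finset.mul_sum] at h
  push_cast at h
  refine le_of_mul_le_mul_left (a := (m:ℝ) ^ n) (h.trans (le_of_eq ?_)) (by positivity)
  ring

/-- `m (1-(1-2/m)^k) ≥ (2/3) k` for `k ≤ m`. -/
lemma noise_lower {m k : ℕ} (hm : 2 ≤ m) (hk : k ≤ m) :
    2 / 3 * (k:ℝ) ≤ m * (1 - (1 - 2 / (m:ℝ)) ^ k) := by
  have hm0 : (0:ℝ) < m := by positivity
  have hm2 : (2:ℝ) ≤ m := by exact_mod_cast hm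
  have hk' : (k:ℝ) ≤ m := by exact_mod_cast hk
  have h0 : 0 ≤ 1 - 2 / (m:ℝ) := by
    rw [sub_nonneg, div_le_one hm0]; exact hm2
  have h1 : (1 - 2 / (m:ℝ)) ^ k * (1 + k * (2 / m)) ≤ 1 := by
    calc _ ≤ (1 - 2 / (m:ℝ)) ^ k * (1 + 2 / m) ^ k := by
          gcongr
          exact one_add_mul_le_pow (by have : 0 < 2 / (m:ℝ) := by positivity
                                       linarith) k
      _ = ((1 - 2 / (m:ℝ)) * (1 + 2 / m)) ^ k := by rw [mul_pow]
      _ ≤ 1 := by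
          apply pow_le_one₀
          · positivity
          · nlinarith [sq_nonneg (2 / (m:ℝ))]
  set a := (1 - 2 / (m:ℝ)) ^ k with ha
  have ha0 : 0 ≤ a := by positivity
  have h2 : a * (m + 2 * k) ≤ m := by
    have : a * (m + 2 * k) = m * (a * (1 + k * (2 / m))) := by field_simp
    rw [this]; nlinarith
  have h3 : a * (m + 2 * k) = a * (m + 2 * k) := rfl
  have hk0 : (0:ℝ) ≤ k := by positivity
  -- m(1-a) ≥ 2ak ; and m(1-a)(m+2k) ≥ 2km
  have h4 : 2 * k * m ≤ m * (1 - a) * (m + 2 * k) := by nlinarith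
  have h5 : m * (1 - a) * (m + 2 * k) ≤ m * (1 - a) * (3 * m) := by
    have : 0 ≤ 1 - a := by
      have : a ≤ 1 := pow_le_one₀ h0 (by have : 0 < 2 / (m:ℝ) := by positivity
                                         linarith)
      linarith
    gcongr
    linarith
  have h6 : (2 / 3 * (k:ℝ)) * (3 * m) ≤ m * (1 - a) * (3 * m) := by linarith
  exact le_of_mul_le_mul_right h6 (by positivity)

lemma choose_bound {n k a J : ℕ} (hk : 1 ≤ k) (hn : n ≤ 2 ^ J) (ha : 2 ^ a ≤ 2 * k)
    (haJ : a < J + 1) : (n.choose k : ℝ) ≤ 2 ^ (k * (J + 3 - a)) := by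
  have hk0 : (0:ℝ) < k := by exact_mod_cast hk
  have h1 : (n.choose k : ℝ) ≤ (n:ℝ) ^ k / k.factorial := Nat.choose_le_pow_div k n
  have h2 : (k:ℝ) ^ k / k.factorial ≤ Real.exp k := Real.pow_div_factorial_le_exp k hk0.le k
  have h3 : Real.exp k ≤ 4 ^ k := by
    rw [← Real.exp_one_pow]
    have := Real.exp_one_lt_d9
    gcongr
    linarith
  have h4 : (k:ℝ) ^ k ≤ 4 ^ k * k.factorial := by
    rw [div_le_iff₀ (by positivity)] at h2
    exact h2.trans (by gcongr)
  have h5 : (n:ℝ) ≤ 2 ^ J := by exact_mod_cast hn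
  have h6 : (2:ℝ) ^ a ≤ 2 * k := by exact_mod_cast ha
  have h7 : 4 * (n:ℝ) ≤ 2 ^ (J + 3 - a) * k := by
    have e : (2:ℝ) ^ (J + 3 - a) * 2 ^ a = 8 * 2 ^ J := by
      rw [← pow_add, Nat.sub_add_cancel (by omega)]; ring
    have : (2:ℝ) ^ (J + 3 - a) * 2 ^ a ≤ 2 ^ (J + 3 - a) * (2 * k) := by gcongr
    linarith
  refine h1.trans ?_
  rw [div_le_iff₀ (by positivity), mul_comm k, pow_mul]
  have h8 : (4 * (n:ℝ)) ^ k ≤ (2 ^ (J + 3 - a) * k) ^ k := by gcongr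
  rw [mul_pow, mul_pow] at h8
  have h9 : (4:ℝ) ^ k * n ^ k ≤ 4 ^ k * ((2 ^ (J + 3 - a)) ^ k * k.factorial) := by
    calc _ ≤ _ := h8
      _ ≤ ((2:ℝ) ^ (J + 3 - a)) ^ k * (4 ^ k * k.factorial) := by gcongr
      _ = _ := by ring
  exact le_of_mul_le_mul_left h9 (by positivity)

/-- the noise weights -/
noncomputable def nw (m k : ℕ) : ℝ := m * (1 - (1 - 2 / (m:ℝ)) ^ k)

lemma nw_nonneg {m k : ℕ} (hm : 2 ≤ m) : 0 ≤ nw m k := by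
  unfold nw
  have hm0 : (0:ℝ) < m := by positivity
  have hm2 : (2:ℝ) ≤ m := by exact_mod_cast hm
  have h0 : 0 ≤ 1 - 2 / (m:ℝ) := by
    rw [sub_nonneg, div_le_one hm0]; exact hm2
  have : (1 - 2 / (m:ℝ)) ^ k ≤ 1 := pow_le_one₀ h0 (by
    have : 0 < 2 / (m:ℝ) := by positivity
    linarith)
  apply mul_nonneg hm0.le
  linarith

lemma logb_choose_bound {n k J : ℕ} (hkn : k ≤ n) (hn : n ≤ 2 ^ J) :
    Real.logb 2 (n.choose k) ≤ 6 * ∑ j ∈ Finset.Icc 1 (J + 1), nw (2 ^ j) k := by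
  have hnn : ∀ j ∈ Finset.Icc 1 (J + 1), 0 ≤ nw (2 ^ j) k := by
    intro j hj
    apply nw_nonneg
    rw [Finset.mem_Icc] at hj
    calc 2 = 2 ^ 1 := rfl
      _ ≤ 2 ^ j := Nat.pow_le_pow_right (by norm_num) hj.1
  rcases Nat.eq_zero_or_pos k with rfl | hk
  · simp
    exact Finset.sum_nonneg hnn
  set a := Nat.clog 2 k with ha
  have hka : k ≤ 2 ^ a := Nat.le_pow_clog (by norm_num) k
  have haJ : a ≤ J := Nat.clog_le_of_le_pow (hkn.trans hn)
  have ha2 : 2 ^ a ≤ 2 * k := by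
    rcases Nat.eq_zero_or_pos a with h0 | h0
    · rw [h0]; omega
    · have hk1 : 1 < k := by
        by_contra hh
        have : k = 1 := by omega
        rw [this] at ha
        simp at ha
        omega
      have := Nat.pow_pred_clog_lt_self (b := 2) (by norm_num) hk1
      rw [← ha] at this
      have e : 2 ^ a = 2 * 2 ^ (a - 1) := by
        rw [← pow_succ']; congr 1; omega
      rw [Nat.pred_eq_sub_one] at this
      omega
  have hc : (0:ℝ) < n.choose k := by exact_mod_cast Nat.choose_pos hkn
  have h1 : Real.logb 2 (n.choose k) ≤ (k * (J + 3 - a) : ℕ) := by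
    rw [Real.logb_le_iff_le_rpow (by norm_num) hc, Real.rpow_natCast]
    exact choose_bound hk hn ha2 (by omega)
  have h2 : ∑ j ∈ Finset.Icc (a + 1) (J + 1), nw (2 ^ j) k ≤
      ∑ j ∈ Finset.Icc 1 (J + 1), nw (2 ^ j) k := by
    apply Finset.sum_le_sum_of_subset_of_nonneg
    · apply Finset.Icc_subset_Icc <;> omega
    · intro j hj _; exact hnn j hj
  have h3 : ∑ j ∈ Finset.Icc (a + 1) (J + 1), (2 / 3 * (k:ℝ)) ≤
      ∑ j ∈ Finset.Icc (a + 1) (J + 1), nw (2 ^ j) k := by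
    apply Finset.sum_le_sum
    intro j hj
    rw [Finset.mem_Icc] at hj
    apply noise_lower
    · calc 2 = 2 ^ 1 := rfl
        _ ≤ 2 ^ j := Nat.pow_le_pow_right (by norm_num) (by omega)
    · exact hka.trans (Nat.pow_le_pow_right (by norm_num) (by omega))
  rw [Finset.sum_const, Nat.card_Icc, nsmul_eq_mul] at h3
  have h4 : ((k * (J + 3 - a) : ℕ) : ℝ) ≤ 6 * (((J + 1 + 1 - (a + 1) : ℕ) : ℝ) * (2 / 3 * k)) := by
    have : k * (J + 3 - a) ≤ k * (4 * (J + 1 + 1 - (a + 1))) := Nat.mul_le_mul_left k (by omega)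
    have h' : ((k * (J + 3 - a) : ℕ) : ℝ) ≤ ((k * (4 * (J + 1 + 1 - (a + 1))) : ℕ) : ℝ) := by
      exact_mod_cast this
    refine h'.trans (le_of_eq ?_)
    rw [Nat.cast_mul, Nat.cast_mul]
    push_cast
    ring
  linarith

lemma geom_sqrt (J : ℕ) : ∑ j ∈ Finset.Icc 1 J, Real.sqrt ((2 ^ j : ℕ) : ℝ) ≤
    4 * Real.sqrt ((2 ^ J : ℕ) : ℝ) := by
  induction J with
  | zero => simp
  | succ J ih =>
    rw [Finset.sum_Icc_succ_top (by omega)]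
    have e : Real.sqrt ((2 ^ (J + 1) : ℕ) : ℝ) = Real.sqrt 2 * Real.sqrt ((2 ^ J : ℕ) : ℝ) := by
      rw [← Real.sqrt_mul (by norm_num)]
      congr 1
      push_cast
      ring
    have h2 : (4:ℝ) / 3 ≤ Real.sqrt 2 := Real.le_sqrt_of_sq_le (by norm_num)
    have h0 := Real.sqrt_nonneg ((2 ^ J : ℕ) : ℝ)
    rw [e]
    nlinarith

lemma gibbs_term {p q : ℝ} (hp : 0 ≤ p) (hq : 0 < q) :
    p * Real.logb 2 (1 / p) ≤ p * Real.logb 2 (1 / q) + (q - p) / Real.log 2 := by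
  have hl : 0 < Real.log 2 := Real.log_pos (by norm_num)
  rcases hp.eq_or_lt with rfl | hp
  · simp; positivity
  unfold Real.logb
  rw [← mul_div_assoc, ← mul_div_assoc, ← add_div]
  gcongr
  have h := Real.log_le_sub_one_of_pos (div_pos hq hp)
  rw [Real.log_div hq.ne' hp.ne'] at h
  rw [one_div, one_div, Real.log_inv, Real.log_inv]
  have h' := mul_le_mul_of_nonneg_left h hp.le
  have e : p * (q / p - 1) = q - p := by field_simp
  rw [e] at h'
  linarith

lemma sum_q (n : ℕ) : ∑ S : Finset (Fin n), 1 / (((n:ℝ) + 1) * n.choose S.card) = 1 := by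
  rw [← Finset.powerset_univ, Finset.sum_powerset_apply_card
    (fun k => 1 / (((n:ℝ) + 1) * n.choose k))]
  simp only [Finset.card_univ, Fintype.card_fin, nsmul_eq_mul]
  have : ∀ k ∈ Finset.range (n + 1), (n.choose k : ℝ) * (1 / (((n:ℝ) + 1) * n.choose k)) =
      1 / ((n:ℝ) + 1) := by
    intro k hk
    have : (n.choose k : ℝ) ≠ 0 := by
      have := Nat.choose_pos (Nat.lt_succ_iff.mp (Finset.mem_range.mp hk))
      positivity
    field_simp
  rw [Finset.sum_congr rfl this]
  simp
  field_simp

lemma entropy_levels {n : ℕ} (w : Fin (n + 1) → ℝ) :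
    fourierEntropy (ltf n w) ≤ Real.logb 2 (n + 1) +
      ∑ S : Finset (Fin n), fCoeff (ltf n w) S ^ 2 * Real.logb 2 (n.choose S.card) := by
  have hP : ∑ S : Finset (Fin n), fCoeff (ltf n w) S ^ 2 = 1 := by
    rw [parseval]; simp [ltf_sq]
  have hc : ∀ S : Finset (Fin n), (0:ℝ) < n.choose S.card := by
    intro S
    have := Nat.choose_pos (by simpa using Finset.card_le_univ S : S.card ≤ n)
    exact_mod_cast this
  have hn : (0:ℝ) < (n:ℝ) + 1 := by positivity
  unfold fourierEntropy
  calc _ ≤ ∑ S : Finset (Fin n), (fCoeff (ltf n w) S ^ 2 *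
        Real.logb 2 (1 / (1 / (((n:ℝ) + 1) * n.choose S.card))) +
        (1 / (((n:ℝ) + 1) * n.choose S.card) - fCoeff (ltf n w) S ^ 2) / Real.log 2) := by
        apply Finset.sum_le_sum
        intro S _
        apply gibbs_term (sq_nonneg _)
        have := hc S
        positivity
    _ = ∑ S : Finset (Fin n), (fCoeff (ltf n w) S ^ 2 * Real.logb 2 (n + 1) +
        fCoeff (ltf n w) S ^ 2 * Real.logb 2 (n.choose S.card)) := by
        rw [Finset.sum_add_distrib, ← Finset.sum_div, Finset.sum_sub_distrib, sum_q, hP]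
        simp only [sub_self, zero_div, add_zero]
        apply Finset.sum_congr rfl
        intro S _
        rw [one_div_one_div, Real.logb_mul hn.ne' (hc S).ne']
        ring
    _ = _ := by
        rw [Finset.sum_add_distrib, ← Finset.sum_mul, hP, one_mul]

lemma logb_succ_le {n : ℕ} (hn : 1 ≤ n) : Real.logb 2 ((n:ℝ) + 1) ≤ 8 * Real.sqrt n := by
  have hn1 : (1:ℝ) ≤ n := by exact_mod_cast hn
  have hs : 1 ≤ Real.sqrt n := Real.one_le_sqrt.mpr hn1
  have hsq : Real.sqrt n ^ 2 = n := Real.sq_sqrt (by positivity)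
  have h1 : Real.log ((n:ℝ) + 1) ≤ 4 * Real.sqrt n := by
    have h2 : Real.log ((n:ℝ) + 1) ≤ Real.log ((2 * Real.sqrt n) ^ 2) := by
      apply Real.log_le_log (by positivity)
      rw [mul_pow, hsq]; linarith
    rw [Real.log_pow] at h2
    have h3 := Real.log_le_sub_one_of_pos (x := 2 * Real.sqrt n) (by positivity)
    push_cast at h2
    linarith
  have hl : 1 / 2 ≤ Real.log 2 := by
    have := Real.log_two_gt_d9
    linarith
  unfold Real.logb
  rw [div_le_iff₀ (by linarith)]
  nlinarith

/-- Fourier entropy of every LTF is at most C·√n. -/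
theorem fei_entropy_sqrt_bound :
    ∃ C : ℝ, 0 < C ∧ ∀ n : ℕ, 1 ≤ n → ∀ w : Fin (n + 1) → ℝ,
      fourierEntropy (ltf n w) ≤ C * Real.sqrt n := by
  refine ⟨104, by norm_num, ?_⟩
  intro n hn w
  set J := Nat.clog 2 n with hJ
  have hnJ : n ≤ 2 ^ J := Nat.le_pow_clog (by norm_num) n
  have hJ2 : 2 ^ (J + 1) ≤ 4 * n := by
    rcases Nat.lt_or_ge 1 n with h | h
    · have := Nat.pow_pred_clog_lt_self (b := 2) (by norm_num) h
      rw [← hJ] at this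
      have hJ0 : 0 < J := Nat.clog_pos (by norm_num) h
      have e : 2 ^ (J + 1) = 4 * 2 ^ J.pred := by
        obtain ⟨K, hK⟩ := Nat.exists_eq_succ_of_ne_zero hJ0.ne'
        rw [hK]
        simp only [Nat.pred_succ, Nat.succ_eq_add_one]
        ring
      omega
    · have : n = 1 := by omega
      rw [this] at hJ
      simp at hJ
      rw [hJ, this]; norm_num
  have h1 : ∑ S : Finset (Fin n), fCoeff (ltf n w) S ^ 2 * Real.logb 2 (n.choose S.card) ≤
      6 * ∑ j ∈ Finset.Icc 1 (J + 1), ∑ S : Finset (Fin n),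
        fCoeff (ltf n w) S ^ 2 * nw (2 ^ j) S.card := by
    rw [Finset.sum_comm, Finset.mul_sum]
    apply Finset.sum_le_sum
    intro S _
    rw [← Finset.mul_sum]
    have := logb_choose_bound (by simpa using Finset.card_le_univ S : S.card ≤ n) hnJ
    nlinarith [sq_nonneg (fCoeff (ltf n w) S), mul_le_mul_of_nonneg_left this
      (sq_nonneg (fCoeff (ltf n w) S))]
  have h2 : ∑ j ∈ Finset.Icc 1 (J + 1), ∑ S : Finset (Fin n),
        fCoeff (ltf n w) S ^ 2 * nw (2 ^ j) S.card ≤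
      ∑ j ∈ Finset.Icc 1 (J + 1), 2 * Real.sqrt ((2 ^ j : ℕ) : ℝ) := by
    apply Finset.sum_le_sum
    intro j hj
    rw [Finset.mem_Icc] at hj
    apply noise_bound
    calc 2 = 2 ^ 1 := rfl
      _ ≤ 2 ^ j := Nat.pow_le_pow_right (by norm_num) hj.1
  rw [← Finset.mul_sum] at h2
  have h3 := geom_sqrt (J + 1)
  have h4 : Real.sqrt ((2 ^ (J + 1) : ℕ) : ℝ) ≤ 2 * Real.sqrt n := by
    apply Real.sqrt_le_iff.mpr
    refine ⟨by positivity, ?_⟩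
    rw [mul_pow, Real.sq_sqrt (by positivity)]
    have : ((2 ^ (J + 1) : ℕ) : ℝ) ≤ ((4 * n : ℕ) : ℝ) := by exact_mod_cast hJ2
    push_cast at this ⊢
    linarith
  have h5 := entropy_levels w
  have h6 := logb_succ_le hn
  linarith
end

section
/- Let n ≥ 2, let w₁, …, w_n be real numbers, let i ∈ {1,…,n} be such that Σ_{j≠i} w_j² > 0, and let α > 0. Set A_i = (1/(n−1))·Σ_{1≤j≤n, j≠i} |w_j|³ and B_i = (1/(n−1))·Σ_{1≤j≤n, j≠i} w_j². Then (1/2)·Pr_{x uniform on {−1,1}^n}[ |Σ_{1≤j≤n, j≠i} w_j x_j| ≤ α ] ≥ (1/√(2π(n−1)B_i))·(α − A_i/B_i) − α³/(6√(2π)·((n−1)B_i)^{3/2}) − 3.4106·A_i^{4/3}/((n−1)^{2/3}·B_i²). -/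
open Finset Real MeasureTheory ProbabilityTheory
open scoped Classical

lemma ra_sin_ge {x : ℝ} (h0 : 0 ≤ x) (h1 : x ≤ π) : x * (1 - x / π) ≤ sin x := by
  have hp := Real.pi_pos
  have key : ∀ z : ℝ, 0 ≤ z → z ≤ π / 2 → z * (1 - z / π) ≤ sin z := by
    intro z hz0 hz1
    have hd : ∀ t : ℝ, HasDerivAt (fun t => sin t - t * (1 - t / π))
        (cos t - (1 * (1 - t / π) + t * (0 - 1 / π))) t := by
      intro t
      exact (Real.hasDerivAt_sin t).sub ((hasDerivAt_id t).mul
        ((hasDerivAt_const t (1:ℝ)).sub ((hasDerivAt_id t).div_const π)))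
    have hm : MonotoneOn (fun t => sin t - t * (1 - t / π)) (Set.Icc 0 (π / 2)) := by
      apply monotoneOn_of_deriv_nonneg (convex_Icc _ _)
      · exact fun t _ => (hd t).continuousAt.continuousWithinAt
      · exact fun t _ => (hd t).differentiableAt.differentiableWithinAt
      · intro t ht
        rw [interior_Icc] at ht
        rw [(hd t).deriv]
        have := Real.one_sub_mul_le_cos ht.1.le ht.2.le
        have e : (1 * (1 - t / π) + t * (0 - 1 / π)) = 1 - 2 / π * t := by ring
        linarith
    have := hm (Set.mem_Icc.2 ⟨le_refl 0, by linarith⟩) (Set.mem_Icc.2 ⟨hz0, hz1⟩) hz0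
    simp at this
    linarith
  rcases le_total x (π / 2) with h | h
  · exact key x h0 h
  · have := key (π - x) (by linarith) (by linarith)
    rw [Real.sin_pi_sub] at this
    have e : (π - x) * (1 - (π - x) / π) = x * (1 - x / π) := by field_simp; ring
    linarith

lemma ra_xcos_le {x : ℝ} (h0 : 0 ≤ x) (h1 : x ≤ π) : x * cos x ≤ sin x := by
  have hd : ∀ t : ℝ, HasDerivAt (fun t => sin t - t * cos t)
      (cos t - (1 * cos t + t * (- sin t))) t := by
    intro t
    exact (Real.hasDerivAt_sin t).sub ((hasDerivAt_id t).mul (Real.hasDerivAt_cos t))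
  have hm : MonotoneOn (fun t => sin t - t * cos t) (Set.Icc 0 π) := by
    apply monotoneOn_of_deriv_nonneg (convex_Icc _ _)
    · exact fun t _ => (hd t).continuousAt.continuousWithinAt
    · exact fun t _ => (hd t).differentiableAt.differentiableWithinAt
    · intro t ht
      rw [interior_Icc] at ht
      rw [(hd t).deriv]
      have := mul_nonneg ht.1.le (Real.sin_nonneg_of_nonneg_of_le_pi ht.1.le ht.2.le)
      linarith
  have := hm (Set.mem_Icc.2 ⟨le_refl 0, Real.pi_pos.le⟩) (Set.mem_Icc.2 ⟨h0, h1⟩) h0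
  simp at this
  linarith

lemma ra_sin_sub_xcos {x : ℝ} (h0 : 0 ≤ x) : sin x - x * cos x ≤ x ^ 3 / 3 := by
  have hd : ∀ t : ℝ, HasDerivAt (fun t => t ^ 3 / 3 - (sin t - t * cos t))
      ((3:ℕ) * t ^ 2 / 3 - (cos t - (1 * cos t + t * (- sin t)))) t := by
    intro t
    exact ((hasDerivAt_pow 3 t).div_const 3).sub
      ((Real.hasDerivAt_sin t).sub ((hasDerivAt_id t).mul (Real.hasDerivAt_cos t)))
  have hm : MonotoneOn (fun t => t ^ 3 / 3 - (sin t - t * cos t)) (Set.Ici 0) := by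
    apply monotoneOn_of_deriv_nonneg (convex_Ici _)
    · exact fun t _ => (hd t).continuousAt.continuousWithinAt
    · exact fun t _ => (hd t).differentiableAt.differentiableWithinAt
    · intro t ht
      rw [interior_Ici] at ht
      rw [(hd t).deriv]
      have ht : 0 < t := ht
      have := mul_le_mul_of_nonneg_left (Real.sin_le ht.le) ht.le
      push_cast
      nlinarith
  have := hm (Set.mem_Ici.2 (le_refl 0)) (Set.mem_Ici.2 h0) h0
  simp at this
  linarith

lemma ra_sin_ge_cubic {x : ℝ} (h0 : 0 ≤ x) : x - x ^ 3 / 6 ≤ sin x := by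
  have hd : ∀ t : ℝ, HasDerivAt (fun t => sin t - (t - t ^ 3 / 6))
      (cos t - (1 - (3:ℕ) * t ^ 2 / 6)) t := by
    intro t
    exact (Real.hasDerivAt_sin t).sub ((hasDerivAt_id t).sub ((hasDerivAt_pow 3 t).div_const 6))
  have hm : MonotoneOn (fun t => sin t - (t - t ^ 3 / 6)) (Set.Ici 0) := by
    apply monotoneOn_of_deriv_nonneg (convex_Ici _)
    · exact fun t _ => (hd t).continuousAt.continuousWithinAt
    · exact fun t _ => (hd t).differentiableAt.differentiableWithinAt
    · intro t ht
      rw [(hd t).deriv]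
      have := Real.one_sub_sq_div_two_le_cos (x := t)
      push_cast
      linarith
  have := hm (Set.mem_Ici.2 (le_refl 0)) (Set.mem_Ici.2 h0) h0
  simp at this
  linarith

lemma ra_cos_le_quartic (x : ℝ) : cos x ≤ 1 - x ^ 2 / 2 + x ^ 4 / 24 := by
  have key : ∀ x : ℝ, 0 ≤ x → cos x ≤ 1 - x ^ 2 / 2 + x ^ 4 / 24 := by
    intro x h0
    have hd : ∀ t : ℝ, HasDerivAt (fun t => 1 - t ^ 2 / 2 + t ^ 4 / 24 - cos t)
        (0 - (2:ℕ) * t ^ 1 / 2 + (4:ℕ) * t ^ 3 / 24 - (- sin t)) t := by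
      intro t
      exact (((hasDerivAt_const t (1:ℝ)).sub ((hasDerivAt_pow 2 t).div_const 2)).add
        ((hasDerivAt_pow 4 t).div_const 24)).sub (Real.hasDerivAt_cos t)
    have hm : MonotoneOn (fun t => 1 - t ^ 2 / 2 + t ^ 4 / 24 - cos t) (Set.Ici 0) := by
      apply monotoneOn_of_deriv_nonneg (convex_Ici _)
      · exact fun t _ => (hd t).continuousAt.continuousWithinAt
      · exact fun t _ => (hd t).differentiableAt.differentiableWithinAt
      · intro t ht
        rw [interior_Ici] at ht
        rw [(hd t).deriv]
        have ht : 0 < t := ht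
        have := ra_sin_ge_cubic ht.le
        push_cast
        nlinarith
    have := hm (Set.mem_Ici.2 (le_refl 0)) (Set.mem_Ici.2 h0) h0
    simp at this
    linarith
  rcases le_total 0 x with h | h
  · exact key x h
  · have := key (-x) (by linarith)
    rw [Real.cos_neg] at this
    have e1 : (-x) ^ 2 = x ^ 2 := by ring
    have e2 : (-x) ^ 4 = x ^ 4 := by ring
    rwa [e1, e2] at this

lemma ra_exp_neg_le {x : ℝ} (h0 : 0 ≤ x) : exp (-x) ≤ 1 - x + x ^ 2 / 2 := by
  have hd : ∀ t : ℝ, HasDerivAt (fun t => 1 - t + t ^ 2 / 2 - exp (-t))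
      (0 - 1 + (2:ℕ) * t ^ 1 / 2 - (exp (-t) * (-1))) t := by
    intro t
    exact (((hasDerivAt_const t (1:ℝ)).sub (hasDerivAt_id t)).add
      ((hasDerivAt_pow 2 t).div_const 2)).sub ((hasDerivAt_neg t).exp)
  have hm : MonotoneOn (fun t => 1 - t + t ^ 2 / 2 - exp (-t)) (Set.Ici 0) := by
    apply monotoneOn_of_deriv_nonneg (convex_Ici _)
    · exact fun t _ => (hd t).continuousAt.continuousWithinAt
    · exact fun t _ => (hd t).differentiableAt.differentiableWithinAt
    · intro t ht
      rw [(hd t).deriv]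
      have := Real.add_one_le_exp (-t)
      push_cast
      linarith
  have := hm (Set.mem_Ici.2 (le_refl 0)) (Set.mem_Ici.2 h0) h0
  simp at this
  linarith

lemma ra_cos_sub_exp (v : ℝ) : |cos v - exp (-(v ^ 2 / 2))| ≤ v ^ 4 / 8 := by
  have h1 := ra_cos_le_quartic v
  have h2 := Real.one_sub_sq_div_two_le_cos (x := v)
  have h3 := ra_exp_neg_le (x := v ^ 2 / 2) (by positivity)
  have h4 := Real.add_one_le_exp (-(v ^ 2 / 2))
  have h5 : 0 ≤ v ^ 4 := by positivity
  rw [abs_le]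
  constructor <;> nlinarith

/-- Telescoping comparison of two products. -/
lemma ra_prod_diff {ι : Type*} (s : Finset ι) (f g b c : ι → ℝ)
    (hf : ∀ i, |f i| ≤ b i) (hg : ∀ i, |g i| ≤ b i)
    (hc : ∀ i, |f i - g i| ≤ c i * b i) :
    |∏ i ∈ s, f i - ∏ i ∈ s, g i| ≤ (∑ i ∈ s, c i) * ∏ i ∈ s, b i := by
  classical
  induction s using Finset.induction_on with
  | empty => simp
  | insert a s ha ih =>
    rw [Finset.prod_insert ha, Finset.prod_insert ha, Finset.prod_insert ha, Finset.sum_insert ha]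
    have e : f a * ∏ i ∈ s, f i - g a * ∏ i ∈ s, g i
        = (f a - g a) * ∏ i ∈ s, f i + g a * (∏ i ∈ s, f i - ∏ i ∈ s, g i) := by ring
    have hP : |∏ i ∈ s, f i| ≤ ∏ i ∈ s, b i := by
      rw [Finset.abs_prod]
      exact Finset.prod_le_prod (fun i _ => abs_nonneg _) (fun i _ => hf i)
    have hb : 0 ≤ b a := le_trans (abs_nonneg _) (hf a)
    rw [e]
    calc _ ≤ |(f a - g a) * ∏ i ∈ s, f i| + |g a * (∏ i ∈ s, f i - ∏ i ∈ s, g i)| := abs_add_le _ _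
      _ = |f a - g a| * |∏ i ∈ s, f i| + |g a| * |∏ i ∈ s, f i - ∏ i ∈ s, g i| := by
        rw [abs_mul, abs_mul]
      _ ≤ (c a * b a) * (∏ i ∈ s, b i) + b a * ((∑ i ∈ s, c i) * ∏ i ∈ s, b i) := by
        apply add_le_add
        · exact mul_le_mul (hc a) hP (abs_nonneg _) (le_trans (abs_nonneg _) (hc a))
        · exact mul_le_mul (hg a) ih (abs_nonneg _) hb
      _ = _ := by ring

lemma ra_sin_sq_sum {n : ℕ} (u : Fin n → ℝ) (β : ℝ) (h2 : ∑ j, u j ^ 2 = 1)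
    (h3 : ∑ j, |u j| ^ 3 = β) (s : ℝ) (hs : 0 ≤ s) (hsβ : β * s ≤ π) :
    s ^ 2 * (1 - β * s / π) ^ 2 ≤ ∑ j, sin (u j * s) ^ 2 := by
  have hp := Real.pi_pos
  set c := 1 - β * s / π with hc
  have hc0 : 0 ≤ c := by
    rw [hc, sub_nonneg, div_le_one hp]; exact hsβ
  have key : ∀ j, u j ^ 2 * s ^ 2 * (2 * c * (1 - |u j| * s / π) - c ^ 2) ≤ sin (u j * s) ^ 2 := by
    intro j
    have e1 : sin (u j * s) ^ 2 = sin (|u j| * s) ^ 2 := by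
      rcases abs_choice (u j) with h | h <;> rw [h]
      rw [neg_mul, Real.sin_neg]; ring
    rw [e1, ← sq_abs (u j)]
    set v := |u j| * s with hv
    have hv0 : 0 ≤ v := by positivity
    have e2 : |u j| ^ 2 * s ^ 2 = v ^ 2 := by rw [hv]; ring
    rw [e2]
    rcases le_total v π with h | h
    · have hs1 := ra_sin_ge hv0 h
      have hq : 0 ≤ 1 - v / π := by rw [sub_nonneg, div_le_one hp]; exact h
      have : (v * (1 - v / π)) ^ 2 ≤ sin v ^ 2 := by gcongr
      nlinarith [mul_nonneg (sq_nonneg v) (sq_nonneg (1 - v / π - c))]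
    · have hq : 1 - v / π ≤ 0 := by rw [sub_nonpos, one_le_div hp]; exact h
      have : 2 * c * (1 - v / π) - c ^ 2 ≤ 0 := by nlinarith [mul_nonneg hc0 (neg_nonneg.2 hq)]
      nlinarith [mul_nonneg (sq_nonneg v) (neg_nonneg.2 this), sq_nonneg (sin v)]
  calc s ^ 2 * c ^ 2
      = ∑ j, u j ^ 2 * s ^ 2 * (2 * c * (1 - |u j| * s / π) - c ^ 2) := by
        have : ∀ j, u j ^ 2 * s ^ 2 * (2 * c * (1 - |u j| * s / π) - c ^ 2)
            = (s ^ 2 * (2 * c - c ^ 2)) * u j ^ 2 - (2 * c * s ^ 3 / π) * |u j| ^ 3 := by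
          intro j
          rw [← sq_abs (u j)]; ring
        simp_rw [this]
        rw [Finset.sum_sub_distrib, ← Finset.mul_sum, ← Finset.mul_sum, h2, h3]
        have : β * s / π = 1 - c := by rw [hc]; ring
        have e : 2 * c * s ^ 3 / π * β = 2 * c * s ^ 2 * (β * s / π) := by ring
        rw [e, this]; ring
    _ ≤ _ := Finset.sum_le_sum (fun j _ => key j)

lemma ra_phi_bound {n : ℕ} (u : Fin n → ℝ) (y : ℝ) (hy : 0 < y) (h2 : ∑ j, u j ^ 2 = 1)
    (h3 : ∑ j, |u j| ^ 3 = y ^ 3) (s : ℝ) (hs : 0 ≤ s) (hsβ : y ^ 3 * s ≤ π) :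
    |∏ j, cos (u j * s) - exp (-(s ^ 2 / 2))| ≤
      exp (1 / 2) / 8 * y ^ 4 * s ^ 4 * exp (-((s * (1 - y ^ 3 * s / π)) ^ 2 / 2)) := by
  have hcosb : ∀ v : ℝ, |cos v| ≤ exp (-(sin v ^ 2 / 2)) := by
    intro v
    apply abs_le_of_sq_le_sq _ (exp_pos _).le
    rw [← Real.exp_nat_mul]
    have := Real.add_one_le_exp (-(sin v ^ 2))
    have h := Real.sin_sq_add_cos_sq v
    have e : ((2:ℕ):ℝ) * -(sin v ^ 2 / 2) = -(sin v ^ 2) := by push_cast; ring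
    rw [e]; linarith
  have hgb : ∀ v : ℝ, |exp (-(v ^ 2 / 2))| ≤ exp (-(sin v ^ 2 / 2)) := by
    intro v
    rw [abs_of_pos (exp_pos _)]
    apply Real.exp_le_exp.2
    have : sin v ^ 2 ≤ v ^ 2 := sq_le_sq.2 Real.abs_sin_le_abs
    linarith
  have hE : ∏ j, exp (-((u j * s) ^ 2 / 2)) = exp (-(s ^ 2 / 2)) := by
    rw [← Real.exp_sum]
    congr 1
    have : ∀ j, -((u j * s) ^ 2 / 2) = (-(s ^ 2 / 2)) * u j ^ 2 := by intro j; ring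
    simp_rw [this]
    rw [← Finset.mul_sum, h2, mul_one]
  have main := ra_prod_diff Finset.univ (fun j => cos (u j * s))
    (fun j => exp (-((u j * s) ^ 2 / 2))) (fun j => exp (-(sin (u j * s) ^ 2 / 2)))
    (fun j => exp (1 / 2) / 8 * (u j * s) ^ 4) (fun j => hcosb _) (fun j => hgb _) (by
      intro j
      refine (ra_cos_sub_exp (u j * s)).trans ?_
      have h1 : 1 ≤ exp (1 / 2) * exp (-(sin (u j * s) ^ 2 / 2)) := by
        rw [← Real.exp_add]
        apply Real.one_le_exp
        have := Real.sin_sq_le_one (u j * s)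
        linarith
      have : 0 ≤ (u j * s) ^ 4 := by positivity
      nlinarith)
  rw [hE] at main
  refine main.trans ?_
  rw [← Real.exp_sum]
  have hu : ∀ j, |u j| ≤ y := by
    intro j
    have : |u j| ^ 3 ≤ y ^ 3 := by
      rw [← h3]
      exact Finset.single_le_sum (f := fun j => |u j| ^ 3) (fun i _ => by positivity)
        (Finset.mem_univ j)
    exact le_of_pow_le_pow_left₀ (by norm_num) hy.le this
  have h4 : ∑ j, u j ^ 4 ≤ y ^ 4 := by
    calc ∑ j, u j ^ 4 ≤ ∑ j, y * |u j| ^ 3 := by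
          apply Finset.sum_le_sum
          intro j _
          have e : u j ^ 4 = |u j| * |u j| ^ 3 := by
            have e0 : |u j| ^ 4 = u j ^ 4 := by
              rw [← abs_pow, abs_of_nonneg (by positivity : (0:ℝ) ≤ u j ^ 4)]
            rw [← e0]; ring
          rw [e]
          exact mul_le_mul_of_nonneg_right (hu j) (by positivity)
      _ = y ^ 4 := by rw [← Finset.mul_sum, h3]; ring
  apply mul_le_mul
  · have : ∀ j, exp (1 / 2) / 8 * (u j * s) ^ 4 = (exp (1 / 2) / 8 * s ^ 4) * u j ^ 4 := by
      intro j; ring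
    simp_rw [this]
    rw [← Finset.mul_sum]
    calc _ ≤ (exp (1 / 2) / 8 * s ^ 4) * y ^ 4 := by gcongr
      _ = _ := by ring
  · apply Real.exp_le_exp.2
    have := ra_sin_sq_sum u (y ^ 3) h2 h3 s hs hsβ
    rw [Finset.sum_neg_distrib, ← Finset.sum_div, mul_pow]
    linarith
  · positivity
  · positivity


/-- Fourier-side weight of the Beurling-Selberg function. -/
noncomputable def raW (t : ℝ) : ℝ := (1 - t) * (cos (π * t) / sin (π * t)) + 1 / π

lemma raW_sin_pos {t : ℝ} (h0 : 0 < t) (h1 : t < 1) : 0 < sin (π * t) :=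
  Real.sin_pos_of_pos_of_lt_pi (by have := Real.pi_pos; positivity)
    (by have := Real.pi_pos; nlinarith)

lemma raW_nonneg {t : ℝ} (h0 : 0 < t) (h1 : t < 1) : 0 ≤ raW t := by
  have hp := Real.pi_pos
  have hs := raW_sin_pos h0 h1
  have h := ra_xcos_le (x := π - π * t) (by nlinarith) (by nlinarith)
  rw [Real.cos_pi_sub, Real.sin_pi_sub] at h
  have e : raW t = (sin (π * t) + (π - π * t) * cos (π * t)) / (π * sin (π * t)) := by
    unfold raW
    generalize sin (π * t) = S at *
    generalize cos (π * t) = C at *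
    have := hs.ne'
    field_simp; ring
  rw [e]
  apply div_nonneg _ (by positivity)
  linarith

lemma raW_le {t : ℝ} (h0 : 0 < t) (h1 : t < 1) : raW t ≤ 1 / (π * t) := by
  have hp := Real.pi_pos
  have hs := raW_sin_pos h0 h1
  have h := ra_xcos_le (x := π * t) (by positivity) (by nlinarith)
  have h2 : cos (π * t) / sin (π * t) ≤ 1 / (π * t) := by
    rw [div_le_div_iff₀ hs (by positivity)]; linarith
  have h3 : (1 - t) * (cos (π * t) / sin (π * t)) ≤ (1 - t) * (1 / (π * t)) :=
    mul_le_mul_of_nonneg_left h2 (by linarith)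
  have e : (1 - t) * (1 / (π * t)) + 1 / π = 1 / (π * t) := by field_simp; ring
  unfold raW; linarith

lemma raW_ge {t : ℝ} (h0 : 0 < t) (h1 : t < 1) : 1 / (π * t) - π * t / 3 ≤ raW t := by
  have hp := Real.pi_pos
  have hs := raW_sin_pos h0 h1
  have hx : 0 < π * t := by positivity
  have h := ra_sin_sub_xcos (x := π * t) hx.le
  have h2 := ra_sin_ge (x := π * t) hx.le (by nlinarith)
  have e0 : π * t * (1 - π * t / π) = π * t * (1 - t) := by field_simp
  rw [e0] at h2
  have e : raW t = 1 / (π * t) - (1 - t) * (sin (π * t) - (π * t) * cos (π * t)) / (π * t * sin (π * t)) := by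
    unfold raW
    generalize sin (π * t) = S at *
    generalize cos (π * t) = C at *
    have := hs.ne'
    field_simp; ring
  rw [e]
  have : (1 - t) * (sin (π * t) - (π * t) * cos (π * t)) / (π * t * sin (π * t)) ≤ π * t / 3 := by
    rw [div_le_iff₀ (by positivity)]
    calc (1 - t) * (sin (π * t) - (π * t) * cos (π * t)) ≤ (1 - t) * ((π * t) ^ 3 / 3) :=
          mul_le_mul_of_nonneg_left h (by linarith)
      _ = (π * t) ^ 2 / 3 * (π * t * (1 - t)) := by ring
      _ ≤ (π * t) ^ 2 / 3 * sin (π * t) := mul_le_mul_of_nonneg_left h2 (by positivity)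
      _ = _ := by ring
  linarith

lemma raW_measurable : Measurable raW := by
  unfold raW; fun_prop

lemma raW_bound_mul {t c : ℝ} (h0 : 0 < t) (h1 : t < 1) : |raW t * sin (c * t)| ≤ |c| / π := by
  have hp := Real.pi_pos
  rw [abs_mul, abs_of_nonneg (raW_nonneg h0 h1)]
  calc raW t * |sin (c * t)| ≤ 1 / (π * t) * (|c| * t) := by
        apply mul_le_mul (raW_le h0 h1) _ (abs_nonneg _) (by positivity)
        calc |sin (c * t)| ≤ |c * t| := Real.abs_sin_le_abs
          _ = |c| * t := by rw [abs_mul, abs_of_pos h0]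
    _ = _ := by field_simp

lemma ra_integrableOn (f : ℝ → ℝ) (hf : Measurable f) (C : ℝ)
    (hb : ∀ t, 0 < t → t < 1 → |f t| ≤ C) : IntegrableOn f (Set.Ioo 0 1) := by
  apply Measure.integrableOn_of_bounded (M := C)
  · simp
  · exact hf.aestronglyMeasurable
  · rw [ae_restrict_iff' measurableSet_Ioo]
    exact Filter.Eventually.of_forall (fun t ht => hb t ht.1 ht.2)

lemma ra_intervalIntegrable (f : ℝ → ℝ) (hf : Measurable f) (C : ℝ)
    (hb : ∀ t, 0 < t → t < 1 → |f t| ≤ C) : IntervalIntegrable f volume 0 1 := by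
  rw [intervalIntegrable_iff_integrableOn_Ioo_of_le zero_le_one]
  exact ra_integrableOn f hf C hb

lemma ra_integral_congr (f g : ℝ → ℝ) (h : ∀ t, 0 < t → t < 1 → f t = g t) :
    ∫ t in (0:ℝ)..1, f t = ∫ t in (0:ℝ)..1, g t := by
  rw [intervalIntegral.integral_of_le zero_le_one, intervalIntegral.integral_of_le zero_le_one,
    integral_Ioc_eq_integral_Ioo, integral_Ioc_eq_integral_Ioo]
  exact setIntegral_congr_fun measurableSet_Ioo (fun t ht => h t ht.1 ht.2)

lemma raW_ii (c : ℝ) : IntervalIntegrable (fun t => raW t * sin (c * t)) volume 0 1 :=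
  ra_intervalIntegrable _ (raW_measurable.mul (by fun_prop)) _ (fun _ h0 h1 => raW_bound_mul h0 h1)

noncomputable def raH (x : ℝ) : ℝ := ∫ t in (0:ℝ)..1, raW t * sin (2 * π * x * t)
noncomputable def raK (x : ℝ) : ℝ := ∫ t in (0:ℝ)..1, (1 - t) * cos (2 * π * x * t)
noncomputable def raS (x : ℝ) : ℝ := ∫ t in (0:ℝ)..1, sin (2 * π * x * t)

lemma raK_eq {x : ℝ} (hx : x ≠ 0) : raK x = sin (π * x) ^ 2 / (2 * (π * x) ^ 2) := by
  have hp := Real.pi_ne_zero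
  set c := 2 * π * x with hc
  have hc0 : c ≠ 0 := by rw [hc]; positivity
  have hd : ∀ t ∈ Set.uIcc (0:ℝ) 1, HasDerivAt
      (fun t => (1 - t) * (sin (c * t) / c) - cos (c * t) / c ^ 2)
      ((1 - t) * cos (c * t)) t := by
    intro t _
    have h1 : HasDerivAt (fun t => sin (c * t)) (cos (c * t) * (c * 1)) t :=
      ((hasDerivAt_id t).const_mul c).sin
    have h2 : HasDerivAt (fun t => cos (c * t)) (-sin (c * t) * (c * 1)) t :=
      ((hasDerivAt_id t).const_mul c).cos
    have h3 := ((((hasDerivAt_const t (1:ℝ)).sub (hasDerivAt_id t)).mul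
      (h1.div_const c)).sub (h2.div_const (c ^ 2)))
    refine h3.congr_deriv ?_
    simp only [Pi.sub_apply, id]
    field_simp
    ring
  have := intervalIntegral.integral_eq_sub_of_hasDerivAt hd (by
    apply Continuous.intervalIntegrable; fun_prop)
  unfold raK
  rw [← hc, this]
  have e1 : cos c = 1 - 2 * sin (π * x) ^ 2 := by
    have : c = 2 * (π * x) := by rw [hc]; ring
    rw [this, Real.cos_two_mul, Real.cos_sq']; ring
  simp
  rw [e1]
  have e2 : c ^ 2 = 4 * (π * x) ^ 2 := by rw [hc]; ring
  rw [e2]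
  have : (π * x) ≠ 0 := by positivity
  field_simp
  ring

lemma raS_eq {x : ℝ} (hx : x ≠ 0) : raS x = sin (π * x) ^ 2 / (π * x) := by
  have hp := Real.pi_ne_zero
  set c := 2 * π * x with hc
  have hc0 : c ≠ 0 := by rw [hc]; positivity
  have hd : ∀ t ∈ Set.uIcc (0:ℝ) 1, HasDerivAt
      (fun t => - cos (c * t) / c) (sin (c * t)) t := by
    intro t _
    have h2 : HasDerivAt (fun t => cos (c * t)) (-sin (c * t) * (c * 1)) t :=
      ((hasDerivAt_id t).const_mul c).cos
    have h3 := h2.neg.div_const c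
    refine h3.congr_deriv ?_
    field_simp
  have := intervalIntegral.integral_eq_sub_of_hasDerivAt hd (by
    apply Continuous.intervalIntegrable; fun_prop)
  unfold raS
  rw [← hc, this]
  have e1 : cos c = 1 - 2 * sin (π * x) ^ 2 := by
    have : c = 2 * (π * x) := by rw [hc]; ring
    rw [this, Real.cos_two_mul, Real.cos_sq']; ring
  simp
  rw [e1]
  have e2 : c = 2 * (π * x) := by rw [hc]; ring
  rw [e2]
  have : (π * x) ≠ 0 := by positivity
  field_simp
  ring

lemma raK_zero : raK 0 = 1 / 2 := by
  unfold raK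
  simp
  rw [intervalIntegral.integral_sub (by simp) (by simp)]
  simp
  norm_num

lemma raH_rec (x : ℝ) : raH (x + 1) - raH x = raK (x + 1) + raK x + (raS (x + 1) - raS x) / π := by
  unfold raH raK raS
  rw [← intervalIntegral.integral_sub (raW_ii _) (raW_ii _),
    ← intervalIntegral.integral_sub (by apply Continuous.intervalIntegrable; fun_prop)
      (by apply Continuous.intervalIntegrable; fun_prop),
    ← intervalIntegral.integral_div,
    ← intervalIntegral.integral_add (by apply Continuous.intervalIntegrable; fun_prop)
      (by apply Continuous.intervalIntegrable; fun_prop),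
    ← intervalIntegral.integral_add (by apply Continuous.intervalIntegrable; fun_prop)
      (by apply Continuous.intervalIntegrable; fun_prop)]
  apply ra_integral_congr
  intro t h0 h1
  have hs := raW_sin_pos h0 h1
  have e : 2 * π * (x + 1) * t = 2 * π * x * t + 2 * (π * t) := by ring
  rw [e]
  set a := 2 * π * x * t
  set p := π * t
  have h2 : sin (a + 2 * p) - sin a = 2 * cos (a + p) * sin p := by
    have : a + 2 * p = (a + p) + p := by ring
    rw [this, Real.sin_add (a + p) p]
    have : sin a = sin ((a + p) - p) := by ring_nf
    rw [this, Real.sin_sub]; ring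
  have h3 : cos (a + 2 * p) + cos a = 2 * cos (a + p) * cos p := by
    have : a + 2 * p = (a + p) + p := by ring
    rw [this, Real.cos_add (a + p) p]
    have : cos a = cos ((a + p) - p) := by ring_nf
    rw [this, Real.cos_sub]; ring
  have h4 : raW t * sin (a + 2 * p) - raW t * sin a
      = (1 - t) * (cos p / sin p * (sin (a + 2 * p) - sin a)) + (sin (a + 2 * p) - sin a) / π := by
    unfold raW; ring
  have h5 : cos p / sin p * (sin (a + 2 * p) - sin a) = cos (a + 2 * p) + cos a := by
    rw [h2, h3]; field_simp
  rw [h4, h5]; ring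

lemma raH_zero : raH 0 = 0 := by unfold raH; simp
lemma raH_neg (x : ℝ) : raH (-x) = - raH x := by
  unfold raH
  rw [← intervalIntegral.integral_neg]
  congr 1; ext t
  rw [show 2 * π * -x * t = -(2 * π * x * t) by ring, Real.sin_neg]; ring
lemma raK_neg (x : ℝ) : raK (-x) = raK x := by
  unfold raK
  congr 1; ext t
  rw [show 2 * π * -x * t = -(2 * π * x * t) by ring, Real.cos_neg]
lemma raK_nonneg (x : ℝ) : 0 ≤ raK x := by
  by_cases hx : x = 0
  · rw [hx, raK_zero]; norm_num
  · rw [raK_eq hx]; positivity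

lemma raH_nat (m : ℕ) : raH ((m:ℝ) + 1) = 1 / 2 := by
  have hsin : ∀ k : ℕ, sin (π * ((k:ℝ) + 1)) = 0 := by
    intro k
    have := Real.sin_nat_mul_pi (k + 1)
    push_cast at this
    rw [mul_comm]; exact this
  have hK : ∀ k : ℕ, raK ((k:ℝ) + 1) = 0 := by
    intro k; rw [raK_eq (by positivity), hsin]; simp
  have hS : ∀ k : ℕ, raS ((k:ℝ) + 1) = 0 := by
    intro k; rw [raS_eq (by positivity), hsin]; simp
  induction m with
  | zero =>
    have h := raH_rec 0
    have h1 := hK 0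
    have h2 := hS 0
    have h3 : raS 0 = 0 := by unfold raS; simp
    simp at h h1 h2
    rw [raH_zero, h1, h2, h3, raK_zero] at h
    simp at h ⊢
    exact h
  | succ k ih =>
    have h := raH_rec ((k:ℝ) + 1)
    have h1 := hK (k + 1)
    have h2 := hS (k + 1)
    push_cast at h1 h2 ⊢
    rw [ih, hK k, hS k, h1, h2] at h
    simp at h
    linarith

lemma ra_RL (x : ℝ) : Filter.Tendsto (fun m : ℕ => raH (x + m) - raH m) Filter.atTop (nhds 0) := by
  set f : ℝ → ℝ := Set.indicator (Set.Ioo 0 1) (fun t => 2 * (raW t * sin (π * x * t))) with hf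
  have hfi : Integrable f := by
    rw [hf, integrable_indicator_iff measurableSet_Ioo]
    exact (ra_integrableOn _ (raW_measurable.mul (by fun_prop)) _
      (fun _ h0 h1 => raW_bound_mul (c := π * x) h0 h1)).const_mul 2
  have h1 := Real.tendsto_integral_exp_smul_cocompact (fun t => (f t : ℂ))
  have h2 : Filter.Tendsto (fun m : ℕ => (m:ℝ) + x / 2) Filter.atTop (Filter.cocompact ℝ) := by
    apply Filter.Tendsto.mono_right _ atTop_le_cocompact
    exact Filter.tendsto_atTop_add_const_right _ _ tendsto_natCast_atTop_atTop
  have h3 := (Complex.continuous_re.tendsto 0).comp (h1.comp h2)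
  simp only [Complex.zero_re] at h3
  refine h3.congr ?_
  intro m
  simp only [Function.comp]
  have hInteg : Integrable (fun v : ℝ => Real.fourierChar (-(v * ((m:ℝ) + x / 2))) • (f v : ℂ)) := by
    refine (hfi.ofReal (𝕜 := ℂ)).mono ?_ ?_
    · apply AEStronglyMeasurable.smul
      · apply Continuous.aestronglyMeasurable
        exact continuous_subtype_val.comp <| Real.continuous_fourierChar.comp
          (by fun_prop : Continuous (fun v : ℝ => -(v * ((m:ℝ) + x / 2))))
      · exact (hfi.ofReal (𝕜 := ℂ)).aestronglyMeasurable
    · exact Filter.Eventually.of_forall (fun v => by simp)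
  have e1 := integral_re hInteg
  rw [RCLike.re_eq_complex_re] at e1
  rw [← e1]
  have e2 : ∀ v : ℝ, Complex.re (Real.fourierChar (-(v * ((m:ℝ) + x / 2))) • (f v : ℂ))
      = Set.indicator (Set.Ioo 0 1)
        (fun t => raW t * sin (2 * π * (x + m) * t) - raW t * sin (2 * π * m * t)) v := by
    intro v
    have : Complex.re (Real.fourierChar (-(v * ((m:ℝ) + x / 2))) • (f v : ℂ))
        = cos (2 * π * (v * ((m:ℝ) + x / 2))) * f v := by
      rw [Circle.smul_def, Real.fourierChar_apply, smul_eq_mul]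
      rw [Complex.re_mul_ofReal, Complex.exp_ofReal_mul_I_re, ← Real.cos_neg]
      congr 2; ring
    rw [this, hf]
    by_cases hv : v ∈ Set.Ioo (0:ℝ) 1
    · rw [Set.indicator_of_mem hv, Set.indicator_of_mem hv]
      have : sin (2 * π * (x + m) * v) - sin (2 * π * m * v)
          = 2 * sin (π * x * v) * cos (2 * π * (v * ((m:ℝ) + x / 2))) := by
        rw [Real.sin_sub_sin]
        congr 3 <;> ring
      rw [← mul_sub, this]; ring
    · rw [Set.indicator_of_notMem hv, Set.indicator_of_notMem hv, mul_zero]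
  simp_rw [e2]
  rw [integral_indicator measurableSet_Ioo, ← integral_Ioc_eq_integral_Ioo,
    ← intervalIntegral.integral_of_le zero_le_one]
  unfold raH
  rw [intervalIntegral.integral_sub (raW_ii _) (raW_ii _)]

lemma raH_tendsto (x : ℝ) : Filter.Tendsto (fun m : ℕ => raH (x + m)) Filter.atTop (nhds (1/2)) := by
  have h1 := ra_RL x
  have h2 : Filter.Tendsto (fun m : ℕ => raH m) Filter.atTop (nhds (1/2)) := by
    rw [← Filter.tendsto_add_atTop_iff_nat 1]
    apply tendsto_const_nhds.congr
    intro m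
    push_cast
    exact (raH_nat m).symm
  have := h1.add h2
  simpa using this

lemma raH_rec_pos {x : ℝ} (hx : 0 < x) :
    raH (x + 1) - raH x = sin (π * x) ^ 2 / (2 * π ^ 2) * (1 / x - 1 / (x + 1)) ^ 2 := by
  have hp := Real.pi_ne_zero
  rw [raH_rec, raK_eq hx.ne', raK_eq (by positivity), raS_eq hx.ne', raS_eq (by positivity)]
  have : sin (π * (x + 1)) ^ 2 = sin (π * x) ^ 2 := by
    rw [mul_add, mul_one, Real.sin_add_pi]; ring
  rw [this]
  field_simp
  ring

lemma raH_le {x : ℝ} (hx : 0 < x) : raH x ≤ 1 / 2 := by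
  have hm : Monotone (fun m : ℕ => raH (x + m)) := by
    apply monotone_nat_of_le_succ
    intro m
    have := raH_rec_pos (x := x + m) (by positivity)
    have h2 : 0 ≤ sin (π * (x + m)) ^ 2 / (2 * π ^ 2) * (1 / (x + m) - 1 / (x + m + 1)) ^ 2 := by
      positivity
    push_cast
    rw [← add_assoc]
    linarith
  have := hm.ge_of_tendsto (raH_tendsto x) 0
  simpa using this

lemma raK_tendsto {x : ℝ} (hx : 0 < x) :
    Filter.Tendsto (fun m : ℕ => raK (x + m)) Filter.atTop (nhds 0) := by
  have hp := Real.pi_pos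
  have h1 : Filter.Tendsto (fun m : ℕ => 1 / ((m:ℝ) + 1)) Filter.atTop (nhds 0) :=
    tendsto_one_div_add_atTop_nhds_zero_nat
  rw [← Filter.tendsto_add_atTop_iff_nat 1]
  refine squeeze_zero (fun m => raK_nonneg _) ?_ h1
  intro m
  have hxm : 0 < x + ((m + 1 : ℕ) : ℝ) := by positivity
  rw [raK_eq hxm.ne', div_le_div_iff₀ (by positivity) (by positivity)]
  have h2 := Real.sin_sq_le_one (π * (x + ((m + 1 : ℕ) : ℝ)))
  have hb : (m:ℝ) + 1 ≤ π * (x + ((m + 1 : ℕ) : ℝ)) := by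
    have := Real.pi_gt_three
    push_cast
    nlinarith [Nat.cast_nonneg (α := ℝ) m]
  have hm : (0:ℝ) ≤ m := Nat.cast_nonneg m
  nlinarith

lemma raH_ge {x : ℝ} (hx : 0 < x) : 1 / 2 - raK x ≤ raH x := by
  have hp := Real.pi_pos
  have hm : Antitone (fun m : ℕ => raH (x + m) + raK (x + m)) := by
    apply antitone_nat_of_succ_le
    intro m
    have hy : 0 < x + m := by positivity
    have := raH_rec_pos hy
    have h1 := raK_eq hy.ne'
    have h2 := raK_eq (x := x + m + 1) (by positivity)
    have h3 : sin (π * (x + m + 1)) ^ 2 = sin (π * (x + m)) ^ 2 := by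
      rw [mul_add π (x + m) 1, mul_one, Real.sin_add_pi]; ring
    rw [h3] at h2
    push_cast
    rw [← add_assoc, h1, h2]
    set z := x + m
    have h4 : sin (π * z) ^ 2 / (2 * (π * z) ^ 2) - sin (π * z) ^ 2 / (2 * (π * (z + 1)) ^ 2)
        - sin (π * z) ^ 2 / (2 * π ^ 2) * (1 / z - 1 / (z + 1)) ^ 2
        = sin (π * z) ^ 2 / (π ^ 2) * (1 / (z * (z + 1) ^ 2)) := by
      field_simp
      ring
    have h5 : 0 ≤ sin (π * z) ^ 2 / (π ^ 2) * (1 / (z * (z + 1) ^ 2)) := by positivity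
    linarith
  have := hm.le_of_tendsto ((raH_tendsto x).add (raK_tendsto hx)) 0
  simp at this
  linarith

/-- The Selberg minorant of the symmetric interval. -/
lemma ra_minorant (T a x : ℝ) (hT : 0 < T) (ha : 0 < a) :
    ∫ t in (0:ℝ)..1, (raW t * sin (a * T * t) - (1 - t) * cos (a * T * t)) * cos (x * T * t)
      ≤ if |x| ≤ a then 1 / 2 else 0 := by
  have hp := Real.pi_pos
  set δ := T / (2 * π) with hδ
  have hδ0 : 0 < δ := by positivity
  have e : ∫ t in (0:ℝ)..1, (raW t * sin (a * T * t) - (1 - t) * cos (a * T * t)) * cos (x * T * t)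
      = (raH (δ * (x + a)) - raH (δ * (x - a)) - raK (δ * (x + a)) - raK (δ * (x - a))) / 2 := by
    unfold raH raK
    rw [← intervalIntegral.integral_sub (raW_ii _) (raW_ii _),
      ← intervalIntegral.integral_sub ((raW_ii _).sub (raW_ii _))
        (by apply Continuous.intervalIntegrable; fun_prop),
      ← intervalIntegral.integral_sub (((raW_ii _).sub (raW_ii _)).sub
        (by apply Continuous.intervalIntegrable; fun_prop))
        (by apply Continuous.intervalIntegrable; fun_prop),
      ← intervalIntegral.integral_div]
    apply ra_integral_congr
    intro t _ _
    have e1 : 2 * π * (δ * (x + a)) * t = x * T * t + a * T * t := by rw [hδ]; field_simp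
    have e2 : 2 * π * (δ * (x - a)) * t = x * T * t - a * T * t := by rw [hδ]; field_simp
    rw [e1, e2, Real.sin_add, Real.sin_sub, Real.cos_add, Real.cos_sub]
    ring
  rw [e]
  have hle : ∀ z, 0 ≤ z → raH z ≤ 1 / 2 := by
    intro z hz
    rcases hz.eq_or_lt with h | h
    · rw [← h, raH_zero]; norm_num
    · exact raH_le h
  have hK1 := raK_nonneg (δ * (x + a))
  have hK2 := raK_nonneg (δ * (x - a))
  split_ifs with h
  · rw [abs_le] at h
    have h1 := hle (δ * (x + a)) (mul_nonneg hδ0.le (by linarith))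
    have h2 := hle (-(δ * (x - a))) (by rw [← mul_neg]; exact mul_nonneg hδ0.le (by linarith))
    rw [raH_neg] at h2
    linarith
  · rw [not_le, lt_abs] at h
    rcases h with h | h
    · have h1 := hle (δ * (x + a)) (mul_nonneg hδ0.le (by linarith))
      have h2 := raH_ge (x := δ * (x - a)) (mul_pos hδ0 (by linarith))
      linarith
    · have h1 := hle (-(δ * (x - a))) (by rw [← mul_neg]; exact mul_nonneg hδ0.le (by linarith))
      have h2 := raH_ge (x := -(δ * (x + a))) (by rw [← mul_neg]; exact mul_pos hδ0 (by linarith))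
      rw [raH_neg] at h1 h2
      rw [raK_neg] at h2
      linarith


lemma ra_char {n : ℕ} (u : Fin n → ℝ) (s : ℝ) :
    ∑ x : Fin n → Bool, cos ((∑ j, u j * pm (x j)) * s) = 2 ^ n * ∏ j, cos (u j * s) := by
  have h : ∑ x : Fin n → Bool, Complex.exp ((((∑ j, u j * pm (x j)) * s : ℝ) : ℂ) * Complex.I)
      = ((2 ^ n * ∏ j, cos (u j * s) : ℝ) : ℂ) := by
    have e1 : ∀ x : Fin n → Bool,
        Complex.exp ((((∑ j, u j * pm (x j)) * s : ℝ) : ℂ) * Complex.I)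
        = ∏ j, Complex.exp (((u j * pm (x j) * s : ℝ) : ℂ) * Complex.I) := by
      intro x
      rw [← Complex.exp_sum]
      congr 1
      push_cast
      rw [Finset.sum_mul, Finset.sum_mul]
    simp_rw [e1]
    have e2 := Finset.prod_univ_sum (fun _ : Fin n => (Finset.univ : Finset Bool))
      (fun j b => Complex.exp (((u j * pm b * s : ℝ) : ℂ) * Complex.I))
    rw [Fintype.piFinset_univ] at e2
    rw [← e2]
    have e3 : ∀ j : Fin n, ∑ b : Bool, Complex.exp (((u j * pm b * s : ℝ) : ℂ) * Complex.I)
        = ((2 * cos (u j * s) : ℝ) : ℂ) := by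
      intro j
      rw [Fintype.sum_bool]
      simp only [pm]
      push_cast
      rw [Complex.two_cos]
      congr 2
      · simp
      · simp
    simp_rw [e3]
    rw [← Complex.ofReal_prod, Finset.prod_mul_distrib]
    simp
  have h2 := congrArg Complex.re h
  rw [Complex.re_sum, Complex.ofReal_re] at h2
  rw [← h2]
  apply Finset.sum_congr rfl
  intro x _
  rw [Complex.exp_ofReal_mul_I_re]

lemma ra_smoothing {n : ℕ} (u : Fin n → ℝ) (T a : ℝ) (hT : 0 < T) (ha : 0 < a) :
    ∫ t in (0:ℝ)..1, (raW t * sin (a * T * t) - (1 - t) * cos (a * T * t))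
        * ∏ j, cos (u j * (T * t))
      ≤ (1 / 2) * unifPr n (fun x => |∑ j, u j * pm (x j)| ≤ a) := by
  have h2n : (0:ℝ) < 2 ^ n := by positivity
  have hg : ∀ c : ℝ, IntervalIntegrable (fun t =>
      (raW t * sin (a * T * t) - (1 - t) * cos (a * T * t)) * cos (c * T * t)) volume 0 1 := by
    intro c
    apply ((raW_ii (a * T)).sub
      (by apply Continuous.intervalIntegrable; fun_prop)).mul_continuousOn
    fun_prop
  have e : ∀ t : ℝ, (raW t * sin (a * T * t) - (1 - t) * cos (a * T * t))
        * ∏ j, cos (u j * (T * t)) = (∑ x : Fin n → Bool,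
        (raW t * sin (a * T * t) - (1 - t) * cos (a * T * t))
          * cos ((∑ j, u j * pm (x j)) * T * t)) / 2 ^ n := by
    intro t
    rw [← Finset.mul_sum]
    have := ra_char u (T * t)
    simp_rw [← mul_assoc] at this ⊢
    rw [this]
    field_simp
  simp_rw [e]
  rw [intervalIntegral.integral_div, intervalIntegral.integral_finsetSum (fun x _ => hg _)]
  unfold unifPr
  rw [← mul_div_assoc, div_le_div_iff_of_pos_right h2n]
  calc _ ≤ ∑ x : Fin n → Bool, (if |∑ j, u j * pm (x j)| ≤ a then (1:ℝ) / 2 else 0) :=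
        Finset.sum_le_sum (fun x _ => ra_minorant T a _ hT ha)
    _ = _ := by
      rw [← Finset.sum_filter, Finset.sum_const, nsmul_eq_mul, mul_comm]

lemma ra_int_cubic (b T : ℝ) (hb : 0 < b) :
    ∫ s in (0:ℝ)..T, s ^ 3 * exp (-(b * s ^ 2)) ≤ 1 / (2 * b ^ 2) := by
  have hd : ∀ t ∈ Set.uIcc (0:ℝ) T, HasDerivAt
      (fun t => -((t ^ 2 / (2 * b) + 1 / (2 * b ^ 2)) * exp (-(b * t ^ 2))))
      (t ^ 3 * exp (-(b * t ^ 2))) t := by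
    intro t _
    have h1 : HasDerivAt (fun t : ℝ => exp (-(b * t ^ 2)))
        (exp (-(b * t ^ 2)) * (-(b * ((2:ℕ) * t ^ 1)))) t :=
      (((hasDerivAt_pow 2 t).const_mul b).neg).exp
    have h3 := ((((hasDerivAt_pow 2 t).div_const (2 * b)).add_const (1 / (2 * b ^ 2))).mul h1).neg
    refine h3.congr_deriv ?_
    push_cast
    field_simp
    ring
  rw [intervalIntegral.integral_eq_sub_of_hasDerivAt hd (by
    apply Continuous.intervalIntegrable; fun_prop)]
  have : 0 ≤ (T ^ 2 / (2 * b) + 1 / (2 * b ^ 2)) * exp (-(b * T ^ 2)) := by positivity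
  simp at this ⊢
  linarith

lemma ra_int_lin (T : ℝ) : ∫ s in (0:ℝ)..T, s * exp (-(s ^ 2 / 2)) ≤ 1 := by
  have hd : ∀ t ∈ Set.uIcc (0:ℝ) T, HasDerivAt
      (fun t => -exp (-(t ^ 2 / 2))) (t * exp (-(t ^ 2 / 2))) t := by
    intro t _
    have h1 : HasDerivAt (fun t : ℝ => exp (-(t ^ 2 / 2)))
        (exp (-(t ^ 2 / 2)) * (-((2:ℕ) * t ^ 1 / 2))) t :=
      (((hasDerivAt_pow 2 t).div_const 2).neg).exp
    refine h1.neg.congr_deriv ?_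
    push_cast
    ring
  rw [intervalIntegral.integral_eq_sub_of_hasDerivAt hd (by
    apply Continuous.intervalIntegrable; fun_prop)]
  simp
  positivity

lemma ra_int_sq (T : ℝ) (hT : 0 ≤ T) : ∫ s in (0:ℝ)..T, s ^ 2 * exp (-(s ^ 2 / 2))
    ≤ ∫ s in (0:ℝ)..T, exp (-(s ^ 2 / 2)) := by
  have hd : ∀ t ∈ Set.uIcc (0:ℝ) T, HasDerivAt
      (fun t => t * exp (-(t ^ 2 / 2))) (exp (-(t ^ 2 / 2)) - t ^ 2 * exp (-(t ^ 2 / 2))) t := by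
    intro t _
    have h1 : HasDerivAt (fun t : ℝ => exp (-(t ^ 2 / 2)))
        (exp (-(t ^ 2 / 2)) * (-((2:ℕ) * t ^ 1 / 2))) t :=
      (((hasDerivAt_pow 2 t).div_const 2).neg).exp
    refine ((hasDerivAt_id t).mul h1).congr_deriv ?_
    simp only [id]
    push_cast
    ring
  have h := intervalIntegral.integral_eq_sub_of_hasDerivAt hd (by
    apply Continuous.intervalIntegrable; fun_prop)
  rw [intervalIntegral.integral_sub (by apply Continuous.intervalIntegrable; fun_prop)
    (by apply Continuous.intervalIntegrable; fun_prop)] at h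
  have : 0 ≤ T * exp (-(T ^ 2 / 2)) := by positivity
  simp at h
  linarith

lemma ra_gauss_integrable : Integrable (fun s : ℝ => exp (-(s ^ 2 / 2))) := by
  have := integrable_exp_neg_mul_sq (b := 1 / 2) (by norm_num)
  refine this.congr (Filter.Eventually.of_forall fun s => ?_)
  simp only
  congr 1; ring

lemma ra_gauss_Ioi : ∫ s in Set.Ioi (0:ℝ), exp (-(s ^ 2 / 2)) = √(2 * π) / 2 := by
  have := integral_gaussian_Ioi (1 / 2)
  rw [show π / (1 / 2) = 2 * π by ring] at this
  rw [← this]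
  congr 1; ext s
  congr 1; ring

lemma ra_gauss_split (T : ℝ) : (∫ s in (0:ℝ)..T, exp (-(s ^ 2 / 2)))
    + ∫ s in Set.Ioi T, exp (-(s ^ 2 / 2)) = √(2 * π) / 2 := by
  rw [← ra_gauss_Ioi]
  exact intervalIntegral.integral_interval_add_Ioi ra_gauss_integrable.integrableOn
    ra_gauss_integrable.integrableOn

lemma ra_gauss_le (T : ℝ) : ∫ s in (0:ℝ)..T, exp (-(s ^ 2 / 2)) ≤ √(2 * π) / 2 := by
  have h := ra_gauss_split T
  have : 0 ≤ ∫ s in Set.Ioi T, exp (-(s ^ 2 / 2)) := by positivity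
  linarith

lemma ra_gauss_ge (T : ℝ) (hT : 0 < T) :
    √(2 * π) / 2 - 2 / T ^ 3 ≤ ∫ s in (0:ℝ)..T, exp (-(s ^ 2 / 2)) := by
  have h := ra_gauss_split T
  have hd : ∀ t ∈ Set.Ici T, HasDerivAt
      (fun t => -(exp (-(t ^ 2 / 2))) / T) (t / T * exp (-(t ^ 2 / 2))) t := by
    intro t _
    have h1 : HasDerivAt (fun t : ℝ => exp (-(t ^ 2 / 2)))
        (exp (-(t ^ 2 / 2)) * (-((2:ℕ) * t ^ 1 / 2))) t :=
      (((hasDerivAt_pow 2 t).div_const 2).neg).exp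
    refine (h1.neg.div_const T).congr_deriv ?_
    push_cast
    ring
  have hlim : Filter.Tendsto (fun t : ℝ => -(exp (-(t ^ 2 / 2))) / T) Filter.atTop (nhds 0) := by
    have h1 : Filter.Tendsto (fun t : ℝ => t ^ 2 / 2) Filter.atTop Filter.atTop :=
      (Filter.tendsto_pow_atTop (by norm_num)).atTop_div_const (by norm_num)
    have h2 := (Real.tendsto_exp_neg_atTop_nhds_zero.comp h1).neg.div_const T
    simpa using h2
  have hnn : ∀ t ∈ Set.Ioi T, 0 ≤ t / T * exp (-(t ^ 2 / 2)) := by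
    intro t ht
    have : 0 < t := hT.trans ht
    positivity
  have hI := integral_Ioi_of_hasDerivAt_of_nonneg' hd hnn hlim
  have hInt := integrableOn_Ioi_deriv_of_nonneg' hd hnn hlim
  have hle : ∫ s in Set.Ioi T, exp (-(s ^ 2 / 2)) ≤ ∫ s in Set.Ioi T, s / T * exp (-(s ^ 2 / 2)) := by
    apply setIntegral_mono_on ra_gauss_integrable.integrableOn hInt measurableSet_Ioi
    intro t ht
    have : 1 ≤ t / T := by rw [one_le_div hT]; exact le_of_lt ht
    have h2 := exp_pos (-(t ^ 2 / 2))
    nlinarith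
  rw [hI] at hle
  have hexp : exp (-(T ^ 2 / 2)) ≤ 2 / T ^ 2 := by
    rw [Real.exp_neg, inv_le_comm₀ (exp_pos _) (by positivity), inv_div]
    have := Real.add_one_le_exp (T ^ 2 / 2)
    linarith
  have h5 : exp (-(T ^ 2 / 2)) / T ≤ 2 / T ^ 3 := by
    calc _ ≤ (2 / T ^ 2) / T := by gcongr
      _ = _ := by field_simp
  have h6 : 0 - -exp (-(T ^ 2 / 2)) / T = exp (-(T ^ 2 / 2)) / T := by ring
  linarith


lemma ra_exp_split (y s T : ℝ) (hy : 0 < y) (hT : T = π / (y ^ 3 * (1 + 2 * y)))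
    (hs0 : 0 ≤ s) (hsT : s ≤ T) :
    exp (-((s * (1 - y ^ 3 * s / π)) ^ 2 / 2)) ≤ exp (-(2 / 9 * s ^ 2))
      + exp (-((2 * π / (9 * y ^ 3)) ^ 2 / 2)) + exp (-((T * (2 * y / (1 + 2 * y))) ^ 2 / 2)) := by
  have hp := Real.pi_pos
  have p1 := exp_pos (-(2 / 9 * s ^ 2))
  have p2 := exp_pos (-((2 * π / (9 * y ^ 3)) ^ 2 / 2))
  have p3 := exp_pos (-((T * (2 * y / (1 + 2 * y))) ^ 2 / 2))
  set γ := y ^ 3 / π with hγ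
  have hγ0 : 0 < γ := by positivity
  have es : y ^ 3 * s / π = γ * s := by rw [hγ]; ring
  have em1 : 2 * π / (9 * y ^ 3) = 2 / (9 * γ) := by rw [hγ]; field_simp
  have hγT : γ * T = 1 / (1 + 2 * y) := by rw [hγ, hT]; field_simp
  have em2 : 2 * y / (1 + 2 * y) = 1 - γ * T := by rw [hγT]; field_simp; ring
  rw [em1] at p2 ⊢
  rw [em2] at p3 ⊢
  rw [es]
  have hγT1 : γ * T ≤ 1 := by rw [hγT, div_le_one (by positivity)]; linarith
  by_cases h1 : γ * s ≤ 1 / 3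
  · have : exp (-((s * (1 - γ * s)) ^ 2 / 2)) ≤ exp (-(2 / 9 * s ^ 2)) := by
      apply Real.exp_le_exp.2
      have : (2 / 3) * s ≤ s * (1 - γ * s) := by nlinarith
      have : ((2 / 3) * s) ^ 2 ≤ (s * (1 - γ * s)) ^ 2 := by gcongr
      nlinarith
    linarith
  · push Not at h1
    by_cases h2 : γ * s + 1 / 3 ≤ 1
    · have : exp (-((s * (1 - γ * s)) ^ 2 / 2)) ≤ exp (-((2 / (9 * γ)) ^ 2 / 2)) := by
        apply Real.exp_le_exp.2
        have : 2 / (9 * γ) ≤ s * (1 - γ * s) := by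
          rw [div_le_iff₀ (by positivity)]
          nlinarith
        have : (2 / (9 * γ)) ^ 2 ≤ (s * (1 - γ * s)) ^ 2 := by gcongr
        linarith
      linarith
    · push Not at h2
      have : exp (-((s * (1 - γ * s)) ^ 2 / 2)) ≤ exp (-((T * (1 - γ * T)) ^ 2 / 2)) := by
        apply Real.exp_le_exp.2
        have hT0 : 0 ≤ T := hs0.trans hsT
        have h3 : γ * s ≤ γ * T := by gcongr
        have : T * (1 - γ * T) ≤ s * (1 - γ * s) := by
          nlinarith [mul_nonneg (sub_nonneg.2 hsT) (by linarith : 0 ≤ γ * s + γ * T - 1)]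
        have : (T * (1 - γ * T)) ^ 2 ≤ (s * (1 - γ * s)) ^ 2 := by
          apply pow_le_pow_left₀ _ this
          exact mul_nonneg hT0 (by linarith)
        linarith
      linarith

lemma ra_pointwise {n : ℕ} (u : Fin n → ℝ) (y : ℝ) (hy : 0 < y) (h2 : ∑ j, u j ^ 2 = 1)
    (h3 : ∑ j, |u j| ^ 3 = y ^ 3) (a : ℝ) (ha : 0 < a) (T E : ℝ) (hT0 : 0 < T)
    (hTy : y ^ 3 * T ≤ π)
    (hE : ∀ s, 0 ≤ s → s ≤ T → exp (-((s * (1 - y ^ 3 * s / π)) ^ 2 / 2))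
      ≤ exp (-(2 / 9 * s ^ 2)) + E) (t : ℝ) (ht0 : 0 < t) (ht1 : t < 1) :
    T * ((a / π - 1 / T) * exp (-((T * t) ^ 2 / 2))
        - a ^ 3 / (6 * π) * ((T * t) ^ 2 * exp (-((T * t) ^ 2 / 2)))
        - π / (3 * T ^ 2) * ((T * t) * exp (-((T * t) ^ 2 / 2)))
        - (1 / π + 1 / 4) * (exp (1 / 2) / 8) * y ^ 4 *
          ((T * t) ^ 3 * exp (-(2 / 9 * (T * t) ^ 2)) + E * (T * t) ^ 3)) ≤
      (raW t * sin (a * T * t) - (1 - t) * cos (a * T * t)) * ∏ j, cos (u j * (T * t)) := by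
  have hp := Real.pi_pos
  set s := T * t with hs
  have hs0 : 0 < s := by positivity
  have hsT : s ≤ T := by rw [hs]; nlinarith
  have hφ := ra_phi_bound u y hy h2 h3 s hs0.le
    (le_trans (mul_le_mul_of_nonneg_left hsT (by positivity)) hTy)
  set P := ∏ j, cos (u j * s)
  set g := exp (-(s ^ 2 / 2)) with hg
  have hg0 : 0 < g := exp_pos _
  have hW0 := raW_nonneg ht0 ht1
  have hW1 := raW_le ht0 ht1
  have hW2 := raW_ge ht0 ht1
  rw [show a * T * t = a * s by rw [hs]; ring]
  set c := raW t * sin (a * s) - (1 - t) * cos (a * s) with hc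
  -- upper bound for the size of the weight
  have hsin1 := Real.abs_sin_le_one (a * s)
  have hcos1 := Real.abs_cos_le_one (a * s)
  have hcabs : |c| ≤ (1 / π + 1 / 4) / t := by
    have h4 : |c| ≤ raW t + (1 - t) := by
      rw [hc]
      calc _ ≤ |raW t * sin (a * s)| + |(1 - t) * cos (a * s)| := abs_sub _ _
        _ = raW t * |sin (a * s)| + (1 - t) * |cos (a * s)| := by
          rw [abs_mul, abs_mul, abs_of_nonneg hW0, abs_of_nonneg (by linarith : 0 ≤ 1 - t)]
        _ ≤ _ := by
          have := mul_le_mul_of_nonneg_left hsin1 hW0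
          have := mul_le_mul_of_nonneg_left hcos1 (by linarith : 0 ≤ 1 - t)
          linarith
    have h5 : 1 - t ≤ (1 / 4) / t := by
      rw [le_div_iff₀ ht0]; nlinarith [sq_nonneg (t - 1 / 2)]
    calc |c| ≤ 1 / (π * t) + (1 / 4) / t := by linarith
      _ = _ := by field_simp
  -- error term
  have herr : |c * (P - g)| ≤ T * ((1 / π + 1 / 4) * (exp (1 / 2) / 8) * y ^ 4 *
          (s ^ 3 * exp (-(2 / 9 * s ^ 2)) + E * s ^ 3)) := by
    rw [abs_mul]
    calc |c| * |P - g| ≤ ((1 / π + 1 / 4) / t) *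
          (exp (1 / 2) / 8 * y ^ 4 * s ^ 4 * (exp (-(2 / 9 * s ^ 2)) + E)) := by
          apply mul_le_mul hcabs _ (abs_nonneg _) (by positivity)
          refine hφ.trans ?_
          exact mul_le_mul_of_nonneg_left (hE s hs0.le hsT) (by positivity)
      _ = _ := by rw [hs]; field_simp
  -- main term
  have hmain : T * ((a / π - 1 / T) - a ^ 3 / (6 * π) * s ^ 2 - π / (3 * T ^ 2) * s) ≤ c := by
    have has : 0 < a * s := by positivity
    have h6 := ra_sin_ge_cubic has.le
    have h7 : raW t * sin (a * s) ≥ 1 / (π * t) * sin (a * s) - π * t / 3 := by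
      have hd : 0 ≤ 1 / (π * t) - raW t := by linarith
      have hd2 : 1 / (π * t) - raW t ≤ π * t / 3 := by linarith
      have h8 : sin (a * s) ≤ 1 := Real.sin_le_one _
      nlinarith
    have h9 : 1 / (π * t) * sin (a * s) ≥ 1 / (π * t) * (a * s - (a * s) ^ 3 / 6) :=
      mul_le_mul_of_nonneg_left h6 (by positivity)
    have h10 : (1 - t) * cos (a * s) ≤ 1 := by
      have := Real.cos_le_one (a * s)
      nlinarith
    have e1 : T * ((a / π - 1 / T) - a ^ 3 / (6 * π) * s ^ 2 - π / (3 * T ^ 2) * s)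
        = 1 / (π * t) * (a * s - (a * s) ^ 3 / 6) - π * t / 3 - 1 := by
      rw [hs]; field_simp; ring
    rw [e1, hc]; linarith
  have h11 := mul_le_mul_of_nonneg_right hmain hg0.le
  have h12 := neg_abs_le (c * (P - g))
  have e2 : c * P = c * g + c * (P - g) := by ring
  rw [e2]
  nlinarith

lemma ra_integrated {n : ℕ} (u : Fin n → ℝ) (y : ℝ) (hy : 0 < y) (h2 : ∑ j, u j ^ 2 = 1)
    (h3 : ∑ j, |u j| ^ 3 = y ^ 3) (a : ℝ) (ha : 0 < a) (T E : ℝ) (hT0 : 0 < T)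
    (hTy : y ^ 3 * T ≤ π) (hE0 : 0 ≤ E)
    (hE : ∀ s, 0 ≤ s → s ≤ T → exp (-((s * (1 - y ^ 3 * s / π)) ^ 2 / 2))
      ≤ exp (-(2 / 9 * s ^ 2)) + E) :
    ((a - a ^ 3 / 6) / π - 1 / T) * (∫ s in (0:ℝ)..T, exp (-(s ^ 2 / 2)))
      - π / (3 * T ^ 2) - (1 / π + 1 / 4) * (exp (1 / 2) / 8) * y ^ 4 * (81 / 8 + E * T ^ 4 / 4)
      ≤ (1 / 2) * unifPr n (fun x => |∑ j, u j * pm (x j)| ≤ a) := by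
  have hp := Real.pi_pos
  refine le_trans ?_ (ra_smoothing u T a hT0 ha)
  set C := (1 / π + 1 / 4) * (exp (1 / 2) / 8) * y ^ 4 with hC
  have hC0 : 0 ≤ C := by positivity
  set G : ℝ → ℝ := fun s => (a / π - 1 / T) * exp (-(s ^ 2 / 2))
        - a ^ 3 / (6 * π) * (s ^ 2 * exp (-(s ^ 2 / 2)))
        - π / (3 * T ^ 2) * (s * exp (-(s ^ 2 / 2)))
        - C * (s ^ 3 * exp (-(2 / 9 * s ^ 2)) + E * s ^ 3) with hG
  have hGc : Continuous G := by rw [hG]; fun_prop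
  have hsub : ∫ t in (0:ℝ)..1, T * G (T * t) = ∫ s in (0:ℝ)..T, G s := by
    rw [intervalIntegral.integral_const_mul, intervalIntegral.mul_integral_comp_mul_left]
    simp
  have hle : ∫ t in (0:ℝ)..1, T * G (T * t) ≤ ∫ t in (0:ℝ)..1,
      (raW t * sin (a * T * t) - (1 - t) * cos (a * T * t)) * ∏ j, cos (u j * (T * t)) := by
    apply intervalIntegral.integral_mono_on_of_le_Ioo zero_le_one
    · apply Continuous.intervalIntegrable; fun_prop
    · apply ((raW_ii (a * T)).sub
        (by apply Continuous.intervalIntegrable; fun_prop)).mul_continuousOn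
      fun_prop
    · intro t ht
      exact ra_pointwise u y hy h2 h3 a ha T E hT0 hTy hE t ht.1 ht.2
  refine le_trans ?_ hle
  rw [hsub, hG]
  have ii : ∀ f : ℝ → ℝ, Continuous f → IntervalIntegrable f volume 0 T :=
    fun f hf => hf.intervalIntegrable _ _
  rw [intervalIntegral.integral_sub (ii _ (by fun_prop)) (ii _ (by fun_prop)),
    intervalIntegral.integral_sub (ii _ (by fun_prop)) (ii _ (by fun_prop)),
    intervalIntegral.integral_sub (ii _ (by fun_prop)) (ii _ (by fun_prop)),
    intervalIntegral.integral_const_mul, intervalIntegral.integral_const_mul,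
    intervalIntegral.integral_const_mul, intervalIntegral.integral_const_mul,
    intervalIntegral.integral_add (ii _ (by fun_prop)) (ii _ (by fun_prop)),
    intervalIntegral.integral_const_mul, integral_pow]
  have i1 := ra_int_sq T hT0.le
  have i2 := ra_int_lin T
  have i3 := ra_int_cubic (2 / 9) T (by norm_num)
  have e3 : (1:ℝ) / (2 * (2 / 9) ^ 2) = 81 / 8 := by norm_num
  rw [e3] at i3
  have j1 := mul_le_mul_of_nonneg_left i1 (by positivity : 0 ≤ a ^ 3 / (6 * π))
  have j2 := mul_le_mul_of_nonneg_left i2 (by positivity : 0 ≤ π / (3 * T ^ 2))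
  have j3 := mul_le_mul_of_nonneg_left i3 hC0
  have e4 : ((T ^ (3 + 1) - 0 ^ (3 + 1)) / (((3:ℕ):ℝ) + 1)) = T ^ 4 / 4 := by norm_num
  rw [e4]
  set I := ∫ s in (0:ℝ)..T, exp (-(s ^ 2 / 2))
  have e5 : ((a - a ^ 3 / 6) / π - 1 / T) * I = (a / π - 1 / T) * I - a ^ 3 / (6 * π) * I := by
    field_simp
    ring
  rw [e5, mul_add C, mul_add C]
  have e6 : C * (E * T ^ 4 / 4) = C * (E * (T ^ 4 / 4)) := by ring
  rw [e6]
  linarith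

lemma ra_sq_exp (x : ℝ) (hx : 8.79 ≤ x) : x ^ 2 * exp (-x) ≤ 0.013 := by
  have h1 : (2978 : ℝ) ≤ exp 8 := by
    have h := Real.exp_one_gt_d9
    have h8 : exp 8 = exp 1 ^ 8 := by
      rw [← Real.exp_nat_mul]; norm_num
    rw [h8]
    calc (2978 : ℝ) ≤ 2.7182 ^ 8 := by norm_num
      _ ≤ exp 1 ^ 8 := by
        apply pow_le_pow_left₀ (by norm_num); linarith
  have h2 := Real.quadratic_le_exp_of_nonneg (x := x - 8) (by linarith)
  have h3 : exp x = exp 8 * exp (x - 8) := by rw [← Real.exp_add]; congr 1; ring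
  have h4 : 2978 * (1 + (x - 8) + (x - 8) ^ 2 / 2) ≤ exp x := by
    rw [h3]
    apply mul_le_mul h1 h2 (by nlinarith) (exp_pos _).le
  rw [Real.exp_neg, ← div_eq_mul_inv, div_le_iff₀ (exp_pos _)]
  nlinarith

lemma ra_exp_neg_le_quart (x : ℝ) (hx : 0 < x) : exp (-x) ≤ 24 / x ^ 4 := by
  have h := Real.pow_div_factorial_le_exp x hx.le 4
  rw [Real.exp_neg, ← one_div, div_le_div_iff₀ (exp_pos _) (by positivity)]
  have : ((Nat.factorial 4 : ℕ) : ℝ) = 24 := by norm_num [Nat.factorial]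
  rw [this, div_le_iff₀ (by norm_num)] at h
  linarith

lemma ra_e1 (y T : ℝ) (hy : 0 < y) (hy1 : y ≤ 0.55) (hT0 : 0 < T) (hT : T * (y ^ 3 * (1 + 2 * y)) = π) :
    exp (-((2 * π / (9 * y ^ 3)) ^ 2 / 2)) * T ^ 4 / 4 ≤ 5.34 := by
  have hy3 : y ^ 3 ≤ 0.166375 := by
    calc y ^ 3 ≤ 0.55 ^ 3 := pow_le_pow_left₀ hy.le hy1 3
      _ = _ := by norm_num
  have hy3p : 0 < y ^ 3 := by positivity
  have hpi := Real.pi_gt_d4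
  set m := 2 * π / (9 * y ^ 3) with hm
  have hm1 : 4.195 ≤ m := by
    rw [hm, le_div_iff₀ (by positivity)]; nlinarith
  have hTm : T ≤ 4.5 * m := by
    have h1 : m * (9 * y ^ 3) = 2 * π := by rw [hm]; field_simp
    have h2 : T * y ^ 3 ≤ π := by
      rw [← hT]; nlinarith [mul_pos (mul_pos hT0 hy3p) hy]
    by_contra hc
    push Not at hc
    nlinarith [mul_lt_mul_of_pos_right hc hy3p]
  have h := ra_sq_exp (m ^ 2 / 2) (by nlinarith)
  have hT4 : T ^ 4 ≤ (4.5 * m) ^ 4 := pow_le_pow_left₀ hT0.le hTm 4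
  have he := exp_pos (-(m ^ 2 / 2))
  have := mul_le_mul_of_nonneg_left hT4 he.le
  nlinarith

lemma ra_e2 (y T : ℝ) (hy : 0 < y) (hy1 : y ≤ 0.55) (hT0 : 0 < T) (hT : T * (y ^ 3 * (1 + 2 * y)) = π) :
    exp (-((T * (2 * y / (1 + 2 * y))) ^ 2 / 2)) * T ^ 4 / 4 ≤ 2.6 := by
  have hpi := Real.pi_gt_d4
  have hz : 0 < 1 + 2 * y := by linarith
  have h := ra_exp_neg_le_quart ((T * (2 * y / (1 + 2 * y))) ^ 2 / 2) (by positivity)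
  have h1 := mul_le_mul_of_nonneg_right h (by positivity : 0 ≤ T ^ 4 / 4)
  rw [mul_div_assoc]
  refine h1.trans ?_
  have h2 : 24 / ((T * (2 * y / (1 + 2 * y))) ^ 2 / 2) ^ 4 * (T ^ 4 / 4)
      = 3 / 8 * (1 + 2 * y) ^ 12 * y ^ 4 / π ^ 4 := by
    rw [← hT]
    field_simp
    norm_num
  rw [h2, div_le_iff₀ (by positivity)]
  have h3 : (1 + 2 * y) ^ 12 ≤ 2.1 ^ 12 := pow_le_pow_left₀ hz.le (by linarith) 12
  have h4 : y ^ 4 ≤ 0.55 ^ 4 := pow_le_pow_left₀ hy.le hy1 4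
  have h5 : (3.1415 : ℝ) ^ 4 ≤ π ^ 4 := pow_le_pow_left₀ (by norm_num) hpi.le 4
  have h6 : (1 + 2 * y) ^ 12 * y ^ 4 ≤ 2.1 ^ 12 * 0.55 ^ 4 :=
    mul_le_mul h3 h4 (by positivity) (by positivity)
  calc 3 / 8 * (1 + 2 * y) ^ 12 * y ^ 4 = 3 / 8 * ((1 + 2 * y) ^ 12 * y ^ 4) := by ring
    _ ≤ 3 / 8 * (2.1 ^ 12 * 0.55 ^ 4) := by gcongr
    _ ≤ 2.6 * 3.1415 ^ 4 := by norm_num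
    _ ≤ _ := by gcongr

lemma ra_C0 : (1 / π + 1 / 4) * (exp (1 / 2) / 8) ≤ 0.1174 := by
  have hpi := Real.pi_gt_d4
  have h1 : 1 / π ≤ 0.3184 := by
    rw [div_le_iff₀ Real.pi_pos]; nlinarith
  have h2 : exp (1 / 2) ≤ 1.6495 := by
    have h := Real.exp_one_lt_d9
    have h3 : exp (1 / 2) ^ 2 = exp 1 := by
      rw [← Real.exp_nat_mul]; norm_num
    have := exp_pos (1 / 2)
    by_contra hc
    push Not at hc
    nlinarith
  have h0 : 0 ≤ 1 / π := by positivity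
  have := exp_pos (1 / 2)
  calc (1 / π + 1 / 4) * (exp (1 / 2) / 8) ≤ (0.3184 + 1 / 4) * (1.6495 / 8) := by gcongr
    _ ≤ _ := by norm_num

lemma ra_unifPr_nonneg (n : ℕ) (E : (Fin n → Bool) → Prop) : 0 ≤ unifPr n E := by
  unfold unifPr; positivity

lemma ra_d_props : 0 < 1 / √(2 * π) ∧ 1 / √(2 * π) ≤ 0.399 ∧ √(2 * π) / 2 = π * (1 / √(2 * π)) := by
  have hpi := Real.pi_gt_d4
  have hs : 0 < √(2 * π) := by positivity
  have hsq : √(2 * π) ^ 2 = 2 * π := Real.sq_sqrt (by positivity)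
  refine ⟨by positivity, ?_, ?_⟩
  · rw [div_le_iff₀ hs]
    have : 2.5065 ≤ √(2 * π) := Real.le_sqrt_of_sq_le (by nlinarith)
    linarith
  · field_simp
    linarith

set_option maxHeartbeats 4000000 in
lemma ra_normalized {n : ℕ} (u : Fin n → ℝ) (y : ℝ) (hy : 0 < y) (h2 : ∑ j, u j ^ 2 = 1)
    (h3 : ∑ j, |u j| ^ 3 = y ^ 3) (a : ℝ) (ha : 0 < a) :
    1 / √(2 * π) * (a - y ^ 3) - 1 / √(2 * π) * a ^ 3 / 6 - 3.4106 * y ^ 4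
      ≤ (1 / 2) * unifPr n (fun x => |∑ j, u j * pm (x j)| ≤ a) := by
  obtain ⟨hd0, hd1, hd2⟩ := ra_d_props
  set d := 1 / √(2 * π) with hd
  have hP := ra_unifPr_nonneg n (fun x => |∑ j, u j * pm (x j)| ≤ a)
  have hpi := Real.pi_gt_d4
  have hy3p : 0 < y ^ 3 := by positivity
  have hy4p : 0 < y ^ 4 := by positivity
  set g := a - a ^ 3 / 6 with hg
  have hrw : d * (a - y ^ 3) - d * a ^ 3 / 6 - 3.4106 * y ^ 4 = d * g - d * y ^ 3 - 3.4106 * y ^ 4 := by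
    rw [hg]; ring
  rw [hrw]
  have hdy : 0 < d * y ^ 3 := by positivity
  rcases le_or_gt g 0 with hg0 | hg0
  · have : d * g ≤ 0 := mul_nonpos_of_nonneg_of_nonpos hd0.le hg0
    linarith
  have hg1 : g ≤ 0.943 := by
    rw [hg]
    nlinarith [mul_nonneg (by linarith : 0 ≤ a + 2.8284) (sq_nonneg (a - 1.4142))]
  rcases le_or_gt 0.55 y with hyb | hys
  · have hy3 : 0.55 ^ 3 ≤ y ^ 3 := pow_le_pow_left₀ (by norm_num) hyb 3
    have hy4 : 0.55 ^ 4 ≤ y ^ 4 := pow_le_pow_left₀ (by norm_num) hyb 4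
    have h5 : g - y ^ 3 ≤ 0.777 := by
      have : (0.55 : ℝ) ^ 3 = 0.166375 := by norm_num
      linarith
    have h6 : d * (g - y ^ 3) ≤ d * 0.777 := mul_le_mul_of_nonneg_left h5 hd0.le
    have h7 : (0.55 : ℝ) ^ 4 = 0.09150625 := by norm_num
    nlinarith
  have hys' := hys.le
  set T := π / (y ^ 3 * (1 + 2 * y)) with hTdef
  have hT0 : 0 < T := by positivity
  have hT : T * (y ^ 3 * (1 + 2 * y)) = π := by rw [hTdef]; field_simp
  have hTy : y ^ 3 * T ≤ π := by
    rw [← hT]; nlinarith [mul_pos (mul_pos hT0 hy3p) hy]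
  have he1 := ra_e1 y T hy hys' hT0 hT
  have he2 := ra_e2 y T hy hys' hT0 hT
  set e1 := exp (-((2 * π / (9 * y ^ 3)) ^ 2 / 2)) with he1d
  set e2 := exp (-((T * (2 * y / (1 + 2 * y))) ^ 2 / 2)) with he2d
  have he1p : 0 < e1 := exp_pos _
  have he2p : 0 < e2 := exp_pos _
  have key := ra_integrated u y hy h2 h3 a ha T (e1 + e2) hT0 hTy (by linarith)
    (fun s hs0 hsT => by
      have := ra_exp_split y s T hy hTdef hs0 hsT
      linarith)
  have hIle := ra_gauss_le T
  have hIge := ra_gauss_ge T hT0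
  rw [hd2] at hIle hIge
  set I := ∫ s in (0:ℝ)..T, exp (-(s ^ 2 / 2)) with hI
  refine le_trans ?_ key
  have hy3 : y ^ 3 ≤ 0.166375 := by
    calc y ^ 3 ≤ 0.55 ^ 3 := pow_le_pow_left₀ hy.le hys' 3
      _ = _ := by norm_num
  have hTinv : 1 / T = y ^ 3 * (1 + 2 * y) / π := by rw [hTdef]; field_simp
  -- term with I / T
  have t1 : 1 / T * I ≤ d * y ^ 3 + 0.798 * y ^ 4 := by
    calc 1 / T * I ≤ 1 / T * (π * d) := by gcongr
      _ = d * y ^ 3 + 2 * d * y ^ 4 := by rw [hTinv]; field_simp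
      _ ≤ _ := by nlinarith
  -- main term
  have hT9 : 8.9 ≤ T := by
    rw [hTdef, le_div_iff₀ (by positivity)]
    have : y ^ 3 * (1 + 2 * y) ≤ 0.166375 * 2.1 := by
      apply mul_le_mul hy3 (by linarith) (by linarith) (by norm_num)
    linarith
  have hip : 1 / π ≤ 0.3184 := by
    rw [div_le_iff₀ Real.pi_pos]; nlinarith
  have t2 : d * g - 0.068 * (1 / T ^ 2) ≤ g / π * I := by
    have h1 : g / π * (π * d - 2 / T ^ 3) ≤ g / π * I := by gcongr
    have h2 : g / π * (π * d - 2 / T ^ 3) = d * g - g * (1 / π) * 2 * (1 / T) * (1 / T ^ 2) := by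
      field_simp
    have h3 : g * (1 / π) * 2 * (1 / T) ≤ 0.068 := by
      have hTi : 1 / T ≤ 1 / 8.9 := one_div_le_one_div_of_le (by norm_num) hT9
      calc g * (1 / π) * 2 * (1 / T) ≤ 0.943 * 0.3184 * 2 * (1 / 8.9) := by gcongr
        _ ≤ _ := by norm_num
    have h4 : g * (1 / π) * 2 * (1 / T) * (1 / T ^ 2) ≤ 0.068 * (1 / T ^ 2) := by gcongr
    linarith
  have t3 : 0.068 * (1 / T ^ 2) + π / (3 * T ^ 2) ≤ 0.16 * y ^ 4 := by
    have hpi2 := Real.pi_lt_d4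
    have h1 : π / (3 * T ^ 2) = π / 3 * (1 / T ^ 2) := by field_simp
    have h2 : 1 / T ^ 2 = (y * (1 + 2 * y)) ^ 2 * y ^ 4 * (1 / π) ^ 2 := by
      rw [hTdef]; field_simp
    have h3 : 1 / T ^ 2 ≤ (0.55 * 2.1) ^ 2 * y ^ 4 * 0.3184 ^ 2 := by
      rw [h2]
      have : 1 + 2 * y ≤ 2.1 := by linarith
      gcongr
    rw [h1]
    have : 0 < 1 / T ^ 2 := by positivity
    nlinarith
  have t4 : (1 / π + 1 / 4) * (exp (1 / 2) / 8) * y ^ 4 * (81 / 8 + (e1 + e2) * T ^ 4 / 4)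
      ≤ 2.13 * y ^ 4 := by
    have h1 : 81 / 8 + (e1 + e2) * T ^ 4 / 4 ≤ 18.07 := by
      have : (e1 + e2) * T ^ 4 / 4 = e1 * T ^ 4 / 4 + e2 * T ^ 4 / 4 := by ring
      rw [this]; linarith
    calc _ ≤ 0.1174 * y ^ 4 * 18.07 := by
          have := ra_C0
          gcongr
      _ ≤ _ := by nlinarith
  have hexp : (g / π - 1 / T) * I = g / π * I - 1 / T * I := by ring
  rw [hexp]
  linarith

/-- Berry–Esseen based anticoncentration for Rademacher sums. -/
theorem rademacher_anticoncentration (n : ℕ) (hn : 2 ≤ n) (w : Fin n → ℝ) (i : Fin n)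
    (hpos : 0 < ∑ j ∈ Finset.univ.erase i, w j ^ 2) (α : ℝ) (hα : 0 < α)
    (A B : ℝ)
    (hA : A = (1 / ((n : ℝ) - 1)) * ∑ j ∈ Finset.univ.erase i, |w j| ^ 3)
    (hB : B = (1 / ((n : ℝ) - 1)) * ∑ j ∈ Finset.univ.erase i, w j ^ 2) :
    (1 / 2) * unifPr n (fun x => |∑ j ∈ Finset.univ.erase i, w j * pm (x j)| ≤ α) ≥
      (1 / Real.sqrt (2 * Real.pi * ((n : ℝ) - 1) * B)) * (α - A / B)
      - α ^ 3 / (6 * Real.sqrt (2 * Real.pi) * (((n : ℝ) - 1) * B) ^ ((3 : ℝ) / 2))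
      - 3.4106 * A ^ ((4 : ℝ) / 3) / (((n : ℝ) - 1) ^ ((2 : ℝ) / 3) * B ^ 2) := by
  have hN : (0:ℝ) < (n : ℝ) - 1 := by
    have : (2:ℝ) ≤ n := by exact_mod_cast hn
    linarith
  set N := (n : ℝ) - 1 with hNd
  set Q := ∑ j ∈ Finset.univ.erase i, w j ^ 2 with hQ
  set R := ∑ j ∈ Finset.univ.erase i, |w j| ^ 3 with hR
  have hRpos : 0 < R := by
    obtain ⟨j, hj, hjp⟩ := Finset.exists_lt_of_sum_lt (s := Finset.univ.erase i)
      (f := fun _ => (0:ℝ)) (g := fun j => w j ^ 2) (by rw [Finset.sum_const_zero]; exact hpos)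
    apply Finset.sum_pos' (fun k _ => by positivity)
    refine ⟨j, hj, ?_⟩
    have : w j ≠ 0 := by
      rintro h
      simp [h] at hjp
    positivity
  set σ := √Q with hσ
  have hσp : 0 < σ := Real.sqrt_pos.mpr hpos
  have hσ2 : σ ^ 2 = Q := Real.sq_sqrt hpos.le
  set y := (R / σ ^ 3) ^ ((1:ℝ) / 3) with hyd
  have hyp : 0 < y := by positivity
  have hy3 : y ^ 3 = R / σ ^ 3 := by
    rw [hyd, ← Real.rpow_natCast, ← Real.rpow_mul (by positivity)]; norm_num
  have hRy : R = (y * σ) ^ 3 := by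
    rw [mul_pow, hy3]; field_simp
  set u : Fin n → ℝ := fun j => if j = i then 0 else w j / σ with hu
  have hsum : ∀ f : Fin n → ℝ, f i = 0 → ∑ j, f j = ∑ j ∈ Finset.univ.erase i, f j := by
    intro f hf
    rw [← Finset.add_sum_erase _ _ (Finset.mem_univ i), hf, zero_add]
  have hu2 : ∑ j, u j ^ 2 = 1 := by
    rw [hsum _ (by simp [hu])]
    have : ∑ j ∈ Finset.univ.erase i, u j ^ 2 = ∑ j ∈ Finset.univ.erase i, w j ^ 2 / σ ^ 2 := by
      apply Finset.sum_congr rfl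
      intro j hj
      simp only [hu, if_neg (Finset.ne_of_mem_erase hj), div_pow]
    rw [this, ← Finset.sum_div, hσ2]
    exact div_self hpos.ne'
  have hu3 : ∑ j, |u j| ^ 3 = y ^ 3 := by
    rw [hsum _ (by simp [hu]), hy3]
    have : ∑ j ∈ Finset.univ.erase i, |u j| ^ 3 = ∑ j ∈ Finset.univ.erase i, |w j| ^ 3 / σ ^ 3 := by
      apply Finset.sum_congr rfl
      intro j hj
      simp only [hu, if_neg (Finset.ne_of_mem_erase hj), abs_div, abs_of_pos hσp, div_pow]
    rw [this, ← Finset.sum_div]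
  have key := ra_normalized u y hyp hu2 hu3 (α / σ) (by positivity)
  have hev : (fun x : Fin n → Bool => |∑ j, u j * pm (x j)| ≤ α / σ)
      = (fun x => |∑ j ∈ Finset.univ.erase i, w j * pm (x j)| ≤ α) := by
    funext x
    rw [hsum _ (by simp [hu])]
    have : ∑ j ∈ Finset.univ.erase i, u j * pm (x j)
        = (∑ j ∈ Finset.univ.erase i, w j * pm (x j)) / σ := by
      rw [Finset.sum_div]
      apply Finset.sum_congr rfl
      intro j hj
      simp only [hu, if_neg (Finset.ne_of_mem_erase hj)]
      ring
    rw [this, abs_div, abs_of_pos hσp, div_le_div_iff_of_pos_right hσp]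
  rw [hev] at key
  refine le_trans (le_of_eq ?_) key
  have hNB : N * B = σ ^ 2 := by rw [hB, hσ2]; field_simp
  have hBs : B = σ ^ 2 / N := by rw [← hNB]; field_simp
  have hAs : A = (y * σ) ^ 3 / N := by rw [hA, ← hRy]; ring
  have e1 : √(2 * π * N * B) = √(2 * π) * σ := by
    rw [mul_assoc (2 * π), hNB, Real.sqrt_mul (by positivity), Real.sqrt_sq hσp.le]
  have e2 : (N * B) ^ ((3:ℝ) / 2) = σ ^ 3 := by
    rw [hNB, ← Real.rpow_natCast, ← Real.rpow_mul hσp.le, ← Real.rpow_natCast]; norm_num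
  have e3 : A ^ ((4:ℝ) / 3) = (y * σ) ^ 4 / N ^ ((4:ℝ) / 3) := by
    rw [hAs, Real.div_rpow (by positivity) hN.le, ← Real.rpow_natCast,
      ← Real.rpow_mul (by positivity), ← Real.rpow_natCast]; norm_num
  have e4 : N ^ ((4:ℝ) / 3) * N ^ ((2:ℝ) / 3) = N ^ 2 := by
    rw [← Real.rpow_add hN, ← Real.rpow_natCast]; norm_num
  have e5 : A / B = y ^ 3 * σ := by rw [hAs, hBs]; field_simp
  have e6 : 3.4106 * A ^ ((4:ℝ) / 3) / (N ^ ((2:ℝ) / 3) * B ^ 2) = 3.4106 * y ^ 4 := by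
    rw [e3, hBs]
    have h1 : 0 < N ^ ((4:ℝ) / 3) := by positivity
    have h2 : 0 < N ^ ((2:ℝ) / 3) := by positivity
    generalize N ^ ((4:ℝ) / 3) = p at *
    generalize N ^ ((2:ℝ) / 3) = q at *
    have : 3.4106 * ((y * σ) ^ 4 / p) / (q * (σ ^ 2 / N) ^ 2) = 3.4106 * y ^ 4 * (N ^ 2 / (p * q)) := by
      field_simp
    rw [this, e4, div_self (by positivity), mul_one]
  rw [e6, e1, e2, e5]
  have hs : 0 < √(2 * π) := by positivity
  congr 1
  field_simp
end

section
/- Let n ≥ 2, let w₀, w₁, …, w_n be real numbers, and let f : {−1,1}^n → {−1,1} be defined by f(x) = sign(w₀ + Σ_{j=1}^n w_j x_j). Fix i ∈ {1,…,n} and assume not all of {w_j : 0 ≤ j ≤ n, j ≠ i} are zero. Set A_i = (1/(n−1))·Σ_{0≤j≤n, j≠i} |w_j|³ and B_i = (1/(n−1))·Σ_{0≤j≤n, j≠i} w_j². Then Inf_i(f) ≥ (1/(2√(2π(n−1)B_i)))·(|w_i| − A_i/B_i) − |w_i|³/(6√(2π)·((n−1)B_i)^{3/2}) − 3.4106·A_i^{4/3}/((n−1)^{2/3}·B_i²).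 -/
open Finset Real MeasureTheory ProbabilityTheory
open scoped Classical

namespace InfLB

/-! ### Elementary inequalities -/

lemma mul_cos_le_sin {u : ℝ} (h0 : 0 ≤ u) (h1 : u ≤ π) : u * Real.cos u ≤ Real.sin u := by
  rcases le_or_gt (π / 2) u with h | h
  · have hc : Real.cos u ≤ 0 := Real.cos_nonpos_of_pi_div_two_le_of_le h (by linarith)
    have hs : 0 ≤ Real.sin u := Real.sin_nonneg_of_nonneg_of_le_pi h0 h1
    nlinarith
  · have hc : 0 < Real.cos u := Real.cos_pos_of_mem_Ioo ⟨by linarith [Real.pi_pos], h⟩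
    have ht : u ≤ Real.tan u := Real.le_tan h0 h
    rw [Real.tan_eq_sin_div_cos, le_div_iff₀ hc] at ht
    exact ht

lemma exp_neg_le_quad {q : ℝ} (hq : 0 ≤ q) : Real.exp (-q) ≤ 1 - q + q ^ 2 / 2 := by
  have h := Real.quadratic_le_exp_of_nonneg hq
  have hp : 0 < 1 + q + q ^ 2 / 2 := by positivity
  rw [Real.exp_neg]
  calc (Real.exp q)⁻¹ ≤ (1 + q + q ^ 2 / 2)⁻¹ := inv_anti₀ hp h
    _ ≤ 1 - q + q ^ 2 / 2 := by
      rw [inv_le_iff_one_le_mul₀ hp]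
      nlinarith [sq_nonneg (q ^ 2)]

lemma cos_ge_exp {u : ℝ} (h0 : 0 ≤ u) (h1 : u ≤ π / 2) :
    Real.exp (-(u ^ 2 / 2)) * (1 - u ^ 4 / 2) ≤ Real.cos u := by
  rcases le_or_gt 2 (u ^ 4) with h | h
  · have hc : 0 ≤ Real.cos u := Real.cos_nonneg_of_mem_Icc ⟨by linarith [Real.pi_pos], h1⟩
    have := Real.exp_pos (-(u ^ 2 / 2))
    nlinarith
  · have h2 := Real.one_sub_sq_div_two_le_cos (x := u)
    have h3 := exp_neg_le_quad (q := u ^ 2 / 2) (by positivity)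
    have hq : u ^ 2 / 2 ≤ 1 := by nlinarith [sq_nonneg u]
    have h5 : Real.exp (-1) ≤ Real.exp (-(u ^ 2 / 2)) := Real.exp_le_exp.2 (by linarith)
    have h6 : (1:ℝ) / 4 ≤ Real.exp (-1) := by
      rw [Real.exp_neg, one_div]
      exact inv_anti₀ (Real.exp_pos _) (by linarith [Real.exp_one_lt_three])
    have h7 : u ^ 4 / 8 ≤ Real.exp (-(u ^ 2 / 2)) * (u ^ 4 / 2) := by
      have : 0 ≤ u ^ 4 := by positivity
      nlinarith
    nlinarith

lemma abs_cos_le_exp_of_sq {u e : ℝ} (h : Real.cos u ^ 2 ≤ Real.exp (2 * e)) :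
    |Real.cos u| ≤ Real.exp e := by
  refine abs_le_of_sq_le_sq ?_ (Real.exp_pos e).le
  rw [← Real.exp_nat_mul]
  exact_mod_cast h

lemma abs_cos_le_kappa {u : ℝ} (h0 : 0 ≤ u) :
    |Real.cos u| ≤ Real.exp (-(u ^ 2 / 2) + 0.29 * u ^ 3) := by
  apply abs_cos_le_exp_of_sq
  rcases le_or_gt 1.73 u with h | h
  · refine (Real.cos_sq_le_one u).trans ?_
    apply Real.one_le_exp
    nlinarith [sq_nonneg u]
  · have hs := Real.sin_ge_sub_cube h0
    have hpos : 0 ≤ u - u ^ 3 / 6 := by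
      have : u ^ 2 ≤ 3 := by nlinarith
      nlinarith
    have h2 : (u - u ^ 3 / 6) ^ 2 ≤ Real.sin u ^ 2 := pow_le_pow_left₀ hpos hs 2
    have h3 := Real.sin_sq_add_cos_sq u
    have h4 : Real.cos u ^ 2 ≤ 1 - u ^ 2 + 0.58 * u ^ 3 := by
      have h6 : 0 ≤ u ^ 3 := by positivity
      have h7 : 0 ≤ u ^ 6 := by positivity
      nlinarith
    have h5 := Real.add_one_le_exp (2 * (-(u ^ 2 / 2) + 0.29 * u ^ 3))
    linarith

lemma abs_cos_le_eps {s u : ℝ} (hs0 : 0 < s) (hs1 : s ≤ 1) (h0 : 0 ≤ u) :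
    |Real.cos u| ≤ Real.exp (-(2 * s ^ 2 / π ^ 2) * (u ^ 2 - u ^ 3 * (1 + s) / π)) := by
  have hpi := Real.pi_pos
  apply abs_cos_le_exp_of_sq
  rcases le_or_gt π (u * (1 + s)) with h | h
  · refine (Real.cos_sq_le_one u).trans ?_
    apply Real.one_le_exp
    have : u ^ 2 - u ^ 3 * (1 + s) / π = - (u ^ 2 * (u * (1 + s) - π) / π) := by
      field_simp; ring
    rw [this]
    have h1 : 0 ≤ u ^ 2 * (u * (1 + s) - π) / π := by
      apply div_nonneg _ hpi.le
      exact mul_nonneg (sq_nonneg _) (by linarith)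
    have h2 : 0 ≤ 2 * s ^ 2 / π ^ 2 := by positivity
    nlinarith
  · have hsin : 2 / π * (s * u) ≤ Real.sin u := by
      rcases le_or_gt u (π / 2) with h2 | h2
      · refine le_trans ?_ (Real.mul_le_sin h0 h2)
        have : 0 < 2 / π := by positivity
        have : s * u ≤ u := by nlinarith
        gcongr
      · rw [← Real.sin_pi_sub]
        refine le_trans ?_ (Real.mul_le_sin (x := π - u) (by nlinarith) (by linarith))
        have : 0 < 2 / π := by positivity
        gcongr
        linarith
    have h2 : (2 / π * (s * u)) ^ 2 ≤ Real.sin u ^ 2 := pow_le_pow_left₀ (by positivity) hsin 2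
    have h3 := Real.sin_sq_add_cos_sq u
    have h5 := Real.add_one_le_exp (2 * (-(2 * s ^ 2 / π ^ 2) * (u ^ 2 - u ^ 3 * (1 + s) / π)))
    have h6 : 2 * (-(2 * s ^ 2 / π ^ 2) * (u ^ 2 - u ^ 3 * (1 + s) / π))
        = -(2 / π * (s * u)) ^ 2 + (2 * s ^ 2 / π ^ 2) * 2 * (u ^ 3 * (1 + s) / π) := by
      field_simp; ring
    have h7 : 0 ≤ (2 * s ^ 2 / π ^ 2) * 2 * (u ^ 3 * (1 + s) / π) := by positivity
    linarith

lemma one_sub_sum_le_prod {ι : Type*} (s : Finset ι) (y : ι → ℝ) (h0 : ∀ j ∈ s, 0 ≤ y j)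
    (h1 : ∀ j ∈ s, y j ≤ 1) : 1 - ∑ j ∈ s, y j ≤ ∏ j ∈ s, (1 - y j) := by
  classical
  induction s using Finset.induction_on with
  | empty => simp
  | insert a s ha ih =>
    rw [Finset.sum_insert ha, Finset.prod_insert ha]
    have i1 := ih (fun j hj => h0 j (Finset.mem_insert_of_mem hj))
      (fun j hj => h1 j (Finset.mem_insert_of_mem hj))
    have hy0 := h0 a (Finset.mem_insert_self _ _)
    have hy1 := h1 a (Finset.mem_insert_self _ _)
    have hs : 0 ≤ ∑ j ∈ s, y j := Finset.sum_nonneg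
      (fun j hj => h0 j (Finset.mem_insert_of_mem hj))
    nlinarith

/-! ### The trigonometric weight and the band-limited minorant -/

/-- the weight function -/
noncomputable def D (c u : ℝ) : ℝ := (1 + c) * Real.sin u + (1 - c) * ((π - u) * Real.cos u)

lemma D_cont (c : ℝ) : Continuous (D c) := by unfold D; fun_prop

lemma D_nonneg {c u : ℝ} (hc0 : 0 ≤ c) (hc1 : c ≤ 1) (h0 : 0 ≤ u) (h1 : u ≤ π) : 0 ≤ D c u := by
  have h := mul_cos_le_sin (u := π - u) (by linarith) (by linarith)
  rw [Real.cos_pi_sub, Real.sin_pi_sub] at h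
  have hs : 0 ≤ Real.sin u := Real.sin_nonneg_of_nonneg_of_le_pi h0 h1
  unfold D
  nlinarith

lemma D_le {c u : ℝ} (hc0 : 0 ≤ c) (hc1 : c ≤ 1) (h0 : 0 ≤ u) (h1 : u ≤ π) : D c u ≤ π := by
  have hs : Real.sin u ≤ u := Real.sin_le h0
  have hs1 := Real.sin_le_one u
  have hc := Real.cos_le_one u
  have h2 : (π - u) * Real.cos u ≤ π - u := by nlinarith
  have h3 := Real.pi_gt_three
  unfold D
  nlinarith

lemma D_ge {c u : ℝ} (hc0 : 0 ≤ c) (hc1 : c ≤ 1) (h0 : 0 ≤ u) (h1 : u ≤ π) :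
    (1 - c) * π * (1 - u ^ 2 / 2) ≤ D c u := by
  have hs : 0 ≤ Real.sin u := Real.sin_nonneg_of_nonneg_of_le_pi h0 h1
  have h := mul_cos_le_sin h0 h1
  have hc := Real.one_sub_sq_div_two_le_cos (x := u)
  have h2 : π * (1 - u ^ 2 / 2) ≤ Real.sin u + (π - u) * Real.cos u := by
    nlinarith [Real.pi_pos]
  unfold D
  nlinarith

/-- the minorant -/
noncomputable def g (c y : ℝ) : ℝ := (1 / 4) * ∫ u in (0:ℝ)..π, D c u * Real.cos (u * y)

lemma g_identity (c y : ℝ) :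
    (1 - y ^ 2) ^ 2 * g c y = (1 - c * y ^ 2) * Real.cos (π * y / 2) ^ 2 := by
  have key : ∫ u in (0:ℝ)..π, (1 - y ^ 2) ^ 2 * (D c u * Real.cos (u * y)) =
      ((1 + c) * (1 - y ^ 2) * (-(Real.cos π * Real.cos (π * y)) - y * (Real.sin π * Real.sin (π * y)))
        + (1 - c) * ((π - π) * (1 - y ^ 2) * (Real.sin π * Real.cos (π * y) - y * (Real.cos π * Real.sin (π * y)))
          - (1 + y ^ 2) * (Real.cos π * Real.cos (π * y)) - 2 * y * (Real.sin π * Real.sin (π * y))))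
      - ((1 + c) * (1 - y ^ 2) * (-(Real.cos 0 * Real.cos (0 * y)) - y * (Real.sin 0 * Real.sin (0 * y)))
        + (1 - c) * ((π - 0) * (1 - y ^ 2) * (Real.sin 0 * Real.cos (0 * y) - y * (Real.cos 0 * Real.sin (0 * y)))
          - (1 + y ^ 2) * (Real.cos 0 * Real.cos (0 * y)) - 2 * y * (Real.sin 0 * Real.sin (0 * y)))) := by
    apply intervalIntegral.integral_eq_sub_of_hasDerivAt
      (f := fun u => (1 + c) * (1 - y ^ 2) * (-(Real.cos u * Real.cos (u * y)) - y * (Real.sin u * Real.sin (u * y)))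
        + (1 - c) * ((π - u) * (1 - y ^ 2) * (Real.sin u * Real.cos (u * y) - y * (Real.cos u * Real.sin (u * y)))
          - (1 + y ^ 2) * (Real.cos u * Real.cos (u * y)) - 2 * y * (Real.sin u * Real.sin (u * y))))
    · intro u _
      have hs := Real.hasDerivAt_sin u
      have hc := Real.hasDerivAt_cos u
      have hl : HasDerivAt (fun u : ℝ => u * y) y u := by simpa using (hasDerivAt_id u).mul_const y
      have hsy := hl.sin
      have hcy := hl.cos
      have hpi : HasDerivAt (fun u : ℝ => π - u) (-1) u := by
        simpa using (hasDerivAt_id u).const_sub π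
      have hcc := hc.fun_mul hcy
      have hss := hs.fun_mul hsy
      have hsc := hs.fun_mul hcy
      have hcs := hc.fun_mul hsy
      have := ((hcc.fun_neg.fun_sub (hss.const_mul y)).const_mul ((1 + c) * (1 - y ^ 2))).fun_add
        (((((hpi.mul_const (1 - y ^ 2)).fun_mul (hsc.fun_sub (hcs.const_mul y))).fun_sub
          (hcc.const_mul (1 + y ^ 2))).fun_sub (hss.const_mul (2 * y))).const_mul (1 - c))
      convert this using 1
      unfold D
      ring
    · apply Continuous.intervalIntegrable
      have := D_cont c
      fun_prop
  rw [intervalIntegral.integral_const_mul] at key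
  unfold g
  have h2 : Real.cos (π * y / 2) ^ 2 = (1 + Real.cos (π * y)) / 2 := by
    rw [Real.cos_sq]; ring_nf
  rw [h2]
  simp only [Real.cos_pi, Real.sin_pi, zero_mul, Real.cos_zero, Real.sin_zero] at key
  linear_combination (1 / 4) * key

lemma g_zero (c : ℝ) : g c 0 = 1 := by
  have := g_identity c 0
  simpa using this

lemma g_le_one {c : ℝ} (hc0 : 0 ≤ c) (hc1 : c ≤ 1) (y : ℝ) : g c y ≤ 1 := by
  rw [← g_zero c]
  unfold g
  have hD := D_cont c
  have : ∫ u in (0:ℝ)..π, D c u * Real.cos (u * y) ≤ ∫ u in (0:ℝ)..π, D c u * Real.cos (u * 0) := by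
    apply intervalIntegral.integral_mono_on Real.pi_pos.le
    · apply Continuous.intervalIntegrable; fun_prop
    · apply Continuous.intervalIntegrable; fun_prop
    · intro u hu
      have := D_nonneg hc0 hc1 hu.1 hu.2
      have := Real.cos_le_one (u * y)
      simp only [mul_zero, Real.cos_zero]
      nlinarith
  linarith

lemma g_nonpos {c : ℝ} (hc0 : 0 ≤ c) (hc1 : c < 1) {y : ℝ} (hy : 1 ≤ c * y ^ 2) : g c y ≤ 0 := by
  have h := g_identity c y
  have hy2 : 1 < y ^ 2 := by
    by_contra hh
    push Not at hh
    nlinarith [sq_nonneg y]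
  have h1 : 0 < (1 - y ^ 2) ^ 2 := by
    have : 1 - y ^ 2 ≠ 0 := by linarith
    positivity
  have h2 : (1 - c * y ^ 2) * Real.cos (π * y / 2) ^ 2 ≤ 0 :=
    mul_nonpos_of_nonpos_of_nonneg (by linarith) (sq_nonneg _)
  by_contra hh
  push Not at hh
  have := mul_pos h1 hh
  linarith

/-! ### Bounds on the characteristic function -/

/-- characteristic function of a Rademacher sum -/
noncomputable def phi {ι : Type*} (s : Finset ι) (v : ι → ℝ) (t : ℝ) : ℝ :=
  ∏ j ∈ s, Real.cos (v j * t)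

lemma phi_cont {ι : Type*} (s : Finset ι) (v : ι → ℝ) : Continuous (phi s v) := by
  unfold phi; fun_prop

lemma cos_abs_mul (x t : ℝ) (ht : 0 ≤ t) : Real.cos (|x| * t) = Real.cos (x * t) := by
  rw [← Real.cos_abs (x * t), abs_mul, abs_of_nonneg ht]

lemma phi_ge {ι : Type*} (s : Finset ι) (v : ι → ℝ) {r t : ℝ} (hr : 0 < r)
    (h2 : ∑ j ∈ s, v j ^ 2 = 1) (h3 : ∑ j ∈ s, |v j| ^ 3 = r ^ 3)
    (ht : 0 ≤ t) (htr : r * t ≤ π / 2) :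
    Real.exp (-(t ^ 2 / 2)) * (1 - t ^ 4 * r ^ 4 / 2) ≤ phi s v t := by
  have hvr : ∀ j ∈ s, |v j| ≤ r := by
    intro j hj
    have : |v j| ^ 3 ≤ r ^ 3 := by
      rw [← h3]
      exact Finset.single_le_sum (f := fun j => |v j| ^ 3) (fun i _ => by positivity) hj
    exact le_of_pow_le_pow_left₀ (by norm_num) hr.le this
  have hu : ∀ j ∈ s, |v j| * t ≤ π / 2 := fun j hj =>
    (mul_le_mul_of_nonneg_right (hvr j hj) ht).trans htr
  have hcos : ∀ j ∈ s, 0 ≤ Real.cos (v j * t) := by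
    intro j hj
    rw [← cos_abs_mul _ _ ht]
    have : 0 ≤ |v j| * t := by positivity
    exact Real.cos_nonneg_of_mem_Icc ⟨by linarith [Real.pi_pos], hu j hj⟩
  have hphi : 0 ≤ phi s v t := Finset.prod_nonneg hcos
  have hsum4 : ∑ j ∈ s, (|v j| * t) ^ 4 / 2 ≤ t ^ 4 * r ^ 4 / 2 := by
    have : ∑ j ∈ s, |v j| ^ 4 ≤ r ^ 4 := by
      calc ∑ j ∈ s, |v j| ^ 4 ≤ ∑ j ∈ s, r * |v j| ^ 3 := by
            apply Finset.sum_le_sum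
            intro j hj
            have := mul_le_mul_of_nonneg_right (hvr j hj) (pow_nonneg (abs_nonneg (v j)) 3)
            calc |v j| ^ 4 = |v j| * |v j| ^ 3 := by ring
              _ ≤ _ := this
        _ = r ^ 4 := by rw [← Finset.mul_sum, h3]; ring
    calc ∑ j ∈ s, (|v j| * t) ^ 4 / 2 = (t ^ 4 / 2) * ∑ j ∈ s, |v j| ^ 4 := by
          rw [Finset.mul_sum]; apply Finset.sum_congr rfl; intro j _; ring
      _ ≤ (t ^ 4 / 2) * r ^ 4 := by gcongr
      _ = _ := by ring
  have he := Real.exp_pos (-(t ^ 2 / 2))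
  rcases le_or_gt 1 (t ^ 4 * r ^ 4 / 2) with hbig | hsmall
  · nlinarith
  · have hy1 : ∀ j ∈ s, (|v j| * t) ^ 4 / 2 ≤ 1 := by
      intro j hj
      have := Finset.single_le_sum (f := fun j => (|v j| * t) ^ 4 / 2)
        (fun i _ => by positivity) hj
      linarith
    have hp := one_sub_sum_le_prod s (fun j => (|v j| * t) ^ 4 / 2) (fun j _ => by positivity) hy1
    have hexp : Real.exp (-(t ^ 2 / 2)) = ∏ j ∈ s, Real.exp (-((|v j| * t) ^ 2 / 2)) := by
      rw [← Real.exp_sum]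
      congr 1
      rw [Finset.sum_neg_distrib]
      congr 1
      calc t ^ 2 / 2 = (t ^ 2 / 2) * ∑ j ∈ s, v j ^ 2 := by rw [h2]; ring
        _ = _ := by
          rw [Finset.mul_sum]; apply Finset.sum_congr rfl; intro j _
          rw [mul_pow, sq_abs]; ring
    calc Real.exp (-(t ^ 2 / 2)) * (1 - t ^ 4 * r ^ 4 / 2)
        ≤ Real.exp (-(t ^ 2 / 2)) * ∏ j ∈ s, (1 - (|v j| * t) ^ 4 / 2) := by
          apply mul_le_mul_of_nonneg_left _ he.le
          linarith
      _ = ∏ j ∈ s, (Real.exp (-((|v j| * t) ^ 2 / 2)) * (1 - (|v j| * t) ^ 4 / 2)) := by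
          rw [hexp, Finset.prod_mul_distrib]
      _ ≤ phi s v t := by
          apply Finset.prod_le_prod
          · intro j hj
            have := hy1 j hj
            exact mul_nonneg (Real.exp_pos _).le (by linarith)
          · intro j hj
            rw [← cos_abs_mul _ _ ht]
            exact cos_ge_exp (by positivity) (hu j hj)

lemma phi_abs_le {ι : Type*} (s : Finset ι) (v : ι → ℝ) {r t α β : ℝ}
    (h2 : ∑ j ∈ s, v j ^ 2 = 1) (h3 : ∑ j ∈ s, |v j| ^ 3 = r ^ 3) (ht : 0 ≤ t)
    (hcos : ∀ u : ℝ, 0 ≤ u → |Real.cos u| ≤ Real.exp (α * u ^ 2 + β * u ^ 3)) :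
    |phi s v t| ≤ Real.exp (α * t ^ 2 + β * (r ^ 3 * t ^ 3)) := by
  unfold phi
  rw [Finset.abs_prod]
  calc ∏ j ∈ s, |Real.cos (v j * t)|
      ≤ ∏ j ∈ s, Real.exp (α * (|v j| * t) ^ 2 + β * (|v j| * t) ^ 3) := by
        apply Finset.prod_le_prod
        · intro j _; positivity
        · intro j _
          rw [← cos_abs_mul _ _ ht]
          exact hcos _ (by positivity)
    _ = _ := by
        rw [← Real.exp_sum]
        congr 1
        rw [Finset.sum_add_distrib, ← Finset.mul_sum, ← Finset.mul_sum]
        congr 2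
        · calc ∑ j ∈ s, (|v j| * t) ^ 2 = (∑ j ∈ s, v j ^ 2) * t ^ 2 := by
                rw [Finset.sum_mul]; apply Finset.sum_congr rfl; intro j _
                rw [mul_pow, sq_abs]
            _ = _ := by rw [h2, one_mul]
        · rw [← h3, Finset.sum_mul]; apply Finset.sum_congr rfl; intro j _
          rw [mul_pow]

lemma phi_kappa {ι : Type*} (s : Finset ι) (v : ι → ℝ) {r t : ℝ}
    (h2 : ∑ j ∈ s, v j ^ 2 = 1) (h3 : ∑ j ∈ s, |v j| ^ 3 = r ^ 3) (ht : 0 ≤ t) :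
    |phi s v t| ≤ Real.exp (-(1 / 2) * t ^ 2 + 0.29 * (r ^ 3 * t ^ 3)) := by
  apply phi_abs_le s v h2 h3 ht
  intro u hu
  convert abs_cos_le_kappa hu using 2
  ring

lemma phi_eps {ι : Type*} (s : Finset ι) (v : ι → ℝ) {r t σ : ℝ}
    (h2 : ∑ j ∈ s, v j ^ 2 = 1) (h3 : ∑ j ∈ s, |v j| ^ 3 = r ^ 3) (ht : 0 ≤ t)
    (hs0 : 0 < σ) (hs1 : σ ≤ 1) :
    |phi s v t| ≤ Real.exp (-(2 * σ ^ 2 / π ^ 2) * t ^ 2 +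
      (2 * σ ^ 2 / π ^ 2 * (1 + σ) / π) * (r ^ 3 * t ^ 3)) := by
  apply phi_abs_le s v h2 h3 ht
  intro u hu
  convert abs_cos_le_eps hs0 hs1 hu using 2
  ring

lemma exp_neg_le_pow {x : ℝ} (hx : 0 < x) (n : ℕ) :
    Real.exp (-x) ≤ n.factorial / x ^ n := by
  have h := Real.pow_div_factorial_le_exp x hx.le n
  have hf : (0:ℝ) < n.factorial := by exact_mod_cast n.factorial_pos
  rw [Real.exp_neg, inv_le_comm₀ (Real.exp_pos _) (by positivity), inv_div]
  exact h

lemma phi_tail {ι : Type*} (s : Finset ι) (v : ι → ℝ) {r t y : ℝ} (hr : 0 < r)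
    (h2 : ∑ j ∈ s, v j ^ 2 = 1) (h3 : ∑ j ∈ s, |v j| ^ 3 = r ^ 3) (ht : 0 ≤ t)
    (hr1 : r ≤ 0.431) (hy : 0 < y) (hyr : 624 * r ^ 3 ≤ y ^ 3)
    (htl : 1 / 2 ≤ r ^ 3 * t) (hty : r ^ 3 * t * (1 + y) ≤ π) :
    |phi s v t| ≤ 0.25 * r ^ 4 := by
  have hpi := Real.pi_gt_d4
  have hpi2 := Real.pi_lt_d4
  have hr3 : 0 < r ^ 3 := by positivity
  have ht2 : 1 / (4 * r ^ 6) ≤ t ^ 2 := by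
    rw [div_le_iff₀ (by positivity)]
    calc (1:ℝ) = 4 * (1 / 2) ^ 2 := by norm_num
      _ ≤ 4 * (r ^ 3 * t) ^ 2 := by gcongr
      _ = t ^ 2 * (4 * r ^ 6) := by ring
  rcases le_or_gt 2 y with h | h
  · have h4 : r ^ 3 * t ≤ 1.0472 := by nlinarith
    refine (phi_kappa s v h2 h3 ht).trans ?_
    have hx : 0 < 0.049 / r ^ 6 := by positivity
    calc Real.exp (-(1 / 2) * t ^ 2 + 0.29 * (r ^ 3 * t ^ 3))
        ≤ Real.exp (-(0.049 / r ^ 6)) := by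
          apply Real.exp_le_exp.2
          have h5 : r ^ 3 * t ^ 3 ≤ 1.0472 * t ^ 2 := by
            have := mul_le_mul_of_nonneg_right h4 (sq_nonneg t)
            nlinarith
          have h6 : 0.049 / r ^ 6 ≤ 0.196 * t ^ 2 := by
            have : 0.049 / r ^ 6 = 0.196 * (1 / (4 * r ^ 6)) := by field_simp; norm_num
            rw [this]; gcongr
          nlinarith [sq_nonneg t]
      _ ≤ _ := exp_neg_le_pow hx 4
      _ = (24 / 0.049 ^ 4 * r ^ 20) * r ^ 4 := by
          simp only [Nat.factorial]; field_simp; norm_num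
      _ ≤ (24 / 0.049 ^ 4 * 0.431 ^ 20) * r ^ 4 := by gcongr
      _ ≤ _ := by gcongr; norm_num
  · refine (phi_eps s v h2 h3 ht (σ := y / 2) (by positivity) (by linarith)).trans ?_
    have hx : 0 < 1.3 / r ^ 3 := by positivity
    calc _ ≤ Real.exp (-(1.3 / r ^ 3)) := by
          apply Real.exp_le_exp.2
          have h5 : r ^ 3 * t * (1 + y / 2) / π ≤ 1 - y / 6 := by
            rw [div_le_iff₀ Real.pi_pos]
            have h7 : r ^ 3 * t * (1 + y / 2) * (1 + y) ≤ π * (1 + y / 2) := by nlinarith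
            have h8 : π * (1 + y / 2) ≤ (1 - y / 6) * π * (1 + y) := by
              have : (1 + y / 2) ≤ (1 - y / 6) * (1 + y) := by nlinarith
              nlinarith
            have h9 : 0 < 1 + y := by linarith
            nlinarith
          have h6 : -(2 * (y / 2) ^ 2 / π ^ 2) * t ^ 2 +
              (2 * (y / 2) ^ 2 / π ^ 2 * (1 + y / 2) / π) * (r ^ 3 * t ^ 3)
              = -((2 * (y / 2) ^ 2 / π ^ 2 * t ^ 2) * (1 - r ^ 3 * t * (1 + y / 2) / π)) := by
            field_simp; ring
          rw [h6]
          apply neg_le_neg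
          calc 1.3 / r ^ 3 ≤ (624 * r ^ 3) / (12 * π ^ 2) * (1 / (4 * r ^ 6)) := by
                have : (624 * r ^ 3) / (12 * π ^ 2) * (1 / (4 * r ^ 6)) = (13 / π ^ 2) / r ^ 3 := by
                  field_simp; norm_num
                rw [this]
                gcongr
                rw [le_div_iff₀ (by positivity)]
                nlinarith
            _ ≤ y ^ 3 / (12 * π ^ 2) * t ^ 2 := by gcongr
            _ = (2 * (y / 2) ^ 2 / π ^ 2 * t ^ 2) * (y / 6) := by field_simp; ring
            _ ≤ _ := by
              apply mul_le_mul_of_nonneg_left _ (by positivity)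
              linarith
      _ ≤ _ := exp_neg_le_pow hx 3
      _ = (6 / 1.3 ^ 3 * r ^ 5) * r ^ 4 := by
          simp only [Nat.factorial]; field_simp; norm_num
      _ ≤ (6 / 1.3 ^ 3 * 0.431 ^ 5) * r ^ 4 := by gcongr
      _ ≤ _ := by gcongr; norm_num

lemma phi_lower {ι : Type*} (s : Finset ι) (v : ι → ℝ) {r t X : ℝ} (hr : 0 < r)
    (h2 : ∑ j ∈ s, v j ^ 2 = 1) (h3 : ∑ j ∈ s, |v j| ^ 3 = r ^ 3) (ht : 0 ≤ t) (hX : 0 ≤ X)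
    (hXt : 1 / 2 ≤ r ^ 3 * t → |phi s v t| ≤ X) :
    Real.exp (-(t ^ 2 / 2)) - (r ^ 4 / 2 * (t ^ 4 * Real.exp (-(t ^ 2 / 2)))
      + (2 / π) ^ 4 * r ^ 4 * (t ^ 4 * Real.exp (-((0.84 * t) ^ 2 / 2))) + X) ≤ phi s v t := by
  have he := Real.exp_pos (-(t ^ 2 / 2))
  have he2 := Real.exp_pos (-((0.84 * t) ^ 2 / 2))
  have hq : 0 ≤ (2 / π) ^ 4 * r ^ 4 * (t ^ 4 * Real.exp (-((0.84 * t) ^ 2 / 2))) := by positivity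
  rcases le_or_gt (r * t) (π / 2) with h | h
  · have := phi_ge s v hr h2 h3 ht h
    nlinarith
  · have h4 : (π / 2) ^ 4 ≤ (r * t) ^ 4 := pow_le_pow_left₀ (by positivity) h.le 4
    have h5 : (2:ℝ) ≤ (π / 2) ^ 4 := by
      calc (2:ℝ) ≤ (3 / 2) ^ 4 := by norm_num
        _ ≤ _ := by gcongr; exact Real.pi_gt_three.le
    have h6 : Real.exp (-(t ^ 2 / 2)) ≤ r ^ 4 / 2 * (t ^ 4 * Real.exp (-(t ^ 2 / 2))) := by
      have : 2 ≤ r ^ 4 * t ^ 4 := by rw [← mul_pow]; linarith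
      nlinarith
    have h7 := neg_abs_le (phi s v t)
    rcases le_or_gt (1 / 2) (r ^ 3 * t) with h8 | h8
    · have := hXt h8
      linarith
    · have h9 : |phi s v t| ≤ Real.exp (-((0.84 * t) ^ 2 / 2)) := by
        refine (phi_kappa s v h2 h3 ht).trans (Real.exp_le_exp.2 ?_)
        have : r ^ 3 * t ^ 3 ≤ 1 / 2 * t ^ 2 := by
          have := mul_le_mul_of_nonneg_right h8.le (sq_nonneg t)
          nlinarith
        nlinarith [sq_nonneg t]
      have h10 : 1 ≤ (2 / π) ^ 4 * (r ^ 4 * t ^ 4) := by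
        calc (1:ℝ) = (2 / π) ^ 4 * (π / 2) ^ 4 := by field_simp
          _ ≤ (2 / π) ^ 4 * (r * t) ^ 4 := by gcongr
          _ = _ := by ring
      have h11 : Real.exp (-((0.84 * t) ^ 2 / 2)) ≤
          (2 / π) ^ 4 * r ^ 4 * (t ^ 4 * Real.exp (-((0.84 * t) ^ 2 / 2))) := by
        nlinarith
      linarith

/-! ### Gaussian moments -/

lemma gauss_intble (k : ℕ) {q : ℝ} (hq : 0 < q) :
    IntegrableOn (fun t : ℝ => t ^ k * Real.exp (-((q * t) ^ 2 / 2))) (Set.Ioi 0) := by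
  have h := integrableOn_rpow_mul_exp_neg_mul_sq (b := q ^ 2 / 2) (by positivity) (s := (k:ℝ))
    (by have : (0:ℝ) ≤ k := Nat.cast_nonneg k
        linarith)
  refine h.congr_fun ?_ measurableSet_Ioi
  intro t ht
  simp only [Real.rpow_natCast]
  congr 2
  ring

lemma gauss_moment (k : ℕ) {q : ℝ} (hq : 0 < q) :
    ∫ t in Set.Ioi (0:ℝ), t ^ k * Real.exp (-((q * t) ^ 2 / 2)) =
      (q ^ 2 / 2) ^ (-((k:ℝ) + 1) / 2) * (1 / 2) * Real.Gamma (((k:ℝ) + 1) / 2) := by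
  rw [← integral_rpow_mul_exp_neg_mul_rpow (p := 2) (q := (k:ℝ)) (b := q ^ 2 / 2) (by norm_num)
    (by have : (0:ℝ) ≤ k := Nat.cast_nonneg k
        linarith) (by positivity)]
  apply setIntegral_congr_fun measurableSet_Ioi
  intro t ht
  simp only [Real.rpow_natCast, Real.rpow_ofNat]
  congr 2
  ring

lemma half_rpow (k : ℕ) {q : ℝ} (hq : 0 < q) :
    (q ^ 2 / 2) ^ (-((k:ℝ) + 1) / 2) = (√2) ^ (k + 1) / q ^ (k + 1) := by
  have h1 : q ^ 2 / 2 = (q / √2) ^ (2:ℝ) := by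
    rw [Real.rpow_ofNat, div_pow, Real.sq_sqrt (by norm_num)]
  rw [h1, ← Real.rpow_mul (by positivity)]
  have h2 : (2:ℝ) * (-((k:ℝ) + 1) / 2) = -((k + 1 : ℕ) : ℝ) := by push_cast; ring
  rw [h2, Real.rpow_neg (by positivity), Real.rpow_natCast, div_pow, inv_div]

lemma gauss_moment4 {q : ℝ} (hq : 0 < q) :
    ∫ t in Set.Ioi (0:ℝ), t ^ 4 * Real.exp (-((q * t) ^ 2 / 2)) = 3 * √(π / 2) / q ^ 5 := by
  rw [gauss_moment 4 hq, half_rpow 4 hq]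
  have h := Real.Gamma_nat_add_half 2
  have h1 : (((4:ℕ):ℝ) + 1) / 2 = ((2:ℕ):ℝ) + 1 / 2 := by norm_num
  rw [h1, h]
  have h2 : √π = √(π / 2) * √2 := by
    rw [← Real.sqrt_mul (by positivity)]; congr 1; ring
  have h3 : √2 ^ 6 = (8:ℝ) := by
    calc √2 ^ 6 = (√2 ^ 2) ^ 3 := by ring
      _ = 8 := by rw [Real.sq_sqrt (by norm_num)]; norm_num
  have h4 : (Nat.doubleFactorial (2 * 2 - 1) : ℝ) = 3 := by norm_num [Nat.doubleFactorial]
  rw [h2, h4]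
  have : √2 ^ (4 + 1) / q ^ (4 + 1) * (1 / 2) * (3 * (√(π / 2) * √2) / 2 ^ 2)
    = √2 ^ 6 * (3 * √(π / 2)) / (8 * q ^ 5) := by ring
  rw [this, h3]
  field_simp

lemma gauss_moment2 :
    ∫ t in Set.Ioi (0:ℝ), t ^ 2 * Real.exp (-((1 * t) ^ 2 / 2)) = √(π / 2) := by
  rw [gauss_moment 2 one_pos, half_rpow 2 one_pos]
  have h := Real.Gamma_nat_add_half 1
  have h1 : (((2:ℕ):ℝ) + 1) / 2 = ((1:ℕ):ℝ) + 1 / 2 := by norm_num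
  rw [h1, h]
  have h2 : √π = √(π / 2) * √2 := by
    rw [← Real.sqrt_mul (by positivity)]; congr 1; ring
  have h3 : √2 ^ 4 = (4:ℝ) := by
    calc √2 ^ 4 = (√2 ^ 2) ^ 2 := by ring
      _ = 4 := by rw [Real.sq_sqrt (by norm_num)]; norm_num
  have h4 : (Nat.doubleFactorial (2 * 1 - 1) : ℝ) = 1 := by norm_num [Nat.doubleFactorial]
  rw [h2, h4]
  have : √2 ^ (2 + 1) / (1:ℝ) ^ (2 + 1) * (1 / 2) * (1 * (√(π / 2) * √2) / 2 ^ 1)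
    = √2 ^ 4 * (√(π / 2)) / 4 := by ring
  rw [this, h3]
  field_simp

lemma gauss_moment0 :
    ∫ t in Set.Ioi (0:ℝ), t ^ 0 * Real.exp (-((1 * t) ^ 2 / 2)) = √(π / 2) := by
  rw [gauss_moment 0 one_pos, half_rpow 0 one_pos]
  have h1 : (((0:ℕ):ℝ) + 1) / 2 = 1 / 2 := by norm_num
  rw [h1, Real.Gamma_one_half_eq]
  have h2 : √π = √(π / 2) * √2 := by
    rw [← Real.sqrt_mul (by positivity)]; congr 1; ring
  have h3 : √2 ^ 2 = (2:ℝ) := Real.sq_sqrt (by norm_num)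
  rw [h2]
  have : √2 ^ (0 + 1) / (1:ℝ) ^ (0 + 1) * (1 / 2) * (√(π / 2) * √2)
    = √2 ^ 2 * (√(π / 2)) / 2 := by ring
  rw [this, h3]
  field_simp

lemma trunc_moment4 {q T : ℝ} (hq : 0 < q) (hT : 0 ≤ T) :
    ∫ t in (0:ℝ)..T, t ^ 4 * Real.exp (-((q * t) ^ 2 / 2)) ≤ 3 * √(π / 2) / q ^ 5 := by
  rw [← gauss_moment4 hq, intervalIntegral.integral_of_le hT]
  apply setIntegral_mono_set (gauss_intble 4 hq)
  · exact Filter.Eventually.of_forall (fun t => by positivity)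
  · exact Filter.Eventually.of_forall (fun t ht => ht.1)

lemma trunc_main {b T : ℝ} (hT : 0 ≤ T) (hbT : 2 ≤ (b * T) ^ 2) :
    √(π / 2) * (1 - b ^ 2 / 2) ≤
      ∫ t in (0:ℝ)..T, (1 - (b * t) ^ 2 / 2) * Real.exp (-(t ^ 2 / 2)) := by
  have i0 := gauss_intble 0 one_pos
  have i2 := gauss_intble 2 one_pos
  have heq : (fun t : ℝ => (1 - (b * t) ^ 2 / 2) * Real.exp (-(t ^ 2 / 2))) =
      fun t => t ^ 0 * Real.exp (-((1 * t) ^ 2 / 2))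
        - (b ^ 2 / 2) * (t ^ 2 * Real.exp (-((1 * t) ^ 2 / 2))) := by
    funext t; simp only [one_mul]; ring
  have hi : IntegrableOn (fun t : ℝ => (1 - (b * t) ^ 2 / 2) * Real.exp (-(t ^ 2 / 2)))
      (Set.Ioi 0) := by
    rw [heq]
    exact i0.sub (i2.const_mul _)
  have htot : ∫ t in Set.Ioi (0:ℝ), (1 - (b * t) ^ 2 / 2) * Real.exp (-(t ^ 2 / 2)) =
      √(π / 2) * (1 - b ^ 2 / 2) := by
    rw [heq, integral_sub i0 (i2.const_mul _), integral_const_mul, gauss_moment0, gauss_moment2]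
    ring
  rw [← htot, intervalIntegral.integral_of_le hT, ← Set.Ioc_union_Ioi_eq_Ioi hT,
    setIntegral_union (Set.Ioc_disjoint_Ioi le_rfl) measurableSet_Ioi
      (hi.mono_set Set.Ioc_subset_Ioi_self) (hi.mono_set (Set.Ioi_subset_Ioi hT))]
  have : ∫ t in Set.Ioi T, (1 - (b * t) ^ 2 / 2) * Real.exp (-(t ^ 2 / 2)) ≤ 0 := by
    apply setIntegral_nonpos measurableSet_Ioi
    intro t ht
    apply mul_nonpos_of_nonpos_of_nonneg _ (Real.exp_pos _).le
    have h1 : T ≤ t := le_of_lt ht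
    have h2 : (b * T) ^ 2 ≤ (b * t) ^ 2 := by
      rw [mul_pow, mul_pow]; gcongr
    linarith
  linarith

/-! ### The expectation of the minorant -/

lemma main_integral {ι : Type*} (s : Finset ι) (v : ι → ℝ) {r b c X : ℝ} (hr : 0 < r)
    (h2 : ∑ j ∈ s, v j ^ 2 = 1) (h3 : ∑ j ∈ s, |v j| ^ 3 = r ^ 3)
    (hb : 0 < b) (hc0 : 0 ≤ c) (hc1 : c ≤ 1) (hX : 0 ≤ X)
    (hXt : ∀ t, 0 ≤ t → t ≤ π / b → 1 / 2 ≤ r ^ 3 * t → |phi s v t| ≤ X) :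
    (1 - c) * π * (√(π / 2) * (1 - b ^ 2 / 2)) - π * (r ^ 4 / 2 * (3 * √(π / 2))
      + (2 / π) ^ 4 * r ^ 4 * (3 * √(π / 2) / 0.84 ^ 5) + π / b * X) ≤
      ∫ t in (0:ℝ)..(π / b), D c (b * t) * phi s v t := by
  have hT : 0 ≤ π / b := by positivity
  have hbT : b * (π / b) = π := by field_simp
  have hDc := D_cont c
  have hpc := phi_cont s v
  have hm := trunc_main (b := b) hT (by rw [hbT]; nlinarith [Real.pi_gt_three])
  have h41 := trunc_moment4 (q := 1) one_pos hT
  have h42 := trunc_moment4 (q := 0.84) (by norm_num) hT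
  have hmono : ∫ t in (0:ℝ)..(π / b), ((1 - c) * π * ((1 - (b * t) ^ 2 / 2) * Real.exp (-(t ^ 2 / 2)))
      - π * (r ^ 4 / 2 * (t ^ 4 * Real.exp (-((1 * t) ^ 2 / 2)))
      + (2 / π) ^ 4 * r ^ 4 * (t ^ 4 * Real.exp (-((0.84 * t) ^ 2 / 2))) + X)) ≤
      ∫ t in (0:ℝ)..(π / b), D c (b * t) * phi s v t := by
    apply intervalIntegral.integral_mono_on hT
    · apply Continuous.intervalIntegrable; fun_prop
    · apply Continuous.intervalIntegrable; fun_prop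
    · intro t ht
      have hu0 : 0 ≤ b * t := mul_nonneg hb.le ht.1
      have hu1 : b * t ≤ π := by
        rw [← hbT]; exact mul_le_mul_of_nonneg_left ht.2 hb.le
      have d0 := D_nonneg hc0 hc1 hu0 hu1
      have d1 := D_le hc0 hc1 hu0 hu1
      have d2 := D_ge hc0 hc1 hu0 hu1
      have hphi := phi_lower s v hr h2 h3 ht.1 hX (hXt t ht.1 ht.2)
      rw [one_mul]
      set G := Real.exp (-(t ^ 2 / 2)) with hG
      have hGpos : 0 < G := Real.exp_pos _
      set E := r ^ 4 / 2 * (t ^ 4 * G) + (2 / π) ^ 4 * r ^ 4 * (t ^ 4 * Real.exp (-((0.84 * t) ^ 2 / 2))) + X with hE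
      have hEpos : 0 ≤ E := by positivity
      have e1 : D c (b * t) * (G - E) ≤ D c (b * t) * phi s v t :=
        mul_le_mul_of_nonneg_left hphi d0
      have e2 : D c (b * t) * E ≤ π * E := mul_le_mul_of_nonneg_right d1 hEpos
      have e3 := mul_le_mul_of_nonneg_right d2 hGpos.le
      nlinarith
  refine le_trans ?_ hmono
  have ic1 : IntervalIntegrable (fun t : ℝ => (1 - (b * t) ^ 2 / 2) * Real.exp (-(t ^ 2 / 2))) volume 0 (π / b) := by
    apply Continuous.intervalIntegrable; fun_prop
  have ic2 : IntervalIntegrable (fun t : ℝ => t ^ 4 * Real.exp (-((1 * t) ^ 2 / 2))) volume 0 (π / b) := by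
    apply Continuous.intervalIntegrable; fun_prop
  have ic3 : IntervalIntegrable (fun t : ℝ => t ^ 4 * Real.exp (-((0.84 * t) ^ 2 / 2))) volume 0 (π / b) := by
    apply Continuous.intervalIntegrable; fun_prop
  have ic4 : IntervalIntegrable (fun _ : ℝ => X) volume 0 (π / b) := by
    apply Continuous.intervalIntegrable; fun_prop
  rw [intervalIntegral.integral_sub (ic1.const_mul _)
      ((((ic2.const_mul _).add (ic3.const_mul _)).add ic4).const_mul _),
    intervalIntegral.integral_const_mul, intervalIntegral.integral_const_mul,
    intervalIntegral.integral_add ((ic2.const_mul _).add (ic3.const_mul _)) ic4,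
    intervalIntegral.integral_add (ic2.const_mul _) (ic3.const_mul _),
    intervalIntegral.integral_const_mul, intervalIntegral.integral_const_mul,
    intervalIntegral.integral_const]
  have hpi := Real.pi_pos
  have f1 : (1 - c) * π * (√(π / 2) * (1 - b ^ 2 / 2)) ≤ (1 - c) * π *
      ∫ t in (0:ℝ)..(π / b), (1 - (b * t) ^ 2 / 2) * Real.exp (-(t ^ 2 / 2)) :=
    mul_le_mul_of_nonneg_left hm (mul_nonneg (by linarith) hpi.le)
  rw [one_pow, div_one] at h41
  have f2 := mul_le_mul_of_nonneg_left h41 (show 0 ≤ r ^ 4 / 2 by positivity)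
  have f3 := mul_le_mul_of_nonneg_left h42 (show 0 ≤ (2 / π) ^ 4 * r ^ 4 by positivity)
  have f4 : π * (r ^ 4 / 2 * (∫ t in (0:ℝ)..(π / b), t ^ 4 * Real.exp (-((1 * t) ^ 2 / 2)))
      + (2 / π) ^ 4 * r ^ 4 * (∫ t in (0:ℝ)..(π / b), t ^ 4 * Real.exp (-((0.84 * t) ^ 2 / 2)))
      + (π / b - 0) • X) ≤ π * (r ^ 4 / 2 * (3 * √(π / 2))
      + (2 / π) ^ 4 * r ^ 4 * (3 * √(π / 2) / 0.84 ^ 5) + π / b * X) := by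
    apply mul_le_mul_of_nonneg_left _ hpi.le
    simp only [sub_zero, smul_eq_mul]
    linarith
  linarith

/-! ### Numerical assembly -/

set_option maxHeartbeats 2000000 in
lemma core_numeric {ι : Type*} (s : Finset ι) (v : ι → ℝ) {r a : ℝ} (hr : 0 < r) (ha : 0 ≤ a)
    (h2 : ∑ j ∈ s, v j ^ 2 = 1) (h3 : ∑ j ∈ s, |v j| ^ 3 = r ^ 3)
    (hpos : 0 < (a - r ^ 3) / (2 * √(2 * π)) - a ^ 3 / (6 * √(2 * π)) - 3.4106 * r ^ 4) :
    ∃ b, 0 < b ∧ b < a ∧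
      (a - r ^ 3) / (2 * √(2 * π)) - a ^ 3 / (6 * √(2 * π)) - 3.4106 * r ^ 4 ≤
        b / 4 * ∫ t in (0:ℝ)..(π / b), D ((b / a) ^ 2) (b * t) * phi s v t := by
  have hpi := Real.pi_gt_d4
  have hpi2 := Real.pi_lt_d4
  have hpi0 := Real.pi_pos
  have hr3 : 0 < r ^ 3 := by positivity
  have hr4 : 0 < r ^ 4 := by positivity
  obtain ⟨S, hS⟩ : ∃ S, S = √(2 * π) := ⟨_, rfl⟩
  have hS0 : 0 < S := by rw [hS]; positivity
  have hSS : S ^ 2 = 2 * π := by rw [hS]; exact Real.sq_sqrt (by positivity)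
  have hS1 : 2.5065 ≤ S := by
    rw [hS]; apply Real.le_sqrt_of_sq_le; norm_num; linarith
  have hS2 : S ≤ 2.5067 := by
    rw [hS]; apply Real.sqrt_le_iff.2; constructor <;> norm_num; linarith
  have hhalf : √(π / 2) = S / 2 := by
    rw [Real.sqrt_eq_iff_mul_self_eq (by positivity) (by positivity)]
    nlinarith
  rw [← hS] at hpos ⊢
  -- consequences of positivity
  have hp1 : 3.4106 * r ^ 4 * S < (a - r ^ 3) / 2 - a ^ 3 / 6 := by
    have e : ((a - r ^ 3) / (2 * S) - a ^ 3 / (6 * S) - 3.4106 * r ^ 4) * S =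
      (a - r ^ 3) / 2 - a ^ 3 / 6 - 3.4106 * r ^ 4 * S := by field_simp
    have := mul_pos hpos hS0
    linarith
  have hp2 : 8.548 * r ^ 4 < (a - r ^ 3) / 2 - a ^ 3 / 6 := by nlinarith
  have ha3 : 0 ≤ a ^ 3 := by positivity
  have hgap : 17.096 * r ^ 4 < a - r ^ 3 := by linarith
  have hr1 : r ≤ 0.431 := by
    by_contra hh
    push Not at hh
    have e1 : (0.431:ℝ) ^ 3 ≤ r ^ 3 := by gcongr
    have e2 : (0.431:ℝ) ^ 4 ≤ r ^ 4 := by gcongr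
    have e3 : a / 2 - a ^ 3 / 6 ≤ 1 / 3 := by nlinarith [mul_nonneg (sq_nonneg (a - 1)) (by linarith : 0 ≤ a + 2)]
    norm_num at e1 e2
    linarith
  have hL : r ^ 3 ≤ 0.0801 := by
    calc r ^ 3 ≤ 0.431 ^ 3 := by gcongr
      _ ≤ _ := by norm_num
  have haL : r ^ 3 < a := by linarith
  have ha0 : 0 < a := by linarith
  have ha1 : a < 1.7321 := by
    by_contra hh
    push Not at hh
    have : a * 3 ≤ a ^ 3 := by
      have : 3 ≤ a ^ 2 := by nlinarith
      nlinarith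
    linarith
  obtain ⟨b, hb⟩ : ∃ b, b = (a + r ^ 3) / 2 := ⟨_, rfl⟩
  have hb0 : 0 < b := by linarith
  have hba : b < a := by linarith
  have hb1 : b ≤ 0.9061 := by linarith
  refine ⟨b, hb0, hba, ?_⟩
  obtain ⟨y, hy⟩ : ∃ y, y = (a - r ^ 3) / (2 * r ^ 3) := ⟨_, rfl⟩
  have hyb : r ^ 3 * (1 + y) = b := by rw [hy, hb]; field_simp; ring
  have hyr : 8.548 * r ≤ y := by
    rw [hy, le_div_iff₀ (by positivity)]
    have : 8.548 * r * (2 * r ^ 3) = 17.096 * r ^ 4 := by ring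
    linarith
  have hy0 : 0 < y := lt_of_lt_of_le (by positivity) hyr
  have hy3 : 624 * r ^ 3 ≤ y ^ 3 := by
    calc 624 * r ^ 3 ≤ (8.548 * r) ^ 3 := by rw [mul_pow]; gcongr; norm_num
      _ ≤ y ^ 3 := by gcongr
  have hc0 : 0 ≤ (b / a) ^ 2 := by positivity
  have hc1 : (b / a) ^ 2 ≤ 1 := by
    apply pow_le_one₀ (by positivity)
    rw [div_le_one ha0]; exact hba.le
  have hmain := main_integral s v (X := 0.25 * r ^ 4) hr h2 h3 hb0 hc0 hc1 (by positivity) (by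
    intro t ht0 ht1 ht2
    apply phi_tail s v hr h2 h3 ht0 hr1 hy0 hy3 ht2
    rw [le_div_iff₀ hb0] at ht1
    calc r ^ 3 * t * (1 + y) = t * (r ^ 3 * (1 + y)) := by ring
      _ = t * b := by rw [hyb]
      _ ≤ π := ht1)
  have hmul := mul_le_mul_of_nonneg_left hmain (show 0 ≤ b / 4 by positivity)
  refine le_trans ?_ hmul
  rw [hhalf]
  -- main term
  have hm : (a - r ^ 3) / (2 * S) ≤
      b / 4 * ((1 - (b / a) ^ 2) * π * (S / 2 * (1 - b ^ 2 / 2))) := by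
    rw [div_le_iff₀ (by positivity)]
    have e1 : b / 4 * ((1 - (b / a) ^ 2) * π * (S / 2 * (1 - b ^ 2 / 2))) * (2 * S)
        = (π ^ 2 / 2) * (b * (1 - (b / a) ^ 2)) * (1 - b ^ 2 / 2) := by
      calc _ = (π / 4) * (b * (1 - (b / a) ^ 2)) * (1 - b ^ 2 / 2) * S ^ 2 := by ring
        _ = _ := by rw [hSS]; ring
    rw [e1]
    have e2 : 3 / 8 * (a - r ^ 3) ≤ b * (1 - (b / a) ^ 2) := by
      have : b * (1 - (b / a) ^ 2) = b * (a - b) * (a + b) / a ^ 2 := by field_simp; ring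
      rw [this, le_div_iff₀ (by positivity)]
      have e3 : b * (a - b) * (a + b) = (a - r ^ 3) * ((a + r ^ 3) * (3 * a + r ^ 3) / 8) := by
        rw [hb]; ring
      rw [e3]
      have e4 : 3 / 8 * a ^ 2 ≤ (a + r ^ 3) * (3 * a + r ^ 3) / 8 := by nlinarith
      have := mul_le_mul_of_nonneg_left e4 (show 0 ≤ a - r ^ 3 by linarith)
      linarith
    have e5 : 0.58 ≤ 1 - b ^ 2 / 2 := by
      have h5 : b ^ 2 ≤ 0.9061 ^ 2 := by gcongr
      norm_num at h5 ⊢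
      linarith
    have e6 : 4.93 ≤ π ^ 2 / 2 := by
      have h6 : (3.1415:ℝ) ^ 2 ≤ π ^ 2 := by gcongr
      norm_num at h6 ⊢
      linarith
    have hg : 0 ≤ a - r ^ 3 := by linarith
    calc a - r ^ 3 ≤ 4.93 * (3 / 8 * (a - r ^ 3)) * 0.58 := by linarith
      _ ≤ _ := by gcongr
  -- error term
  have he : b / 4 * (π * (r ^ 4 / 2 * (3 * (S / 2))
      + (2 / π) ^ 4 * r ^ 4 * (3 * (S / 2) / 0.84 ^ 5) + π / b * (0.25 * r ^ 4))) ≤ 3.4106 * r ^ 4 := by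
    have e1 : (2 / π) ^ 4 ≤ 0.1644 := by
      calc (2 / π) ^ 4 ≤ (2 / 3.1415) ^ 4 := by gcongr
        _ ≤ _ := by norm_num
    have e2 : b / 4 * (π * (r ^ 4 / 2 * (3 * (S / 2))
      + (2 / π) ^ 4 * r ^ 4 * (3 * (S / 2) / 0.84 ^ 5) + π / b * (0.25 * r ^ 4)))
      = (b * (3 * π * S / 8) * (1 / 2 + (2 / π) ^ 4 / 0.84 ^ 5) + π ^ 2 / 16) * r ^ 4 := by
      generalize (2 / π) ^ 4 = z
      field_simp
      ring
    rw [e2]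
    gcongr
    calc b * (3 * π * S / 8) * (1 / 2 + (2 / π) ^ 4 / 0.84 ^ 5) + π ^ 2 / 16
        ≤ 0.9061 * (3 * 3.1416 * 2.5067 / 8) * (1 / 2 + 0.1644 / 0.84 ^ 5) + 3.1416 ^ 2 / 16 := by
          gcongr
      _ ≤ 3.4106 := by norm_num
  have ha6 : 0 ≤ a ^ 3 / (6 * S) := by positivity
  linarith

/-! ### Probability -/

lemma sum_cos (n : ℕ) (c0 : ℝ) (v : Fin n → ℝ) :
    ∑ x : Fin n → Bool, Real.cos (c0 + ∑ j, v j * pm (x j)) =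
      2 ^ n * (Real.cos c0 * ∏ j, Real.cos (v j)) := by
  have h := Finset.prod_univ_sum (fun _ : Fin n => (Finset.univ : Finset Bool))
    (fun j b => Complex.exp (((v j * pm b : ℝ) : ℂ) * Complex.I))
  rw [Fintype.piFinset_univ] at h
  have h1 : ∀ j : Fin n, ∑ b : Bool, Complex.exp (((v j * pm b : ℝ) : ℂ) * Complex.I)
      = ((2 * Real.cos (v j) : ℝ) : ℂ) := by
    intro j
    simp only [Fintype.sum_bool, pm]
    push_cast
    rw [Complex.cos]
    simp
    ring
  simp_rw [h1] at h
  have h2 : ∀ x : Fin n → Bool, ∏ j, Complex.exp (((v j * pm (x j) : ℝ) : ℂ) * Complex.I)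
      = Complex.exp (((∑ j, v j * pm (x j) : ℝ) : ℂ) * Complex.I) := by
    intro x
    rw [← Complex.exp_sum, ← Finset.sum_mul]
    push_cast
    rfl
  simp_rw [h2] at h
  have h3 : ∑ x : Fin n → Bool, Real.cos (c0 + ∑ j, v j * pm (x j)) =
      (Complex.exp ((c0 : ℂ) * Complex.I) *
        ∑ x : Fin n → Bool, Complex.exp (((∑ j, v j * pm (x j) : ℝ) : ℂ) * Complex.I)).re := by
    rw [Finset.mul_sum, Complex.re_sum]
    apply Finset.sum_congr rfl
    intro x _
    rw [← Complex.exp_add, ← add_mul, ← Complex.ofReal_add, Complex.exp_ofReal_mul_I_re]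
  rw [h3, ← h, ← Complex.ofReal_prod, Complex.re_mul_ofReal, Complex.exp_ofReal_mul_I_re,
    Finset.prod_mul_distrib]
  simp
  ring

/-- the shifted sum without coordinate `i` -/
noncomputable def rest {n : ℕ} (w : Fin (n + 1) → ℝ) (i : Fin n) (x : Fin n → Bool) : ℝ :=
  Function.update w i.succ 0 0 + ∑ j : Fin n, Function.update w i.succ 0 j.succ * pm (x j)

lemma rest_flip {n : ℕ} (w : Fin (n + 1) → ℝ) (i : Fin n) (x : Fin n → Bool) :
    w 0 + ∑ j : Fin n, w j.succ * pm (x j) = rest w i x + w i.succ * pm (x i) := by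
  unfold rest
  have h0 : Function.update w i.succ 0 0 = w 0 := by
    rw [Function.update_of_ne]; exact (Fin.succ_ne_zero i).symm
  rw [h0, add_assoc]
  congr 1
  rw [← Finset.sum_erase_add _ _ (Finset.mem_univ i), ← Finset.sum_erase_add (a := i)
    (f := fun j : Fin n => Function.update w i.succ 0 j.succ * pm (x j)) _ (Finset.mem_univ i)]
  simp only [Function.update_self, zero_mul, add_zero]
  congr 1
  apply Finset.sum_congr rfl
  intro j hj
  rw [Function.update_of_ne]
  simpa using Finset.ne_of_mem_erase hj

lemma rest_flipAt {n : ℕ} (w : Fin (n + 1) → ℝ) (i : Fin n) (x : Fin n → Bool) :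
    rest w i (flipAt i x) = rest w i x := by
  unfold rest
  congr 1
  apply Finset.sum_congr rfl
  intro j _
  by_cases h : j = i
  · subst h; simp
  · unfold flipAt; rw [Function.update_of_ne h]

lemma ltf_flip {n : ℕ} (w : Fin (n + 1) → ℝ) (i : Fin n) (x : Fin n → Bool)
    (h : |rest w i x| < |w i.succ|) : ltf n w x ≠ ltf n w (flipAt i x) := by
  unfold ltf
  rw [rest_flip w i x, rest_flip w i (flipAt i x), rest_flipAt]
  have hf : pm (flipAt i x i) = - pm (x i) := by
    unfold flipAt pm; cases x i <;> simp
  rw [hf]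
  have hp : pm (x i) = 1 ∨ pm (x i) = -1 := by unfold pm; cases x i <;> simp
  unfold sgn
  have ⟨h1, h2⟩ := abs_lt.1 h
  rcases abs_cases (w i.succ) with ⟨ha, _⟩ | ⟨ha, _⟩ <;> rw [ha] at h1 h2 <;>
    rcases hp with hp | hp <;> rw [hp]
  · rw [if_pos (by linarith), if_neg (by linarith)]; norm_num
  · rw [if_neg (by linarith), if_pos (by linarith)]; norm_num
  · rw [if_neg (by linarith), if_pos (by linarith)]; norm_num
  · rw [if_pos (by linarith), if_neg (by linarith)]; norm_num

lemma sum_cos_rest {n : ℕ} (w : Fin (n + 1) → ℝ) (i : Fin n) (k : ℝ) :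
    ∑ x : Fin n → Bool, Real.cos (k * rest w i x) =
      2 ^ n * ∏ j ∈ Finset.univ.erase i.succ, Real.cos (w j * k) := by
  have h1 : ∀ x : Fin n → Bool, k * rest w i x = k * Function.update w i.succ 0 0 +
      ∑ j : Fin n, (k * Function.update w i.succ 0 j.succ) * pm (x j) := by
    intro x
    unfold rest
    rw [mul_add, Finset.mul_sum]
    congr 1
    apply Finset.sum_congr rfl
    intro j _; ring
  simp_rw [h1]
  rw [sum_cos]
  congr 1
  rw [← Fin.prod_univ_succ (fun j => Real.cos (k * Function.update w i.succ 0 j)),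
    ← Finset.prod_erase_mul _ _ (Finset.mem_univ i.succ)]
  simp only [Function.update_self, mul_zero, Real.cos_zero, mul_one]
  apply Finset.prod_congr rfl
  intro j hj
  rw [Function.update_of_ne (Finset.ne_of_mem_erase hj), mul_comm]

lemma infl_ge {n : ℕ} (w : Fin (n + 1) → ℝ) (i : Fin n) {σ a b : ℝ} (hσ : 0 < σ) (hb : 0 < b)
    (hba : b < a) (haw : a * σ = |w i.succ|) :
    b / 4 * ∫ t in (0:ℝ)..(π / b), D ((b / a) ^ 2) (b * t) *
      phi (Finset.univ.erase i.succ) (fun j => w j / σ) t ≤ infl (ltf n w) i := by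
  have ha : 0 < a := hb.trans hba
  have hDc := D_cont ((b / a) ^ 2)
  have hc0 : 0 ≤ (b / a) ^ 2 := by positivity
  have hc1 : (b / a) ^ 2 < 1 := by
    apply pow_lt_one₀ (by positivity) _ (by norm_num)
    rw [div_lt_one ha]; exact hba
  unfold infl unifPr
  rw [le_div_iff₀ (by positivity)]
  have hg : ∑ x : Fin n → Bool, g ((b / a) ^ 2) (rest w i x / (σ * b)) ≤
      ((Finset.univ.filter (fun x => ltf n w x ≠ ltf n w (flipAt i x))).card : ℝ) := by
    rw [Finset.card_filter]
    push_cast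
    apply Finset.sum_le_sum
    intro x _
    split_ifs with hx
    · exact g_le_one hc0 hc1.le _
    · apply g_nonpos hc0 hc1
      have h1 : |w i.succ| ≤ |rest w i x| := by
        by_contra hh
        push Not at hh
        exact hx (ltf_flip w i x hh)
      rw [← haw] at h1
      have h2 : (a * σ) ^ 2 ≤ (rest w i x) ^ 2 := by
        rw [← sq_abs (rest w i x)]; gcongr
      have h3 : (b / a) ^ 2 * (rest w i x / (σ * b)) ^ 2 = (rest w i x) ^ 2 / (a * σ) ^ 2 := by
        field_simp
      rw [h3, one_le_div (by positivity)]
      exact h2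
  refine le_trans (le_of_eq ?_) (hg.trans (le_of_eq (by congr)))
  unfold g
  rw [← Finset.mul_sum, ← intervalIntegral.integral_finsetSum]
  swap
  · intro x _
    apply Continuous.intervalIntegrable; fun_prop
  have h5 : ∀ u : ℝ, ∑ x : Fin n → Bool, D ((b / a) ^ 2) u * Real.cos (u * (rest w i x / (σ * b)))
      = 2 ^ n * (D ((b / a) ^ 2) (b * (u / b)) *
        phi (Finset.univ.erase i.succ) (fun j => w j / σ) (u / b)) := by
    intro u
    rw [← Finset.mul_sum]
    have h6 : ∀ x, u * (rest w i x / (σ * b)) = (u / (σ * b)) * rest w i x := by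
      intro x; ring
    simp_rw [h6]
    rw [sum_cos_rest]
    unfold phi
    have h7 : b * (u / b) = u := by field_simp
    have h8 : ∀ j, w j / σ * (u / b) = w j * (u / (σ * b)) := by intro j; field_simp
    simp_rw [h7, h8]
    ring
  simp_rw [h5]
  rw [intervalIntegral.integral_const_mul, intervalIntegral.integral_comp_div
    (fun t => D ((b / a) ^ 2) (b * t) * phi (Finset.univ.erase i.succ) (fun j => w j / σ) t) hb.ne']
  simp only [zero_div, smul_eq_mul]
  ring

end InfLB

/-- lower bound on the i-th influence of an LTF. -/
theorem influence_main_lower_bound (n : ℕ) (hn : 2 ≤ n) (w : Fin (n + 1) → ℝ)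
    (i : Fin n) (hw : ∃ j ∈ Finset.univ.erase i.succ, w j ≠ 0)
    (A B : ℝ)
    (hA : A = (1 / ((n : ℝ) - 1)) * ∑ j ∈ Finset.univ.erase i.succ, |w j| ^ 3)
    (hB : B = (1 / ((n : ℝ) - 1)) * ∑ j ∈ Finset.univ.erase i.succ, w j ^ 2) :
    infl (ltf n w) i ≥
      (1 / (2 * Real.sqrt (2 * Real.pi * ((n : ℝ) - 1) * B))) * (|w i.succ| - A / B)
      - |w i.succ| ^ 3 / (6 * Real.sqrt (2 * Real.pi) * (((n : ℝ) - 1) * B) ^ ((3 : ℝ) / 2))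
      - 3.4106 * A ^ ((4 : ℝ) / 3) / (((n : ℝ) - 1) ^ ((2 : ℝ) / 3) * B ^ 2) := by
  have hn1 : (0:ℝ) < (n:ℝ) - 1 := by
    have : (2:ℝ) ≤ n := by exact_mod_cast hn
    linarith
  obtain ⟨N, hN⟩ : ∃ N : ℝ, N = (n:ℝ) - 1 := ⟨_, rfl⟩
  rw [← hN] at hA hB hn1 ⊢
  obtain ⟨j0, hj0, hwj0⟩ := hw
  obtain ⟨V, hV⟩ : ∃ V, V = ∑ j ∈ Finset.univ.erase i.succ, w j ^ 2 := ⟨_, rfl⟩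
  obtain ⟨R, hR⟩ : ∃ R, R = ∑ j ∈ Finset.univ.erase i.succ, |w j| ^ 3 := ⟨_, rfl⟩
  have hVpos : 0 < V := by
    rw [hV]
    exact Finset.sum_pos' (fun j _ => sq_nonneg _) ⟨j0, hj0, by positivity⟩
  have hRpos : 0 < R := by
    rw [hR]
    exact Finset.sum_pos' (fun j _ => by positivity) ⟨j0, hj0, by positivity⟩
  rw [← hV] at hB
  rw [← hR] at hA
  have hNB : N * B = V := by rw [hB]; field_simp
  obtain ⟨σ, hσ⟩ : ∃ σ, σ = √V := ⟨_, rfl⟩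
  have hσ0 : 0 < σ := by rw [hσ]; positivity
  have hσ2 : σ ^ 2 = V := by rw [hσ]; exact Real.sq_sqrt hVpos.le
  obtain ⟨ρ, hρ⟩ : ∃ ρ, ρ = R ^ ((1:ℝ) / 3) := ⟨_, rfl⟩
  have hρ0 : 0 < ρ := by rw [hρ]; positivity
  have hρ3 : ρ ^ 3 = R := by
    rw [hρ, ← Real.rpow_natCast, ← Real.rpow_mul hRpos.le]; norm_num
  obtain ⟨ν, hν⟩ : ∃ ν, ν = N ^ ((1:ℝ) / 3) := ⟨_, rfl⟩
  have hν0 : 0 < ν := by rw [hν]; positivity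
  have hν3 : ν ^ 3 = N := by
    rw [hν, ← Real.rpow_natCast, ← Real.rpow_mul hn1.le]; norm_num
  have hAeq : A = (ρ / ν) ^ 3 := by rw [hA, div_pow, hρ3, hν3]; ring
  have hA43 : A ^ ((4:ℝ) / 3) = (ρ / ν) ^ 4 := by
    rw [hAeq, ← Real.rpow_natCast, ← Real.rpow_natCast, ← Real.rpow_mul (by positivity)]
    norm_num
  have hN23 : N ^ ((2:ℝ) / 3) = ν ^ 2 := by
    rw [← hν3, ← Real.rpow_natCast, ← Real.rpow_natCast, ← Real.rpow_mul (by positivity)]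
    norm_num
  have hBeq : B = σ ^ 2 / ν ^ 3 := by rw [hB, hσ2, hν3]; ring
  have hlast : 3.4106 * A ^ ((4:ℝ) / 3) / (N ^ ((2:ℝ) / 3) * B ^ 2) = 3.4106 * (ρ / σ) ^ 4 := by
    rw [hA43, hN23, hBeq]; field_simp
  have h32 : (N * B) ^ ((3:ℝ) / 2) = σ ^ 3 := by
    rw [hNB, ← hσ2, ← Real.rpow_natCast, ← Real.rpow_natCast, ← Real.rpow_mul (by positivity)]
    norm_num
  have hsq : √(2 * π * N * B) = √(2 * π) * σ := by
    rw [mul_assoc, hNB, Real.sqrt_mul (by positivity), hσ]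
  have hAB : A / B = ρ ^ 3 / σ ^ 2 := by rw [hAeq, hBeq]; field_simp
  rw [hlast, h32, hsq, hAB]
  obtain ⟨a, ha⟩ : ∃ a, a = |w i.succ| / σ := ⟨_, rfl⟩
  have ha0 : 0 ≤ a := by rw [ha]; positivity
  have haw : a * σ = |w i.succ| := by rw [ha]; field_simp
  rw [← haw]
  have hS0 : 0 < √(2 * π) := by positivity
  have hform : 1 / (2 * (√(2 * π) * σ)) * (a * σ - ρ ^ 3 / σ ^ 2)
      - (a * σ) ^ 3 / (6 * √(2 * π) * σ ^ 3) - 3.4106 * (ρ / σ) ^ 4 =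
      (a - (ρ / σ) ^ 3) / (2 * √(2 * π)) - a ^ 3 / (6 * √(2 * π)) - 3.4106 * (ρ / σ) ^ 4 := by
    congr 1
    field_simp
  rw [hform]
  rcases le_or_gt ((a - (ρ / σ) ^ 3) / (2 * √(2 * π)) - a ^ 3 / (6 * √(2 * π))
      - 3.4106 * (ρ / σ) ^ 4) 0 with hneg | hpos
  · refine ge_iff_le.2 (hneg.trans ?_)
    unfold infl unifPr
    positivity
  · have h2 : ∑ j ∈ Finset.univ.erase i.succ, (w j / σ) ^ 2 = 1 := by
      simp_rw [div_pow]
      rw [← Finset.sum_div, ← hV, hσ2]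
      field_simp
    have h3 : ∑ j ∈ Finset.univ.erase i.succ, |w j / σ| ^ 3 = (ρ / σ) ^ 3 := by
      simp_rw [abs_div, abs_of_pos hσ0, div_pow]
      rw [← Finset.sum_div, ← hR, hρ3]
    obtain ⟨b, hb0, hba, hle⟩ := InfLB.core_numeric (Finset.univ.erase i.succ)
      (fun j => w j / σ) (div_pos hρ0 hσ0) ha0 h2 h3 hpos
    exact hle.trans (InfLB.infl_ge w i hσ0 hb0 hba haw)
end
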